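/- arXiv:1205.2286 — 3 statements merged into one kernel-verified Lean document; each statement's English description precedes it below -/
import Mathlib

section
/- (Helton–Vinnikov) Let p ∈ ℝ[x_1, x_2] be an RZ_{x⁰} polynomial of degree m with p(x⁰) = 1. Then there exist real symmetric m×m matrices A_0, A_1, A_2 with A_0 + x⁰_1 A_1 + x⁰_2 A_2 = I_m such that det(A_0 + x_1 A_1 + x_2 A_2) = p(x_1, x_2) as polynomials in x_1, x_2. -/
/-- A polynomial `p ∈ ℝ[x_1,…,x_d]` satisfies the real zero condition with respect to
`x⁰ ∈ ℝ^d` if for every `x ∈ ℝ^d`, every complex zero of the univariate polynomial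
`t ↦ p(x⁰ + t·x)` is real. -/
def IsRZ {d : ℕ} (p : MvPolynomial (Fin d) ℝ) (x0 : Fin d → ℝ) : Prop :=
  ∀ x : Fin d → ℝ, ∀ t : ℂ,
    MvPolynomial.aeval (fun i => (x0 i : ℂ) + t * (x i : ℂ)) p = 0 → t.im = 0

/-- Indices `(i, j)` of the monomials `t ^ i * x ^ (m - i - j) * y ^ j` with `i < m`. -/
abbrev TernaryIndex (m : ℕ) : Type := Σ i : Fin m, Fin (m - i + 1)

/-- The ternary form of degree `m`, monic in `t`, with lower coefficients `c`. -/
def ternaryForm {m : ℕ} {R : Type*} [CommRing R] [Algebra ℝ R] (c : TernaryIndex m → ℝ)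
    (t x y : R) : R :=
  t ^ m + ∑ k : TernaryIndex m,
    algebraMap ℝ R (c k) * (t ^ (k.1 : ℕ) * (x ^ (m - k.1 - k.2 : ℕ) * y ^ (k.2 : ℕ)))

namespace TernaryForm

variable {m : ℕ}

theorem map {R S : Type*} [CommRing R] [Algebra ℝ R] [CommRing S] [Algebra ℝ S]
    (f : R →ₐ[ℝ] S) (c : TernaryIndex m → ℝ) (t x y : R) :
    f (ternaryForm c t x y) = ternaryForm c (f t) (f x) (f y) := by
  simp [ternaryForm]

theorem ofReal (c : TernaryIndex m → ℝ) (t x y : ℝ) :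
    ((ternaryForm c t x y : ℝ) : ℂ) = ternaryForm c (t : ℂ) (x : ℂ) (y : ℂ) :=
  map Complex.ofRealAm c t x y

theorem conj (c : TernaryIndex m → ℝ) (t : ℂ) (x y : ℝ) :
    ternaryForm c (starRingEnd ℂ t) (x : ℂ) (y : ℂ) =
      starRingEnd ℂ (ternaryForm c t (x : ℂ) (y : ℂ)) := by
  have := map Complex.conjAe.toAlgHom c t x y
  simpa using this.symm

theorem smul {R : Type*} [CommRing R] [Algebra ℝ R] (c : TernaryIndex m → ℝ) (r t x y : R) :
    ternaryForm c (r * t) (r * x) (r * y) = r ^ m * ternaryForm c t x y := by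
  simp only [ternaryForm, mul_add, Finset.mul_sum, mul_pow]
  congr 1
  refine Finset.sum_congr rfl fun k _ => ?_
  have h : r ^ m = r ^ (k.1 : ℕ) * (r ^ (m - k.1 - k.2 : ℕ) * r ^ (k.2 : ℕ)) := by
    rw [← pow_add, ← pow_add]
    congr 1
    have := k.1.2
    have := k.2.2
    omega
  rw [h]
  ring

theorem at_one_zero_zero (c : TernaryIndex m → ℝ) : ternaryForm c (1 : ℝ) 0 0 = 1 := by
  simp only [ternaryForm, one_pow, Algebra.algebraMap_self, RingHom.id_apply, one_mul]
  rw [Finset.sum_eq_zero, add_zero]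
  intro k _
  have h1 := k.1.2
  have h2 := k.2.2
  by_cases h : (k.2 : ℕ) = 0
  · rw [zero_pow (by omega : m - k.1 - k.2 ≠ 0)]; simp
  · rw [zero_pow h]; simp

open MvPolynomial in
theorem ext {c c' : TernaryIndex m → ℝ}
    (h : ∀ t x y : ℝ, ternaryForm c t x y = ternaryForm c' t x y) : c = c' := by
  have key : (ternaryForm c (X 0) (X 1) (X 2) : MvPolynomial (Fin 3) ℝ) =
      ternaryForm c' (X 0) (X 1) (X 2) := by
    refine MvPolynomial.funext fun v => ?_
    have := h (v 0) (v 1) (v 2)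
    simpa [← MvPolynomial.coe_aeval_eq_eval, map] using this
  have mono : ∀ (a : TernaryIndex m → ℝ) (k : TernaryIndex m),
      coeff (Finsupp.single 0 (k.1 : ℕ) + (Finsupp.single 1 (m - k.1 - k.2 : ℕ) +
        Finsupp.single 2 (k.2 : ℕ)))
        (ternaryForm a (X 0) (X 1) (X 2) : MvPolynomial (Fin 3) ℝ) = a k := by
    intro a k
    have hk := k.1.2
    simp only [ternaryForm, coeff_add, coeff_sum, algebraMap_eq, coeff_C_mul, X_pow_eq_monomial,
      monomial_mul, coeff_monomial]
    rw [if_neg, zero_add, Finset.sum_eq_single k]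
    · simp
    · intro l _ hl
      rw [if_neg, mul_zero]
      intro he
      apply hl
      have h0 := DFunLike.congr_fun he 0
      have h2 := DFunLike.congr_fun he 2
      simp at h0 h2
      rcases k with ⟨i, j⟩
      rcases l with ⟨i', j'⟩
      have : i' = i := Fin.ext h0
      subst this
      simp only [Sigma.mk.injEq, heq_eq_eq, true_and]
      exact Fin.ext h2
    · simp
    · intro he
      have h0 := DFunLike.congr_fun he 0
      simp at h0
      omega
  funext k
  rw [← mono c k, key, mono]

open MvPolynomial in
theorem exists_of_isHomogeneous {p : MvPolynomial (Fin 3) ℂ} (hp : p.IsHomogeneous m)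
    (h1 : (eval ![(1 : ℂ), 0, 0] p).re = 1) :
    ∃ c : TernaryIndex m → ℝ, ∀ t x y : ℝ,
      ternaryForm c t x y = (eval ![(t : ℂ), x, y] p).re := by
  suffices H : ∃ (a : ℝ) (c : TernaryIndex m → ℝ), ∀ t x y : ℝ,
      a * t ^ m + (ternaryForm c t x y - t ^ m) = (eval ![(t : ℂ), x, y] p).re by
    obtain ⟨a, c, h⟩ := H
    have ha : a = 1 := by
      have := h 1 0 0
      rw [at_one_zero_zero] at this
      simp at this h1
      rw [this, h1]
    refine ⟨c, fun t x y => ?_⟩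
    rw [← h, ha]
    ring
  rw [p.as_sum]
  have hs : ∀ d ∈ p.support, d 0 + d 1 + d 2 = m := by
    intro d hd
    have := hp (mem_support_iff.1 hd)
    rw [← this, Finsupp.weight_apply, Finsupp.sum_fintype _ _ (by simp)]
    simp [Fin.sum_univ_three]
  revert hs
  generalize p.support = s
  intro hs
  induction s using Finset.induction_on with
  | empty => exact ⟨0, 0, by simp [ternaryForm]⟩
  | insert d s hd ih =>
    obtain ⟨a, c, h⟩ := ih fun d hd' => hs d (Finset.mem_insert_of_mem hd')
    have hdm := hs d (Finset.mem_insert_self _ _)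
    have hev : ∀ t x y : ℝ, (eval ![(t : ℂ), x, y] (monomial d (coeff d p))).re =
        (coeff d p).re * (t ^ d 0 * (x ^ d 1 * y ^ d 2)) := by
      intro t x y
      rw [eval_monomial, Finsupp.prod_fintype _ _ (by simp)]
      simp only [Fin.prod_univ_three, Matrix.cons_val]
      rw [← Complex.re_mul_ofReal]
      push_cast
      congr 1
      ring
    by_cases hm : d 0 < m
    · set k : TernaryIndex m := ⟨⟨d 0, hm⟩, ⟨d 2, by simp; omega⟩⟩
      have h1 : m - d 0 - d 2 = d 1 := by omega
      have hsum : ∀ t x y : ℝ, ∑ l : TernaryIndex m, (Pi.single k (coeff d p).re :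
          TernaryIndex m → ℝ) l * (t ^ (l.1 : ℕ) * (x ^ (m - l.1 - l.2 : ℕ) * y ^ (l.2 : ℕ))) =
          (coeff d p).re * (t ^ d 0 * (x ^ d 1 * y ^ d 2)) := by
        intro t x y
        rw [Finset.sum_eq_single k (fun l _ hl => by rw [Pi.single_eq_of_ne hl, zero_mul])
          (by simp)]
        have h2 : m - (k.1 : ℕ) - (k.2 : ℕ) = d 1 := h1
        rw [Pi.single_eq_same, h2]
      refine ⟨a, c + Pi.single k (coeff d p).re, fun t x y => ?_⟩
      rw [Finset.sum_insert hd, map_add, Complex.add_re, hev, ← h]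
      simp only [ternaryForm, Pi.add_apply, Algebra.algebraMap_self, RingHom.id_apply, add_mul,
        Finset.sum_add_distrib, hsum]
      ring
    · have h0 : d 0 = m := by omega
      have h1 : d 1 = 0 := by omega
      have h2 : d 2 = 0 := by omega
      refine ⟨a + (coeff d p).re, c, fun t x y => ?_⟩
      rw [Finset.sum_insert hd, map_add, Complex.add_re, hev, ← h, h0, h1, h2]
      ring

/-- Evaluation of the non-leading part of a ternary form, as a functional of its coefficients. -/
def lowerEval (m : ℕ) (p : ℝ × ℝ × ℝ) : Module.Dual ℝ (TernaryIndex m → ℝ) where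
  toFun c := ternaryForm c p.1 p.2.1 p.2.2 - p.1 ^ m
  map_add' c c' := by
    simp [ternaryForm, add_mul, Finset.sum_add_distrib]
  map_smul' r c := by
    simp [ternaryForm, Finset.mul_sum, mul_assoc]

theorem lowerEval_apply (p : ℝ × ℝ × ℝ) (c : TernaryIndex m → ℝ) :
    lowerEval m p c = ternaryForm c p.1 p.2.1 p.2.2 - p.1 ^ m := rfl

theorem exists_interpolation (k : TernaryIndex m) :
    ∃ w : (ℝ × ℝ × ℝ) →₀ ℝ, ∀ c : TernaryIndex m → ℝ,
      c k = w.sum fun p a => a * (ternaryForm c p.1 p.2.1 p.2.2 - p.1 ^ m) := by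
  have htop : Submodule.span ℝ (Set.range (lowerEval m)) = ⊤ := by
    rw [← Subspace.dualCoannihilator_dualAnnihilator_eq
      (W := Submodule.span ℝ (Set.range (lowerEval m)))]
    suffices h : (Submodule.span ℝ (Set.range (lowerEval m))).dualCoannihilator = ⊥ by
      rw [h, Submodule.dualAnnihilator_bot]
    rw [Submodule.eq_bot_iff]
    intro c hc
    rw [Submodule.mem_dualCoannihilator] at hc
    refine ext fun t x y => ?_
    have h1 := hc _ (Submodule.subset_span ⟨(t, x, y), rfl⟩)
    have h2 := (lowerEval m (t, x, y)).map_zero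
    rw [lowerEval_apply] at h1 h2
    linarith
  have hk : (LinearMap.proj k : Module.Dual ℝ (TernaryIndex m → ℝ)) ∈
      Submodule.span ℝ (Set.range (lowerEval m)) := htop ▸ Submodule.mem_top
  obtain ⟨w, hw⟩ := (Finsupp.mem_span_range_iff_exists_finsupp).1 hk
  refine ⟨w, fun c => ?_⟩
  have := congrArg (fun f : Module.Dual ℝ (TernaryIndex m → ℝ) => f c) hw
  simp only [Finsupp.sum, LinearMap.coe_proj, Function.eval, LinearMap.sum_apply,
    LinearMap.smul_apply, smul_eq_mul] at this
  rw [← this]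
  rfl

theorem continuous_of_eval {E : Type*} [TopologicalSpace E] {G : E → TernaryIndex m → ℝ}
    (h : ∀ t x y : ℝ, Continuous fun e => ternaryForm (G e) t x y) : Continuous G := by
  refine continuous_pi fun k => ?_
  obtain ⟨w, hw⟩ := exists_interpolation k
  simp only [hw, Finsupp.sum]
  exact continuous_finsetSum _ fun p _ => continuous_const.mul ((h _ _ _).sub continuous_const)

theorem contDiff_of_eval {E : Type*} [NormedAddCommGroup E] [NormedSpace ℝ E]
    {G : E → TernaryIndex m → ℝ}
    (h : ∀ t x y : ℝ, ContDiff ℝ 1 fun e => ternaryForm (G e) t x y) : ContDiff ℝ 1 G := by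
  refine contDiff_pi.2 fun k => ?_
  obtain ⟨w, hw⟩ := exists_interpolation k
  simp only [hw, Finsupp.sum]
  exact ContDiff.sum fun p _ => contDiff_const.mul ((h _ _ _).sub contDiff_const)

theorem continuous_eval {R : Type*} [CommRing R] [Algebra ℝ R] [TopologicalSpace R]
    [IsTopologicalRing R] [ContinuousSMul ℝ R] :
    Continuous fun q : (TernaryIndex m → ℝ) × R × R × R =>
      ternaryForm q.1 q.2.1 q.2.2.1 q.2.2.2 := by
  have := continuous_algebraMap ℝ R
  unfold ternaryForm
  fun_prop

end TernaryForm

open Polynomial in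
/-- The restriction of a ternary form to a line in the direction of `t`. -/
noncomputable def linePoly {m : ℕ} (c : TernaryIndex m → ℝ) (x y : ℂ) : ℂ[X] :=
  ternaryForm c X (C x) (C y)

/-- Coefficients of ternary forms whose restriction to every real line in the direction of `t`
has only real simple zeros. -/
def strictlyHyperbolic (m : ℕ) : Set (TernaryIndex m → ℝ) :=
  {c | ∀ x y : ℝ, (x ≠ 0 ∨ y ≠ 0) → ∀ t : ℂ, ternaryForm c t (x : ℂ) (y : ℂ) = 0 →
    t.im = 0 ∧ (linePoly c x y).derivative.eval t ≠ 0}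

namespace TernaryForm

variable {m : ℕ}

open Polynomial in
theorem linePoly_eval (c : TernaryIndex m → ℝ) (t x y : ℂ) :
    (linePoly c x y).eval t = ternaryForm c t x y := by
  have := map ((Polynomial.aeval t : ℂ[X] →ₐ[ℂ] ℂ).restrictScalars ℝ) c X (C x) (C y)
  simpa [linePoly] using this

/-- The divided difference `(P (t, x, y) - P (s, x, y)) / (t - s)` of a ternary form `P`. -/
def divDiff (c : TernaryIndex m → ℝ) (t s x y : ℂ) : ℂ :=
  ∑ a ∈ Finset.range m, t ^ a * s ^ (m - 1 - a) + ∑ k : TernaryIndex m,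
    (c k : ℂ) * ((∑ a ∈ Finset.range k.1, t ^ a * s ^ (k.1 - 1 - a : ℕ)) *
      (x ^ (m - k.1 - k.2 : ℕ) * y ^ (k.2 : ℕ)))

theorem divDiff_mul (c : TernaryIndex m → ℝ) (t s x y : ℂ) :
    divDiff c t s x y * (t - s) = ternaryForm c t x y - ternaryForm c s x y := by
  have h : ∀ n : ℕ, t ^ n - s ^ n = (∑ a ∈ Finset.range n, t ^ a * s ^ (n - 1 - a)) * (t - s) :=
    fun n => (geom_sum₂_mul t s n).symm
  rw [divDiff, ternaryForm, ternaryForm, add_mul, ← h, add_sub_add_comm, ← Finset.sum_sub_distrib,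
    Finset.sum_mul]
  congr 1
  refine Finset.sum_congr rfl fun k _ => ?_
  have := h k.1
  simp only [Complex.coe_algebraMap]
  linear_combination (-(c k : ℂ) * (x ^ (m - k.1 - k.2 : ℕ) * y ^ (k.2 : ℕ))) * this

theorem divDiff_self (c : TernaryIndex m → ℝ) (t x y : ℂ) :
    divDiff c t t x y = (linePoly c x y).derivative.eval t := by
  have h : ∀ k : TernaryIndex m, algebraMap ℝ (Polynomial ℂ) (c k) = Polynomial.C (c k : ℂ) :=
    fun k => rfl
  have hC : ∀ a b : ℕ, (Polynomial.C x ^ a * Polynomial.C y ^ b : Polynomial ℂ) =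
      Polynomial.C (x ^ a * y ^ b) := fun a b => by simp
  simp only [divDiff, linePoly, ternaryForm, h, hC, geom_sum₂_self, Polynomial.derivative_add,
    Polynomial.derivative_sum, Polynomial.derivative_mul,
    Polynomial.derivative_X_pow, Polynomial.derivative_C, mul_zero, zero_mul, zero_add, add_zero,
    Polynomial.eval_add, Polynomial.eval_finsetSum, Polynomial.eval_mul, Polynomial.eval_C,
    Polynomial.eval_pow, Polynomial.eval_X]

theorem divDiff_smul (c : TernaryIndex m → ℝ) (r t s x y : ℂ) :
    r * divDiff c (r * t) (r * s) (r * x) (r * y) = r ^ m * divDiff c t s x y := by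
  have h : ∀ n : ℕ, r * ∑ a ∈ Finset.range n, (r * t) ^ a * (r * s) ^ (n - 1 - a) =
      r ^ n * ∑ a ∈ Finset.range n, t ^ a * s ^ (n - 1 - a) := by
    intro n
    rw [Finset.mul_sum, Finset.mul_sum]
    refine Finset.sum_congr rfl fun a ha => ?_
    have ha := Finset.mem_range.1 ha
    have : r ^ n = r * (r ^ a * r ^ (n - 1 - a)) := by
      rw [← pow_add, ← pow_succ']
      congr 1
      omega
    rw [this, mul_pow, mul_pow]
    ring
  rw [divDiff, divDiff, mul_add, mul_add, h, Finset.mul_sum (s := Finset.univ),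
    Finset.mul_sum (s := Finset.univ)]
  congr 1
  refine Finset.sum_congr rfl fun k _ => ?_
  have hr : r ^ m = r ^ (k.1 : ℕ) * (r ^ (m - k.1 - k.2 : ℕ) * r ^ (k.2 : ℕ)) := by
    rw [← pow_add, ← pow_add]
    congr 1
    have := k.1.2
    have := k.2.2
    omega
  rw [hr, mul_pow, mul_pow]
  linear_combination (c k : ℂ) * r ^ (m - k.1 - k.2 : ℕ) * r ^ (k.2 : ℕ) *
    (x ^ (m - k.1 - k.2 : ℕ) * y ^ (k.2 : ℕ)) * h k.1

theorem continuous_divDiff :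
    Continuous fun q : (TernaryIndex m → ℝ) × ℂ × ℝ × ℝ =>
      divDiff q.1 q.2.1 (starRingEnd ℂ q.2.1) q.2.2.1 q.2.2.2 := by
  unfold divDiff
  have : Continuous fun z : ℂ => starRingEnd ℂ z := Complex.continuous_conj
  fun_prop

theorem mem_strictlyHyperbolic_iff {c : TernaryIndex m → ℝ} :
    c ∈ strictlyHyperbolic m ↔ ∀ q ∈ Metric.sphere (0 : ℂ × ℝ × ℝ) 1,
      ¬ (ternaryForm c q.1 (q.2.1 : ℂ) (q.2.2 : ℂ) = 0 ∧
        divDiff c q.1 (starRingEnd ℂ q.1) (q.2.1 : ℂ) (q.2.2 : ℂ) = 0) := by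
  constructor
  · rintro hc ⟨t, x, y⟩ hq ⟨h0, h1⟩
    by_cases hxy : x ≠ 0 ∨ y ≠ 0
    · obtain ⟨him, hd⟩ := hc x y hxy t h0
      rw [Complex.conj_eq_iff_im.2 him, divDiff_self] at h1
      exact hd h1
    · push Not at hxy
      obtain ⟨rfl, rfl⟩ := hxy
      have ht : t ≠ 0 := by
        rintro rfl
        simp at hq
      have h2 := smul c t 1 0 0
      have h3 := ofReal c 1 0 0
      rw [at_one_zero_zero] at h3
      simp only [mul_one, mul_zero] at h2
      simp only [Complex.ofReal_one, Complex.ofReal_zero] at h3 h0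
      rw [h0, ← h3, mul_one] at h2
      exact pow_ne_zero m ht h2.symm
  · intro h x y hxy t ht
    have hq0 : ((t, x, y) : ℂ × ℝ × ℝ) ≠ 0 := by
      intro h
      simp only [Prod.mk_eq_zero] at h
      rcases hxy with hx | hy
      · exact hx h.2.1
      · exact hy h.2.2
    have hn : (‖((t, x, y) : ℂ × ℝ × ℝ)‖) ≠ 0 := norm_ne_zero_iff.2 hq0
    set r : ℝ := (‖((t, x, y) : ℂ × ℝ × ℝ)‖)⁻¹ with hr
    have hr0 : (r : ℂ) ≠ 0 := by
      rw [Ne, Complex.ofReal_eq_zero]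
      exact inv_ne_zero hn
    have hmem : r • ((t, x, y) : ℂ × ℝ × ℝ) ∈ Metric.sphere (0 : ℂ × ℝ × ℝ) 1 := by
      rw [mem_sphere_zero_iff_norm, norm_smul, hr, norm_inv, norm_norm, inv_mul_cancel₀ hn]
    have h1 := h _ hmem
    simp only [Prod.smul_mk, Complex.real_smul, smul_eq_mul, Complex.ofReal_mul, map_mul,
      Complex.conj_ofReal, smul, ht, mul_zero, true_and] at h1
    have h2 := divDiff_smul c r t (starRingEnd ℂ t) x y
    have h3 : divDiff c t (starRingEnd ℂ t) x y ≠ 0 := by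
      intro h4
      rw [h4, mul_zero] at h2
      exact h1 ((mul_eq_zero.1 h2).resolve_left hr0)
    have h5 := divDiff_mul c t (starRingEnd ℂ t) x y
    rw [conj, ht, map_zero, sub_zero] at h5
    have h6 := (mul_eq_zero.1 h5).resolve_left h3
    have him : t.im = 0 := Complex.conj_eq_iff_im.1 (sub_eq_zero.1 h6).symm
    refine ⟨him, ?_⟩
    rwa [Complex.conj_eq_iff_im.2 him, divDiff_self] at h3

theorem isOpen_strictlyHyperbolic : IsOpen (strictlyHyperbolic m) := by
  have hbad : IsClosed {q : (TernaryIndex m → ℝ) × Metric.sphere (0 : ℂ × ℝ × ℝ) 1 |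
      ternaryForm q.1 q.2.1.1 (q.2.1.2.1 : ℂ) (q.2.1.2.2 : ℂ) = 0 ∧
        divDiff q.1 q.2.1.1 (starRingEnd ℂ q.2.1.1) (q.2.1.2.1 : ℂ) (q.2.1.2.2 : ℂ) = 0} := by
    refine IsClosed.inter (isClosed_eq ?_ continuous_const) (isClosed_eq ?_ continuous_const)
    · exact (continuous_eval (m := m) (R := ℂ)).comp (f := fun q : (TernaryIndex m → ℝ) ×
        Metric.sphere (0 : ℂ × ℝ × ℝ) 1 => (q.1, q.2.1.1, (q.2.1.2.1 : ℂ), (q.2.1.2.2 : ℂ)))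
        (by fun_prop)
    · exact (continuous_divDiff (m := m)).comp (f := fun q : (TernaryIndex m → ℝ) ×
        Metric.sphere (0 : ℂ × ℝ × ℝ) 1 => (q.1, q.2.1.1, q.2.1.2.1, q.2.1.2.2)) (by fun_prop)
  have : strictlyHyperbolic m = (Prod.fst '' {q : (TernaryIndex m → ℝ) ×
      Metric.sphere (0 : ℂ × ℝ × ℝ) 1 |
      ternaryForm q.1 q.2.1.1 (q.2.1.2.1 : ℂ) (q.2.1.2.2 : ℂ) = 0 ∧
        divDiff q.1 q.2.1.1 (starRingEnd ℂ q.2.1.1) (q.2.1.2.1 : ℂ) (q.2.1.2.2 : ℂ) = 0})ᶜ := by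
    ext c
    rw [mem_strictlyHyperbolic_iff]
    constructor
    · rintro h ⟨⟨c', q⟩, hq, rfl⟩
      exact h q.1 q.2 hq
    · intro h q hq hbad
      exact h ⟨(c, ⟨q, hq⟩), hbad, rfl⟩
  rw [this, isOpen_compl_iff]
  exact isClosedMap_fst_of_compactSpace _ hbad

end TernaryForm

namespace TernaryForm

variable {m : ℕ}

theorem degree_linePoly_sub_lt (c : TernaryIndex m → ℝ) (x y : ℂ) :
    (linePoly c x y - Polynomial.X ^ m).degree < (m : WithBot ℕ) := by
  unfold linePoly ternaryForm
  rw [add_sub_cancel_left]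
  refine lt_of_le_of_lt (Polynomial.degree_sum_le _ _)
    ((Finset.sup_lt_iff (WithBot.bot_lt_coe m)).2 fun k _ => ?_)
  rw [← Polynomial.C_pow, ← Polynomial.C_pow, ← Polynomial.C_mul,
    mul_comm (Polynomial.X ^ _), ← mul_assoc]
  have h : algebraMap ℝ (Polynomial ℂ) (c k) = Polynomial.C (c k : ℂ) := rfl
  rw [h, ← Polynomial.C_mul]
  refine lt_of_le_of_lt (Polynomial.degree_C_mul_X_pow_le _ _) ?_
  exact WithBot.coe_lt_coe.2 k.1.2

theorem linePoly_monic (c : TernaryIndex m → ℝ) (x y : ℂ) : (linePoly c x y).Monic := by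
  rw [← add_sub_cancel (Polynomial.X ^ m) (linePoly c x y)]
  exact Polynomial.monic_X_pow_add (degree_linePoly_sub_lt c x y)

theorem linePoly_natDegree (c : TernaryIndex m → ℝ) (x y : ℂ) :
    (linePoly c x y).natDegree = m := by
  rw [← add_sub_cancel (Polynomial.X ^ m) (linePoly c x y),
    Polynomial.natDegree_add_eq_left_of_degree_lt, Polynomial.natDegree_X_pow]
  rw [Polynomial.degree_X_pow]
  exact degree_linePoly_sub_lt c x y

end TernaryForm

theorem Multiset.prod_map_lt_prod_map_of_nonneg {ι : Type*} {s : Multiset ι} {f g : ι → ℝ}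
    (hs : s ≠ 0) (hf : ∀ i ∈ s, 0 ≤ f i) (h : ∀ i ∈ s, f i < g i) :
    (s.map f).prod < (s.map g).prod := by
  have key : ∀ s : Multiset ι, (∀ i ∈ s, 0 ≤ f i) → (∀ i ∈ s, f i < g i) →
      0 ≤ (s.map f).prod ∧ 0 < (s.map g).prod ∧ (s.map f).prod ≤ (s.map g).prod := by
    intro s
    induction s using Multiset.induction_on with
    | empty => simp
    | cons a s ih =>
      intro hf h
      obtain ⟨h1, h2, h3⟩ := ih (fun i hi => hf i (Multiset.mem_cons_of_mem hi))
        (fun i hi => h i (Multiset.mem_cons_of_mem hi))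
      have ha := hf a (Multiset.mem_cons_self _ _)
      have hb := h a (Multiset.mem_cons_self _ _)
      simp only [Multiset.map_cons, Multiset.prod_cons]
      exact ⟨mul_nonneg ha h1, mul_pos (ha.trans_lt hb) h2,
        mul_le_mul hb.le h3 h1 (ha.trans hb.le)⟩
  obtain ⟨a, ha⟩ := Multiset.exists_mem_of_ne_zero hs
  obtain ⟨s, rfl⟩ := Multiset.exists_cons_of_mem ha
  obtain ⟨h1, h2, h3⟩ := key s (fun i hi => hf i (Multiset.mem_cons_of_mem hi))
    (fun i hi => h i (Multiset.mem_cons_of_mem hi))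
  simp only [Multiset.map_cons, Multiset.prod_cons]
  exact mul_lt_mul_of_lt_of_le_of_nonneg_of_pos (h a ha) h3 (hf a ha) h2

namespace Polynomial

theorem Monic.eval_eq_prod_roots {p : ℂ[X]} (hp : p.Monic) (z : ℂ) :
    p.eval z = (p.roots.map fun r => z - r).prod := by
  conv_lhs => rw [(IsAlgClosed.splits p).eq_prod_roots_of_monic hp]
  rw [eval_multiset_prod, Multiset.map_map]
  simp

theorem Monic.norm_eval_lt_of_real_roots {p : ℂ[X]} (hp : p.Monic) (hd : p.natDegree ≠ 0)
    (hr : ∀ z, p.eval z = 0 → z.im = 0) {z w : ℂ} (hre : z.re = w.re) (him : z.im ^ 2 < w.im ^ 2) :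
    ‖p.eval z‖ < ‖p.eval w‖ := by
  rw [hp.eval_eq_prod_roots, hp.eval_eq_prod_roots]
  have hn : ∀ s : Multiset ℂ, ‖s.prod‖ = (s.map fun z => ‖z‖).prod := fun s =>
    map_multiset_prod (normHom : ℂ →*₀ ℝ) s
  rw [hn, hn, Multiset.map_map, Multiset.map_map]
  refine Multiset.prod_map_lt_prod_map_of_nonneg ?_ (fun _ _ => norm_nonneg _) ?_
  · intro h
    apply hd
    rw [(IsAlgClosed.splits p).natDegree_eq_card_roots, h, Multiset.card_zero]
  · intro r hmem
    have h0 := hr r (isRoot_of_mem_roots hmem)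
    refine lt_of_pow_lt_pow_left₀ 2 (norm_nonneg _) ?_
    simp only [Function.comp, Complex.sq_norm, Complex.normSq_apply, Complex.sub_re,
      Complex.sub_im, h0, hre]
    nlinarith

theorem im_logDeriv_neg_of_real_roots {p : ℂ[X]} (hd : p.natDegree ≠ 0)
    (hr : ∀ z, p.eval z = 0 → z.im = 0) {z : ℂ} (hz : 0 < z.im) :
    (p.derivative.eval z / p.eval z).im < 0 := by
  have h0 : p.eval z ≠ 0 := fun h => hz.ne' (hr z h)
  rw [Splits.eval_derivative_div_eval_of_ne_zero (IsAlgClosed.splits p) h0]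
  have him : ∀ s : Multiset ℂ, s.sum.im = (s.map Complex.im).sum := fun s =>
    map_multiset_sum Complex.imAddGroupHom s
  rw [him, Multiset.map_map]
  have hne : p.roots ≠ 0 := by
    intro h
    apply hd
    rw [(IsAlgClosed.splits p).natDegree_eq_card_roots, h, Multiset.card_zero]
  have key : ∀ r ∈ p.roots, (Complex.im ∘ fun r => 1 / (z - r)) r < 0 := by
    intro r hmem
    have h1 := hr r (isRoot_of_mem_roots hmem)
    have h2 : z - r ≠ 0 := fun h => by
      have := congrArg Complex.im h
      simp [h1] at this
      exact hz.ne' this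
    simp only [Function.comp, one_div, Complex.inv_im, Complex.sub_im, h1, sub_zero]
    exact div_neg_of_neg_of_pos (neg_neg_of_pos hz) (Complex.normSq_pos.2 h2)
  obtain ⟨a, ha⟩ := Multiset.exists_mem_of_ne_zero hne
  obtain ⟨s, hs⟩ := Multiset.exists_cons_of_mem ha
  rw [hs] at key ⊢
  rw [Multiset.map_cons, Multiset.sum_cons]
  have h1 := key a (Multiset.mem_cons_self _ _)
  have h2 : (s.map (Complex.im ∘ fun r => 1 / (z - r))).sum ≤ 0 := by
    refine Multiset.sum_induction (· ≤ 0) _ (fun a b => add_nonpos) le_rfl fun x hx => ?_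
    obtain ⟨r, hr, rfl⟩ := Multiset.mem_map.1 hx
    exact (key r (Multiset.mem_cons_of_mem hr)).le
  linarith

/-- If all zeros of `p` are real, then the zeros of `p (X + ia) + p (X - ia)` are real. -/
theorem Monic.im_eq_zero_of_shift_add_shift {p : ℂ[X]} (hp : p.Monic) (hd : p.natDegree ≠ 0)
    (hr : ∀ z, p.eval z = 0 → z.im = 0) {a : ℝ} (ha : a ≠ 0) {t : ℂ}
    (ht : p.eval (t + a * Complex.I) + p.eval (t - a * Complex.I) = 0) : t.im = 0 := by
  by_contra him
  have hn : ‖p.eval (t + a * Complex.I)‖ = ‖p.eval (t - a * Complex.I)‖ := by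
    rw [eq_neg_of_add_eq_zero_left ht, norm_neg]
  rcases lt_or_gt_of_ne (mul_ne_zero ha him) with h | h
  · refine (hp.norm_eval_lt_of_real_roots hd hr (z := t + a * Complex.I)
      (w := t - a * Complex.I) (by simp) ?_).ne hn
    simp
    nlinarith
  · refine (hp.norm_eval_lt_of_real_roots hd hr (z := t - a * Complex.I)
      (w := t + a * Complex.I) (by simp) ?_).ne hn.symm
    simp
    nlinarith

/-- If all zeros of `p` are real, then the real zeros of `p (X + ia) + p (X - ia)` are simple. -/
theorem derivative_shift_add_shift_ne_zero {p : ℂ[X]} (hd : p.natDegree ≠ 0)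
    (hr : ∀ z, p.eval z = 0 → z.im = 0) {a : ℝ} (ha : a ≠ 0) {t : ℂ} (him : t.im = 0)
    (hconj : ∀ z, p.eval (starRingEnd ℂ z) = starRingEnd ℂ (p.eval z))
    (hconj' : ∀ z, p.derivative.eval (starRingEnd ℂ z) = starRingEnd ℂ (p.derivative.eval z))
    (ht : p.eval (t + a * Complex.I) + p.eval (t - a * Complex.I) = 0) :
    p.derivative.eval (t + a * Complex.I) + p.derivative.eval (t - a * Complex.I) ≠ 0 := by
  intro hdt
  have hc : ∀ b : ℝ, starRingEnd ℂ (t + b * Complex.I) = t - b * Complex.I := by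
    intro b
    simp [Complex.conj_eq_iff_im.2 him, sub_eq_add_neg]
  have key : ∀ b : ℝ, 0 < b → p.eval (t + b * Complex.I) + p.eval (t - b * Complex.I) = 0 →
      p.derivative.eval (t + b * Complex.I) + p.derivative.eval (t - b * Complex.I) = 0 →
      False := by
    intro b hb h0 h1
    have hlt := im_logDeriv_neg_of_real_roots hd hr (z := t + b * Complex.I) (by simp [him, hb])
    rw [← hc, hconj] at h0
    rw [← hc, hconj'] at h1
    have e : p.derivative.eval (t + b * Complex.I) / p.eval (t + b * Complex.I) =
        starRingEnd ℂ (p.derivative.eval (t + b * Complex.I) / p.eval (t + b * Complex.I)) := by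
      rw [map_div₀, eq_neg_of_add_eq_zero_right h0, eq_neg_of_add_eq_zero_right h1, neg_div_neg_eq]
    exact hlt.ne (Complex.conj_eq_iff_im.1 e.symm)
  rcases lt_or_gt_of_ne ha with h | h
  · refine key (-a) (by linarith) ?_ ?_
    · rw [← ht]; push_cast; ring_nf
    · rw [← hdt]; push_cast; ring_nf
  · exact key a h ht hdt

end Polynomial

theorem MvPolynomial.eq_of_eval_ofReal_eq {n : ℕ} {p q : MvPolynomial (Fin n) ℂ}
    (h : ∀ v : Fin n → ℝ, eval (fun i => (v i : ℂ)) p = eval (fun i => (v i : ℂ)) q) : p = q := by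
  refine MvPolynomial.funext_set (fun _ => Set.range ((↑) : ℝ → ℂ))
    (fun _ => Set.infinite_range_of_injective Complex.ofReal_injective) fun x hx => ?_
  choose v hv using fun i => hx i (Set.mem_univ i)
  have : x = fun i => (v i : ℂ) := _root_.funext fun i => (hv i).symm
  rw [this]
  exact h v

/-- Coefficients of ternary forms whose restriction to every real line in the direction of `t`
has only real zeros. -/
def weaklyHyperbolic (m : ℕ) : Set (TernaryIndex m → ℝ) :=
  {c | ∀ x y : ℝ, ∀ t : ℂ, ternaryForm c t (x : ℂ) (y : ℂ) = 0 → t.im = 0}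

namespace TernaryForm

variable {m : ℕ}

open MvPolynomial in
theorem isHomogeneous_ternaryForm {R σ : Type*} [CommRing R] [Algebra ℝ R]
    (c : TernaryIndex m → ℝ) {p q r : MvPolynomial σ R} (hp : p.IsHomogeneous 1)
    (hq : q.IsHomogeneous 1) (hr : r.IsHomogeneous 1) :
    (ternaryForm c p q r).IsHomogeneous m := by
  refine IsHomogeneous.add (by simpa using hp.pow m) (IsHomogeneous.sum _ _ _ fun k _ => ?_)
  have hC : (algebraMap ℝ (MvPolynomial σ R) (c k)).IsHomogeneous 0 := by
    rw [IsScalarTower.algebraMap_apply ℝ R (MvPolynomial σ R)]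
    exact isHomogeneous_C _ _
  have := hC.mul ((hp.pow k.1).mul ((hq.pow (m - k.1 - k.2)).mul (hr.pow k.2)))
  have hk := k.1.2
  have hk' := k.2.2
  rwa [show 0 + (1 * (k.1 : ℕ) + (1 * (m - k.1 - k.2) + 1 * (k.2 : ℕ))) = m by omega] at this

open MvPolynomial in
theorem eval_ternaryForm {σ : Type*} (v : σ → ℂ) (c : TernaryIndex m → ℝ)
    (p q r : MvPolynomial σ ℂ) :
    eval v (ternaryForm c p q r) = ternaryForm c (eval v p) (eval v q) (eval v r) := by
  have := map ((MvPolynomial.aeval v : MvPolynomial σ ℂ →ₐ[ℂ] ℂ).restrictScalars ℝ) c p q r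
  simpa [coe_aeval_eq_eval] using this

open MvPolynomial in
theorem exists_shiftAverage (a b : ℝ) (c : TernaryIndex m → ℝ) :
    ∃ c' : TernaryIndex m → ℝ, ∀ t x y : ℂ, 2 * ternaryForm c' t x y =
      ternaryForm c (t + (a * x + b * y) * Complex.I) x y +
      ternaryForm c (t - (a * x + b * y) * Complex.I) x y := by
  set P : MvPolynomial (Fin 3) ℂ := ternaryForm c
    (X 0 + (C (a : ℂ) * X 1 + C (b : ℂ) * X 2) * C Complex.I) (X 1) (X 2) with hP
  set Q : MvPolynomial (Fin 3) ℂ := ternaryForm c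
    (X 0 - (C (a : ℂ) * X 1 + C (b : ℂ) * X 2) * C Complex.I) (X 1) (X 2) with hQ
  have hl : ((C (a : ℂ) * X 1 + C (b : ℂ) * X 2) * C Complex.I :
      MvPolynomial (Fin 3) ℂ).IsHomogeneous 1 := by
    have := (((isHomogeneous_C _ (a : ℂ)).mul (isHomogeneous_X ℂ (1 : Fin 3))).add
      ((isHomogeneous_C _ (b : ℂ)).mul (isHomogeneous_X ℂ (2 : Fin 3)))).mul
      (isHomogeneous_C _ Complex.I)
    simpa using this
  have hPh : P.IsHomogeneous m := isHomogeneous_ternaryForm c ((isHomogeneous_X _ _).add hl)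
    (isHomogeneous_X _ _) (isHomogeneous_X _ _)
  have h1 : (eval ![(1 : ℂ), 0, 0] P).re = 1 := by
    rw [hP, eval_ternaryForm]
    have := ofReal c 1 0 0
    simp only [at_one_zero_zero, Complex.ofReal_one, Complex.ofReal_zero] at this
    simp [← this]
  obtain ⟨c', hc'⟩ := exists_of_isHomogeneous hPh h1
  refine ⟨c', ?_⟩
  have key : C 2 * (ternaryForm c' (X 0) (X 1) (X 2) : MvPolynomial (Fin 3) ℂ) = P + Q := by
    refine MvPolynomial.eq_of_eval_ofReal_eq fun v => ?_
    have e0 : eval (fun i => (v i : ℂ)) (ternaryForm c' (X 0) (X 1) (X 2)) =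
        ((ternaryForm c' (v 0) (v 1) (v 2) : ℝ) : ℂ) := by
      rw [ofReal, eval_ternaryForm, eval_X, eval_X, eval_X]
    have e1 : (![(v 0 : ℂ), v 1, v 2] : Fin 3 → ℂ) = fun i => (v i : ℂ) := by
      ext i
      fin_cases i <;> rfl
    have e2 : eval (fun i => (v i : ℂ)) Q = starRingEnd ℂ (eval (fun i => (v i : ℂ)) P) := by
      rw [hP, hQ, eval_ternaryForm, eval_ternaryForm]
      simp only [eval_X]
      rw [← conj]
      simp [sub_eq_add_neg]
    rw [map_mul, e0, hc', map_add, e2, e1, eval_C, Complex.re_eq_add_conj]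
    ring
  intro t x y
  have := congrArg (eval ![t, x, y]) key
  rw [map_mul, map_add, hP, hQ, eval_ternaryForm, eval_ternaryForm, eval_ternaryForm] at this
  simpa using this

/-- The average of the two translates of a ternary form by `± i (a x + b y)` in `t`. -/
noncomputable def shiftAverage (a b : ℝ) (c : TernaryIndex m → ℝ) : TernaryIndex m → ℝ :=
  (exists_shiftAverage a b c).choose

theorem two_mul_shiftAverage (a b : ℝ) (c : TernaryIndex m → ℝ) (t x y : ℂ) :
    2 * ternaryForm (shiftAverage a b c) t x y =
      ternaryForm c (t + (a * x + b * y) * Complex.I) x y +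
      ternaryForm c (t - (a * x + b * y) * Complex.I) x y :=
  (exists_shiftAverage a b c).choose_spec t x y

theorem linePoly_shiftAverage (a b : ℝ) (c : TernaryIndex m → ℝ) (x y : ℂ) :
    Polynomial.C 2 * linePoly (shiftAverage a b c) x y =
      (linePoly c x y).comp (Polynomial.X + Polynomial.C ((a * x + b * y) * Complex.I)) +
      (linePoly c x y).comp (Polynomial.X - Polynomial.C ((a * x + b * y) * Complex.I)) := by
  refine Polynomial.funext fun t => ?_
  simpa [linePoly_eval] using two_mul_shiftAverage a b c t x y

theorem derivative_linePoly_shiftAverage (a b : ℝ) (c : TernaryIndex m → ℝ) (t x y : ℂ) :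
    2 * (linePoly (shiftAverage a b c) x y).derivative.eval t =
      (linePoly c x y).derivative.eval (t + (a * x + b * y) * Complex.I) +
      (linePoly c x y).derivative.eval (t - (a * x + b * y) * Complex.I) := by
  have := congrArg (fun p => p.derivative.eval t) (linePoly_shiftAverage a b c x y)
  simpa [Polynomial.derivative_comp] using this

theorem linePoly_shiftAverage_of_eq_zero (c : TernaryIndex m → ℝ) {a b x y : ℝ}
    (hl : a * x + b * y = 0) : (linePoly (shiftAverage a b c) x y) = linePoly c x y := by
  refine Polynomial.funext fun t => ?_
  have h := two_mul_shiftAverage a b c t x y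
  have hl' : (a * x + b * y : ℂ) = 0 := by exact_mod_cast hl
  rw [hl', zero_mul, add_zero, sub_zero, ← two_mul] at h
  rw [linePoly_eval, linePoly_eval]
  exact mul_left_cancel₀ two_ne_zero h

theorem shiftAverage_zero (c : TernaryIndex m → ℝ) : shiftAverage 0 0 c = c := by
  refine ext fun t x y => ?_
  have := two_mul_shiftAverage 0 0 c t x y
  simp only [Complex.ofReal_zero, zero_mul, add_zero, sub_zero, ← ofReal] at this
  norm_cast at this
  linarith

theorem continuous_shiftAverage :
    Continuous fun q : ℝ × ℝ × (TernaryIndex m → ℝ) => shiftAverage q.1 q.2.1 q.2.2 := by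
  refine continuous_of_eval fun t x y => ?_
  have h : ∀ q : ℝ × ℝ × (TernaryIndex m → ℝ), ternaryForm (shiftAverage q.1 q.2.1 q.2.2) t x y =
      (2⁻¹ * (ternaryForm q.2.2 ((t : ℂ) + (q.1 * x + q.2.1 * y) * Complex.I) (x : ℂ) (y : ℂ) +
      ternaryForm q.2.2 ((t : ℂ) - (q.1 * x + q.2.1 * y) * Complex.I) (x : ℂ) (y : ℂ))).re := by
    intro q
    rw [← two_mul_shiftAverage, inv_mul_cancel_left₀ two_ne_zero, ← ofReal, Complex.ofReal_re]
  simp only [h]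
  refine Complex.continuous_re.comp (continuous_const.mul (Continuous.add ?_ ?_))
  · exact (continuous_eval (m := m) (R := ℂ)).comp (f := fun q : ℝ × ℝ × (TernaryIndex m → ℝ) =>
      (q.2.2, (t : ℂ) + (q.1 * x + q.2.1 * y) * Complex.I, (x : ℂ), (y : ℂ))) (by fun_prop)
  · exact (continuous_eval (m := m) (R := ℂ)).comp (f := fun q : ℝ × ℝ × (TernaryIndex m → ℝ) =>
      (q.2.2, (t : ℂ) - (q.1 * x + q.2.1 * y) * Complex.I, (x : ℂ), (y : ℂ))) (by fun_prop)

/-- A smoothing that turns weakly hyperbolic forms into strictly hyperbolic ones. -/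
noncomputable def smoothing (ε : ℝ) (c : TernaryIndex m → ℝ) : TernaryIndex m → ℝ :=
  shiftAverage 0 ε (shiftAverage ε 0 c)

theorem smoothing_zero (c : TernaryIndex m → ℝ) : smoothing 0 c = c := by
  rw [smoothing, shiftAverage_zero, shiftAverage_zero]

theorem continuous_smoothing :
    Continuous fun q : ℝ × (TernaryIndex m → ℝ) => smoothing q.1 q.2 := by
  have h : Continuous fun q : ℝ × (TernaryIndex m → ℝ) => shiftAverage q.1 0 q.2 :=
    (continuous_shiftAverage (m := m)).comp (f := fun q : ℝ × (TernaryIndex m → ℝ) =>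
      (q.1, (0 : ℝ), q.2)) (by fun_prop)
  exact (continuous_shiftAverage (m := m)).comp (f := fun q : ℝ × (TernaryIndex m → ℝ) =>
      ((0 : ℝ), q.1, shiftAverage q.1 0 q.2)) (by fun_prop)

/-- The ternary form obtained by scaling the variables `x` and `y`. -/
def scale (s : ℝ) (c : TernaryIndex m → ℝ) : TernaryIndex m → ℝ :=
  fun k => s ^ (m - k.1 : ℕ) * c k

theorem ternaryForm_scale (s : ℝ) (c : TernaryIndex m → ℝ) (t x y : ℂ) :
    ternaryForm (scale s c) t x y = ternaryForm c t (s * x) (s * y) := by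
  unfold ternaryForm scale
  congr 1
  refine Finset.sum_congr rfl fun k _ => ?_
  have h : (s : ℂ) ^ (m - k.1 : ℕ) = (s : ℂ) ^ (m - k.1 - k.2 : ℕ) * (s : ℂ) ^ (k.2 : ℕ) := by
    rw [← pow_add]
    congr 1
    have := k.2.2
    omega
  simp only [Complex.coe_algebraMap, Complex.ofReal_mul, Complex.ofReal_pow, h, mul_pow]
  ring

theorem scale_one (c : TernaryIndex m → ℝ) : scale 1 c = c := by
  funext k
  simp [scale]

theorem scale_zero (c : TernaryIndex m → ℝ) : scale 0 c = 0 := by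
  funext k
  have := k.1.2
  simp [scale, show m - (k.1 : ℕ) ≠ 0 by omega]

theorem scale_mem_weaklyHyperbolic {c : TernaryIndex m → ℝ} (hc : c ∈ weaklyHyperbolic m)
    (s : ℝ) : scale s c ∈ weaklyHyperbolic m := by
  intro x y t ht
  rw [ternaryForm_scale] at ht
  exact hc (s * x) (s * y) t (by exact_mod_cast ht)

variable (hm : m ≠ 0)
include hm

theorem shiftAverage_mem_weaklyHyperbolic {c : TernaryIndex m → ℝ} (hc : c ∈ weaklyHyperbolic m)
    (a b : ℝ) : shiftAverage a b c ∈ weaklyHyperbolic m := by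
  intro x y t ht
  have h := two_mul_shiftAverage a b c t x y
  rw [ht, mul_zero] at h
  by_cases hl : a * x + b * y = 0
  · have hl' : (a * x + b * y : ℂ) = 0 := by exact_mod_cast hl
    rw [hl', zero_mul, add_zero, sub_zero, ← two_mul] at h
    exact hc x y t ((mul_eq_zero.1 h.symm).resolve_left two_ne_zero)
  · refine (linePoly_monic c x y).im_eq_zero_of_shift_add_shift
      (by rwa [linePoly_natDegree]) (fun z hz => hc x y z (by rwa [← linePoly_eval])) hl ?_
    simp only [linePoly_eval]
    push_cast
    exact h.symm

theorem derivative_shiftAverage_ne_zero {c : TernaryIndex m → ℝ} (hc : c ∈ weaklyHyperbolic m)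
    {a b x y : ℝ} (hl : a * x + b * y ≠ 0) {t : ℂ}
    (ht : ternaryForm (shiftAverage a b c) t (x : ℂ) (y : ℂ) = 0) :
    (linePoly (shiftAverage a b c) x y).derivative.eval t ≠ 0 := by
  have him := shiftAverage_mem_weaklyHyperbolic hm hc a b x y t ht
  have h := two_mul_shiftAverage a b c t x y
  rw [ht, mul_zero] at h
  have hd := derivative_linePoly_shiftAverage a b c t x y
  intro h0
  rw [h0, mul_zero] at hd
  refine Polynomial.derivative_shift_add_shift_ne_zero (p := linePoly c x y)
      (by rwa [linePoly_natDegree]) (fun z hz => hc x y z (by rwa [← linePoly_eval])) hl him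
      (fun z => ?_) (fun z => ?_) ?_ ?_
  · rw [linePoly_eval, linePoly_eval, conj]
  · rw [← divDiff_self, ← divDiff_self]
    simp [divDiff]
  · simp only [linePoly_eval]
    push_cast
    exact h.symm
  · push_cast
    exact hd.symm

theorem strictlyHyperbolic_subset_weaklyHyperbolic :
    strictlyHyperbolic m ⊆ weaklyHyperbolic m := by
  intro c hc x y t ht
  by_cases hxy : x ≠ 0 ∨ y ≠ 0
  · exact (hc x y hxy t ht).1
  · push Not at hxy
    obtain ⟨rfl, rfl⟩ := hxy
    have h2 := smul c t 1 0 0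
    have h3 := ofReal c 1 0 0
    rw [at_one_zero_zero] at h3
    simp only [mul_one, mul_zero] at h2
    simp only [Complex.ofReal_one, Complex.ofReal_zero] at h3 ht
    rw [ht, ← h3, mul_one] at h2
    rw [pow_eq_zero_iff hm |>.1 h2.symm, Complex.zero_im]

theorem smoothing_mem_strictlyHyperbolic {c : TernaryIndex m → ℝ} (hc : c ∈ weaklyHyperbolic m)
    {ε : ℝ} (hε : ε ≠ 0) : smoothing ε c ∈ strictlyHyperbolic m := by
  have h1 := shiftAverage_mem_weaklyHyperbolic hm hc ε 0
  intro x y hxy t ht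
  refine ⟨shiftAverage_mem_weaklyHyperbolic hm h1 0 ε x y t ht, ?_⟩
  by_cases hy : y = 0
  · have hx : x ≠ 0 := by
      rcases hxy with h | h
      · exact h
      · exact absurd hy h
    have hl := linePoly_shiftAverage_of_eq_zero (shiftAverage ε 0 c) (a := 0) (b := ε) (x := x)
      (y := y) (by simp [hy])
    rw [smoothing, ← linePoly_eval, hl, linePoly_eval] at ht
    rw [smoothing, hl]
    exact derivative_shiftAverage_ne_zero hm hc (by simp [hx, hε]) ht
  · exact derivative_shiftAverage_ne_zero hm h1 (by simp [hy, hε]) ht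

theorem isPreconnected_strictlyHyperbolic : IsPreconnected (strictlyHyperbolic m) := by
  refine isPreconnected_of_forall (smoothing 1 0) fun c hc => ?_
  have hw := strictlyHyperbolic_subset_weaklyHyperbolic hm hc
  refine ⟨Set.range (fun s => smoothing 1 (scale s c)) ∪ Set.range (fun ε => smoothing ε c),
    ?_, ?_, ?_, ?_⟩
  · rintro _ (⟨s, rfl⟩ | ⟨ε, rfl⟩)
    · exact smoothing_mem_strictlyHyperbolic hm (scale_mem_weaklyHyperbolic hw s) one_ne_zero
    · by_cases hε : ε = 0
      · simpa [hε, smoothing_zero] using hc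
      · exact smoothing_mem_strictlyHyperbolic hm hw hε
  · exact Or.inl ⟨0, by simp [scale_zero]⟩
  · exact Or.inr ⟨0, smoothing_zero c⟩
  · refine IsPreconnected.union (smoothing 1 c) ⟨1, by simp [scale_one]⟩ ⟨1, rfl⟩
      (isPreconnected_range ?_) (isPreconnected_range ?_)
    · have hs : Continuous fun s : ℝ => scale s c := by
        unfold scale
        fun_prop
      exact (continuous_smoothing (m := m)).comp (f := fun s : ℝ => ((1 : ℝ), scale s c))
        (by fun_prop)
    · exact (continuous_smoothing (m := m)).comp (f := fun ε : ℝ => (ε, c)) (by fun_prop)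

end TernaryForm

/-- Parameters of the pencils `t + x D + y A` with `D` real diagonal and `A` real symmetric. -/
abbrev PencilSpace (m : ℕ) : Type := (Fin m → ℝ) × (Sym2 (Fin m) → ℝ)

/-- The symmetric matrix with entries indexed by unordered pairs. -/
def symMatrix {m : ℕ} (a : Sym2 (Fin m) → ℝ) : Matrix (Fin m) (Fin m) ℝ :=
  Matrix.of fun i j => a s(i, j)

theorem symMatrix_isSymm {m : ℕ} (a : Sym2 (Fin m) → ℝ) : (symMatrix a).IsSymm := by
  ext i j
  simp [symMatrix, Sym2.eq_swap]

/-- The matrix `t + x D + y A`. -/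
def pencil {m : ℕ} {R : Type*} [CommRing R] [Algebra ℝ R] (e : PencilSpace m) (t x y : R) :
    Matrix (Fin m) (Fin m) R :=
  t • 1 + x • (Matrix.diagonal e.1).map (algebraMap ℝ R) + y • (symMatrix e.2).map (algebraMap ℝ R)

theorem pencil_apply {m : ℕ} {R : Type*} [CommRing R] [Algebra ℝ R] (e : PencilSpace m)
    (t x y : R) (i j : Fin m) : pencil e t x y i j =
      (if i = j then t else 0) + x * algebraMap ℝ R (if i = j then e.1 i else 0) +
        y * algebraMap ℝ R (e.2 s(i, j)) := by
  by_cases h : i = j <;> simp [pencil, symMatrix, h]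

theorem pencil_map {m : ℕ} {R S : Type*} [CommRing R] [Algebra ℝ R] [CommRing S] [Algebra ℝ S]
    (f : R →ₐ[ℝ] S) (e : PencilSpace m) (t x y : R) :
    (pencil e t x y).map f = pencil e (f t) (f x) (f y) := by
  ext i j
  simp only [Matrix.map_apply, pencil_apply, map_add, map_mul, AlgHom.commutes]
  split_ifs <;> simp

theorem det_pencil_map {m : ℕ} {R S : Type*} [CommRing R] [Algebra ℝ R] [CommRing S] [Algebra ℝ S]
    (f : R →ₐ[ℝ] S) (e : PencilSpace m) (t x y : R) :
    f (pencil e t x y).det = (pencil e (f t) (f x) (f y)).det := by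
  rw [← pencil_map]
  exact AlgHom.map_det f _

theorem pencil_transpose {m : ℕ} {R : Type*} [CommRing R] [Algebra ℝ R] (e : PencilSpace m)
    (t x y : R) : (pencil e t x y).transpose = pencil e t x y := by
  ext i j
  rw [Matrix.transpose_apply, pencil_apply, pencil_apply, Sym2.eq_swap]
  by_cases h : i = j
  · simp [h]
  · simp [h, Ne.symm h]

open MvPolynomial in
theorem Matrix.isHomogeneous_det {R σ : Type*} [CommRing R] {m : ℕ}
    {L : Matrix (Fin m) (Fin m) (MvPolynomial σ R)} (hL : ∀ i j, (L i j).IsHomogeneous 1) :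
    L.det.IsHomogeneous m := by
  rw [Matrix.det_apply']
  refine IsHomogeneous.sum _ _ _ fun g _ => ?_
  have h1 : (((Equiv.Perm.sign g : ℤ) : MvPolynomial σ R)).IsHomogeneous 0 := by
    have : (((Equiv.Perm.sign g : ℤ) : MvPolynomial σ R)) = C ((Equiv.Perm.sign g : ℤ) : R) := by
      simp
    rw [this]
    exact isHomogeneous_C _ _
  have h2 := h1.mul (IsHomogeneous.prod Finset.univ (fun i => L (g i) i) (fun _ => 1)
    fun i _ => hL _ _)
  simpa using h2

open MvPolynomial in
theorem exists_detForm {m : ℕ} (e : PencilSpace m) :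
    ∃ c : TernaryIndex m → ℝ, ∀ t x y : ℂ, ternaryForm c t x y = (pencil e t x y).det := by
  have hh : (pencil e (X 0) (X 1) (X 2) : Matrix _ _ (MvPolynomial (Fin 3) ℂ)).det.IsHomogeneous
      m := by
    refine Matrix.isHomogeneous_det fun i j => ?_
    rw [pencil_apply]
    have hC : ∀ r : ℝ, (algebraMap ℝ (MvPolynomial (Fin 3) ℂ) r).IsHomogeneous 0 := fun r => by
      rw [IsScalarTower.algebraMap_apply ℝ ℂ (MvPolynomial (Fin 3) ℂ)]
      exact isHomogeneous_C _ _
    refine IsHomogeneous.add (IsHomogeneous.add ?_ ?_) ?_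
    · split_ifs
      · exact isHomogeneous_X _ _
      · exact isHomogeneous_zero _ _ _
    · exact (isHomogeneous_X ℂ _).mul (hC _)
    · exact (isHomogeneous_X ℂ _).mul (hC _)
  have ev : ∀ v : Fin 3 → ℂ, eval v
      (pencil e (X 0) (X 1) (X 2) : Matrix _ _ (MvPolynomial (Fin 3) ℂ)).det =
      (pencil e (v 0) (v 1) (v 2)).det := by
    intro v
    have := det_pencil_map ((MvPolynomial.aeval v :
      MvPolynomial (Fin 3) ℂ →ₐ[ℂ] ℂ).restrictScalars ℝ) e (X 0) (X 1) (X 2)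
    simpa [coe_aeval_eq_eval] using this
  obtain ⟨c, hc⟩ := TernaryForm.exists_of_isHomogeneous hh (by
    rw [ev]
    simp [pencil])
  refine ⟨c, fun t x y => ?_⟩
  have key : (ternaryForm c (X 0) (X 1) (X 2) : MvPolynomial (Fin 3) ℂ) =
      (pencil e (X 0) (X 1) (X 2)).det := by
    refine MvPolynomial.eq_of_eval_ofReal_eq fun v => ?_
    rw [TernaryForm.eval_ternaryForm, eval_X, eval_X, eval_X, ← TernaryForm.ofReal, hc, ev, ev]
    have := det_pencil_map Complex.ofRealAm e (v 0) (v 1) (v 2)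
    simp only [Complex.ofRealAm_coe] at this
    simp only [Matrix.cons_val]
    rw [← this, Complex.ofReal_re]
  have := congrArg (eval ![t, x, y]) key
  rwa [ev, TernaryForm.eval_ternaryForm, eval_X, eval_X, eval_X] at this

/-- The coefficients of the ternary form `det (t + x D + y A)`. -/
noncomputable def detForm {m : ℕ} (e : PencilSpace m) : TernaryIndex m → ℝ :=
  (exists_detForm e).choose

theorem ternaryForm_detForm {m : ℕ} (e : PencilSpace m) (t x y : ℂ) :
    ternaryForm (detForm e) t x y = (pencil e t x y).det :=
  (exists_detForm e).choose_spec t x y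

theorem ternaryForm_detForm_real {m : ℕ} (e : PencilSpace m) (t x y : ℝ) :
    ternaryForm (detForm e) t x y = (pencil e t x y).det := by
  have h1 := ternaryForm_detForm e t x y
  rw [← TernaryForm.ofReal] at h1
  have h2 := det_pencil_map Complex.ofRealAm e t x y
  simp only [Complex.ofRealAm_coe] at h2
  rw [← h2] at h1
  exact_mod_cast h1

theorem contDiff_detForm {m : ℕ} : ContDiff ℝ 1 (detForm (m := m)) := by
  refine TernaryForm.contDiff_of_eval fun t x y => ?_
  simp only [ternaryForm_detForm_real, Matrix.det_apply', pencil_apply]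
  refine ContDiff.sum fun g _ => contDiff_const.mul (contDiff_prod fun i _ => ?_)
  simp only [Algebra.algebraMap_self, RingHom.id_apply]
  have h1 : ∀ i j : Fin m, ContDiff ℝ 1 fun e : PencilSpace m => if i = j then e.1 i else 0 := by
    intro i j
    split_ifs <;> fun_prop
  have h2 : ∀ s, ContDiff ℝ 1 fun e : PencilSpace m => e.2 s := fun s => by fun_prop
  exact (contDiff_const.add (contDiff_const.mul (h1 _ _))).add (contDiff_const.mul (h2 _))

theorem TernaryForm.abs_le_of_eq_zero {m : ℕ} {c : TernaryIndex m → ℝ} {t x y : ℝ}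
    (hx : |x| ≤ 1) (hy : |y| ≤ 1) (h : ternaryForm c t x y = 0) : |t| ≤ 1 + ∑ k, |c k| := by
  by_contra! hlt
  have hS : 0 ≤ ∑ k, |c k| := Finset.sum_nonneg fun k _ => abs_nonneg _
  have h1 : |t| ^ m ≤ ∑ k, |c k| * |t| ^ (m - 1) := by
    have : t ^ m = -∑ k : TernaryIndex m,
        c k * (t ^ (k.1 : ℕ) * (x ^ (m - k.1 - k.2 : ℕ) * y ^ (k.2 : ℕ))) :=
      eq_neg_of_add_eq_zero_left h
    rw [← abs_pow, this, abs_neg]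
    refine (Finset.abs_sum_le_sum_abs _ _).trans (Finset.sum_le_sum fun k _ => ?_)
    rw [abs_mul, abs_mul, abs_mul, abs_pow, abs_pow, abs_pow]
    refine mul_le_mul_of_nonneg_left ?_ (abs_nonneg _)
    calc |t| ^ (k.1 : ℕ) * (|x| ^ (m - k.1 - k.2 : ℕ) * |y| ^ (k.2 : ℕ))
        ≤ |t| ^ (k.1 : ℕ) * (1 * 1) := by
          gcongr
          · exact pow_le_one₀ (abs_nonneg _) hx
          · exact pow_le_one₀ (abs_nonneg _) hy
      _ ≤ |t| ^ (m - 1) := by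
          rw [mul_one, mul_one]
          exact pow_le_pow_right₀ (by linarith) (by have := k.1.2; omega)
  rw [← Finset.sum_mul] at h1
  have hp : 0 < |t| ^ (m - 1) := pow_pos (by linarith) _
  rcases Nat.eq_zero_or_pos m with rfl | hm
  · simp at h1
    linarith
  · rw [← mul_pow_sub_one hm.ne'] at h1
    have := le_of_mul_le_mul_right h1 hp
    linarith

theorem abs_fst_le_of_detForm {m : ℕ} (e : PencilSpace m) (i : Fin m) :
    |e.1 i| ≤ 1 + ∑ k, |detForm e k| := by
  rw [← abs_neg]
  refine TernaryForm.abs_le_of_eq_zero (x := 1) (y := 0) (by simp) (by simp) ?_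
  rw [ternaryForm_detForm_real]
  have : pencil e (-e.1 i) 1 0 = Matrix.diagonal fun j => e.1 j - e.1 i := by
    ext j k
    by_cases h : j = k
    · simp [pencil_apply, h]
      ring
    · simp [pencil_apply, h]
  rw [this, Matrix.det_diagonal]
  exact Finset.prod_eq_zero (Finset.mem_univ i) (sub_self _)

theorem abs_snd_le_of_detForm {m : ℕ} (e : PencilSpace m) (s : Sym2 (Fin m)) :
    |e.2 s| ≤ m * (1 + ∑ k, |detForm e k|) := by
  induction s using Sym2.inductionOn with
  | hf i j =>
    have hA : (symMatrix e.2).IsHermitian := by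
      rw [Matrix.IsHermitian, Matrix.conjTranspose_eq_transpose_of_trivial]
      exact symMatrix_isSymm _
    have hl : ∀ k, |hA.eigenvalues k| ≤ 1 + ∑ k, |detForm e k| := by
      intro k
      rw [← abs_neg]
      refine TernaryForm.abs_le_of_eq_zero (x := 0) (y := 1) (by simp) (by simp) ?_
      rw [ternaryForm_detForm_real]
      refine Matrix.exists_mulVec_eq_zero_iff.1 ⟨(hA.eigenvectorBasis k).ofLp, ?_, ?_⟩
      · intro h
        have := hA.eigenvectorBasis.orthonormal.ne_zero k
        apply this
        ext i
        exact congrFun h i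
      · have := hA.mulVec_eigenvectorBasis k
        have hp : pencil e (-hA.eigenvalues k) 0 1 =
            -(hA.eigenvalues k • 1) + symMatrix e.2 := by
          ext a b
          simp [pencil]
        rw [hp, Matrix.add_mulVec, this, Matrix.neg_mulVec, Matrix.smul_mulVec,
          Matrix.one_mulVec]
        simp
    have hsp := congrFun (congrFun hA.spectral_theorem i) j
    have hij : symMatrix e.2 i j = e.2 s(i, j) := rfl
    rw [hij] at hsp
    rw [hsp, Unitary.conjStarAlgAut_apply, Matrix.mul_apply]
    refine (Finset.abs_sum_le_sum_abs _ _).trans ?_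
    have hcard : (m : ℝ) * (1 + ∑ k, |detForm e k|) =
        ∑ _k : Fin m, (1 + ∑ k, |detForm e k|) := by
      rw [Finset.sum_const, Finset.card_univ, Fintype.card_fin, nsmul_eq_mul]
    rw [hcard]
    refine Finset.sum_le_sum fun k _ => ?_
    rw [Matrix.mul_diagonal, abs_mul, abs_mul]
    have h1 := entry_norm_bound_of_unitary hA.eigenvectorUnitary.2 i k
    have h2 := entry_norm_bound_of_unitary (star hA.eigenvectorUnitary).2 k j
    rw [Real.norm_eq_abs] at h1 h2
    calc _ ≤ 1 * (1 + ∑ k, |detForm e k|) * 1 := by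
          gcongr
          · exact hl k
          · exact h2
      _ = _ := by ring

theorem isClosed_range_detForm (m : ℕ) : IsClosed (Set.range (detForm (m := m))) := by
  have hc : Continuous (detForm (m := m)) := contDiff_detForm.continuous
  refine (isProperMap_iff_isCompact_preimage.2 ⟨hc, fun K hK => ?_⟩).isClosedMap.isClosed_range
  refine Metric.isCompact_of_isClosed_isBounded (hK.isClosed.preimage hc) ?_
  obtain ⟨B, hB⟩ := hK.isBounded.exists_norm_le
  have hS : ∀ e, detForm e ∈ K →
      1 + ∑ k, |detForm e k| ≤ 1 + Fintype.card (TernaryIndex m) * B := by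
    intro e he
    gcongr
    calc ∑ k, |detForm e k| ≤ ∑ _k : TernaryIndex m, B :=
          Finset.sum_le_sum fun k _ => (norm_le_pi_norm (detForm e) k).trans (hB _ he)
      _ = _ := by simp
  refine (Metric.isBounded_closedBall (x := (0 : PencilSpace m)) (r :=
    (m + 1) * |1 + Fintype.card (TernaryIndex m) * B|)).subset fun e he => ?_
  have h1 := (hS e he).trans (le_abs_self _)
  rw [mem_closedBall_zero_iff, Prod.norm_def]
  refine max_le ((pi_norm_le_iff_of_nonneg (by positivity)).2 fun i => ?_)
    ((pi_norm_le_iff_of_nonneg (by positivity)).2 fun s => ?_)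
  · refine (abs_fst_le_of_detForm e i).trans (h1.trans ?_)
    exact le_mul_of_one_le_left (abs_nonneg _) (by linarith [Nat.cast_nonneg (α := ℝ) m])
  · refine (abs_snd_le_of_detForm e s).trans ?_
    exact mul_le_mul (by linarith) h1 (by positivity) (by positivity)

/-- A closed set with nonempty interior in a connected open set `H`, such that all its points in
`H` outside of a set with small cones are interior, contains `H`. -/
theorem IsPreconnected.subset_of_forall_mem_interior {V : Type*} [NormedAddCommGroup V]
    [NormedSpace ℝ V] {H G Z : Set V} (hH : IsPreconnected H) (hHo : IsOpen H) (hG : IsClosed G)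
    (hne : (H ∩ interior G).Nonempty) (hint : ∀ c ∈ H ∩ G, c ∉ Z → c ∈ interior G)
    (hZ : ∀ a : V, Dense ((fun q : ℝ × V => a + q.1 • (q.2 - a)) '' (Set.univ ×ˢ Z))ᶜ) :
    H ⊆ G := by
  refine (hH.subset_of_closure_inter_subset isOpen_interior hne ?_).trans interior_subset
  rintro c ⟨hcl, hcH⟩
  obtain ⟨r, hr, hball⟩ := Metric.isOpen_iff.1 hHo c hcH
  obtain ⟨a, haB, haG⟩ := mem_closure_iff.1 hcl _ Metric.isOpen_ball (Metric.mem_ball_self hr)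
  have hclG : closure (interior G) ⊆ G := closure_minimal interior_subset hG
  have key : Metric.ball c r ∩ ((fun q : ℝ × V => a + q.1 • (q.2 - a)) '' (Set.univ ×ˢ Z))ᶜ ⊆
      G := by
    rintro b ⟨hb, hbad⟩
    have hseg : segment ℝ a b ⊆ Metric.ball c r := (convex_ball c r).segment_subset haB hb
    have hpre : IsPreconnected (segment ℝ a b) := (convex_segment a b).isPreconnected
    refine interior_subset (hpre.subset_of_closure_inter_subset isOpen_interior
      ⟨a, left_mem_segment ℝ a b, haG⟩ ?_ (right_mem_segment ℝ a b))
    rintro p ⟨hp, hps⟩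
    by_cases hpZ : p ∈ Z
    · rw [segment_eq_image'] at hps
      obtain ⟨s, -, rfl⟩ := hps
      by_cases hs : s = 0
      · simpa [hs] using haG
      · exact absurd ⟨(s⁻¹, a + s • (b - a)), ⟨trivial, hpZ⟩, by simp [smul_smul, hs]⟩ hbad
    · exact hint p ⟨hball (hseg hps), hclG hp⟩ hpZ
  have hBG : Metric.ball c r ⊆ G :=
    ((hZ a).open_subset_closure_inter Metric.isOpen_ball).trans (closure_minimal key hG)
  exact interior_maximal hBG Metric.isOpen_ball (Metric.mem_ball_self hr)

open MvPolynomial in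
theorem exists_weaklyHyperbolic_of_isRZ {m : ℕ} (p : MvPolynomial (Fin 2) ℝ) (x0 : Fin 2 → ℝ)
    (hdeg : p.totalDegree = m) (hRZ : ∀ x : Fin 2 → ℝ, ∀ t : ℂ,
      MvPolynomial.aeval (fun i => (x0 i : ℂ) + t * (x i : ℂ)) p = 0 → t.im = 0)
    (hval : MvPolynomial.eval x0 p = 1) :
    ∃ c ∈ weaklyHyperbolic m, ∀ x y : ℝ,
      ternaryForm c (1 : ℝ) x y = eval ![x0 0 + x, x0 1 + y] p := by
  set P : MvPolynomial (Fin 3) ℂ := ∑ d ∈ p.support, C ((coeff d p : ℝ) : ℂ) *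
    ((C (x0 0 : ℂ) * X 0 + X 1) ^ (d 0) * (C (x0 1 : ℂ) * X 0 + X 2) ^ (d 1) *
      X 0 ^ (m - (d 0 + d 1))) with hP
  have hd : ∀ d ∈ p.support, d 0 + d 1 ≤ m := by
    intro d hd
    have := le_totalDegree hd
    rw [hdeg, Finsupp.sum_fintype _ _ (by simp)] at this
    simpa using this
  have hh : P.IsHomogeneous m := by
    refine IsHomogeneous.sum _ _ _ fun d hdp => ?_
    have hl : ∀ (r : ℂ) (i : Fin 3), (C r * X 0 + X i : MvPolynomial (Fin 3) ℂ).IsHomogeneous 1 :=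
      fun r i => by
        simpa using ((isHomogeneous_C _ r).mul (isHomogeneous_X ℂ (0 : Fin 3))).add
          (by simpa using isHomogeneous_X ℂ i)
    have := (isHomogeneous_C (Fin 3) ((coeff d p : ℝ) : ℂ)).mul ((((hl (x0 0) 1).pow (d 0)).mul
      ((hl (x0 1) 2).pow (d 1))).mul ((isHomogeneous_X ℂ (0 : Fin 3)).pow (m - (d 0 + d 1))))
    have h := hd d hdp
    rwa [show 0 + (1 * d 0 + 1 * d 1 + 1 * (m - (d 0 + d 1))) = m by omega] at this
  have hev : ∀ t x y : ℂ, t ≠ 0 → eval ![t, x, y] P =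
      t ^ m * aeval ![(x0 0 : ℂ) + t⁻¹ * x, (x0 1 : ℂ) + t⁻¹ * y] p := by
    intro t x y ht
    rw [aeval_def, eval₂_eq', Finset.mul_sum, hP, map_sum]
    refine Finset.sum_congr rfl fun d hdp => ?_
    have h : t ^ m = t ^ d 0 * t ^ d 1 * t ^ (m - (d 0 + d 1)) := by
      rw [← pow_add, ← pow_add, Nat.add_sub_cancel' (hd d hdp)]
    have e : ∀ a b : ℂ, a * t + b = t * (a + t⁻¹ * b) := fun a b => by field_simp
    simp only [map_mul, map_pow, map_add, eval_C, eval_X, Fin.prod_univ_two, Matrix.cons_val, h, e,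
      Complex.coe_algebraMap, mul_pow]
    ring
  have hreal : ∀ x y : ℝ, aeval ![(x0 0 : ℂ) + x, (x0 1 : ℂ) + y] p =
      ((eval ![x0 0 + x, x0 1 + y] p : ℝ) : ℂ) := by
    intro x y
    have := MvPolynomial.aeval_algebraMap_apply (A := ℝ) ℂ ![x0 0 + x, x0 1 + y] p
    simp only [Complex.coe_algebraMap] at this
    rw [← MvPolynomial.coe_aeval_eq_eval, RingHom.coe_coe, ← this]
    congr 2
    ext i
    fin_cases i <;> simp
  have hPreal : ∀ v : Fin 3 → ℝ, starRingEnd ℂ (eval (fun i => (v i : ℂ)) P) =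
      eval (fun i => (v i : ℂ)) P := by
    intro v
    simp [hP]
  obtain ⟨c, hc⟩ := TernaryForm.exists_of_isHomogeneous hh (by
    rw [hev _ _ _ one_ne_zero]
    have := hreal 0 0
    have hx0 : ![x0 0, x0 1] = x0 := by
      ext i
      fin_cases i <;> rfl
    simp only [Complex.ofReal_zero, add_zero, hx0, hval, Complex.ofReal_one] at this
    simp [this])
  have key : ternaryForm c (X 0) (X 1) (X 2) = P := by
    refine MvPolynomial.eq_of_eval_ofReal_eq fun v => ?_
    rw [TernaryForm.eval_ternaryForm, eval_X, eval_X, eval_X, ← TernaryForm.ofReal, hc,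
      ← Complex.conj_eq_iff_re.1 (hPreal v)]
    congr 4
    ext i
    fin_cases i <;> rfl
  have hcomplex : ∀ t x y : ℂ, t ≠ 0 → ternaryForm c t x y =
      t ^ m * aeval ![(x0 0 : ℂ) + t⁻¹ * x, (x0 1 : ℂ) + t⁻¹ * y] p := by
    intro t x y ht
    have := congrArg (eval ![t, x, y]) key
    rwa [hev _ _ _ ht, TernaryForm.eval_ternaryForm, eval_X, eval_X, eval_X] at this
  refine ⟨c, fun x y t ht => ?_, fun x y => ?_⟩
  · by_cases h0 : t = 0
    · simp [h0]
    rw [hcomplex _ _ _ h0] at ht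
    have h1 := hRZ ![x, y] t⁻¹ (by
      rw [← (mul_eq_zero.1 ht).resolve_left (pow_ne_zero m h0)]
      congr 2
      ext i
      fin_cases i <;> simp)
    rw [Complex.inv_im, div_eq_zero_iff, neg_eq_zero, Complex.normSq_eq_zero] at h1
    exact h1.resolve_right h0
  · have h1 := hcomplex 1 x y one_ne_zero
    rw [inv_one, one_mul, one_mul, hreal, one_pow, one_mul] at h1
    have h2 := TernaryForm.ofReal c 1 x y
    rw [Complex.ofReal_one, h1] at h2
    exact_mod_cast h2

namespace Matrix

variable {n R : Type*} [Fintype n] [DecidableEq n] [CommRing R]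

theorem det_updateRow_eq_sum_mul_adjugate (L : Matrix n n R) (i : n) (r : n → R) :
    (L.updateRow i r).det = ∑ j, L.adjugate j i * r j := by
  rw [← cramer_transpose_apply, cramer_eq_adjugate_mulVec, ← adjugate_transpose]
  rfl

theorem exists_det_add_smul (L M : Matrix n n R) (s : R) :
    ∃ r, (L + s • M).det = L.det + s * (L.adjugate * M).trace + s ^ 2 * r := by
  have h := (detRowAlternating (n := n) (R := R)).toMultilinearMap.map_add_eq_map_add_linearDeriv_add
    (fun i => L i) (fun i => (s • M) i)
  have h1 : ∀ N : Matrix n n R,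
      (detRowAlternating (n := n) (R := R)).toMultilinearMap (fun i => N i) = N.det := fun N => rfl
  have h2 : (detRowAlternating (n := n) (R := R)).toMultilinearMap.linearDeriv (fun i => L i)
      (fun i => (s • M) i) = s * (L.adjugate * M).trace := by
    rw [MultilinearMap.linearDeriv_apply]
    have : ∀ i, (detRowAlternating (n := n) (R := R)).toMultilinearMap
        (Function.update (fun i => L i) i ((s • M) i)) = ∑ j, L.adjugate j i * (s • M) i j :=
      fun i => det_updateRow_eq_sum_mul_adjugate L i _
    simp only [this, trace, diag, mul_apply, Finset.mul_sum]
    rw [Finset.sum_comm]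
    refine Finset.sum_congr rfl fun i _ => Finset.sum_congr rfl fun j _ => ?_
    simp only [smul_apply, smul_eq_mul]
    ring
  have h3 : ∀ t ∈ Finset.univ.filter fun t : Finset n => 2 ≤ t.card,
      s ^ 2 ∣ (detRowAlternating (n := n) (R := R)).toMultilinearMap
        (t.piecewise (fun i => (s • M) i) (fun i => L i)) := by
    intro t ht
    have h4 := (detRowAlternating (n := n) (R := R)).toMultilinearMap.map_piecewise_smul
      (fun _ => s) (t.piecewise (fun i => M i) (fun i => L i)) t
    have h5 : t.piecewise (fun i => s • (t.piecewise (fun i => M i) (fun i => L i)) i)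
        (t.piecewise (fun i => M i) (fun i => L i)) =
        t.piecewise (fun i => (s • M) i) (fun i => L i) := by
      ext i j
      by_cases hi : i ∈ t <;> simp [hi]
    rw [h5] at h4
    rw [h4, Finset.prod_const]
    exact Dvd.dvd.mul_right (pow_dvd_pow _ (Finset.mem_filter.1 ht).2) _
  obtain ⟨r, hr⟩ := Finset.dvd_sum h3
  refine ⟨r, ?_⟩
  rw [← h2, ← hr]
  exact h

open Polynomial in
theorem exists_eval_eq_det_add_smul (L M : Matrix n n R) :
    ∃ p : R[X], (∀ s, p.eval s = (L + s • M).det) ∧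
      p.derivative.eval 0 = (L.adjugate * M).trace := by
  obtain ⟨r, hr⟩ := exists_det_add_smul (L.map C) (M.map C) (X : R[X])
  refine ⟨(L.map C + (X : R[X]) • M.map C).det, fun s => ?_, ?_⟩
  · rw [← coe_evalRingHom, RingHom.map_det]
    congr 1
    ext i j
    simp
    ring
  · have h1 : (L.map C).adjugate = L.adjugate.map (C : R →+* R[X]) := by
      rw [← RingHom.mapMatrix_apply, ← RingHom.mapMatrix_apply, RingHom.map_adjugate]
    have h2 : ((L.map C).adjugate * M.map C).trace = C (L.adjugate * M).trace := by
      rw [h1, ← Matrix.map_mul]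
      exact (AddMonoidHom.map_trace (C : R →+* R[X]).toAddMonoidHom _).symm
    have h3 : (L.map C).det = C L.det := (RingHom.map_det C L).symm
    rw [hr, h2, h3]
    simp

theorem hasDerivAt_det_add_smul (L M : Matrix n n ℝ) :
    HasDerivAt (fun s : ℝ => (L + s • M).det) (L.adjugate * M).trace 0 := by
  obtain ⟨p, hp, hd⟩ := exists_eval_eq_det_add_smul L M
  have := p.hasDerivAt 0
  simp only [hp, hd] at this
  exact this

/-- The span of the columns of a nonzero skew-symmetric matrix is at least two-dimensional, so a
matrix annihilating it has vanishing adjugate. -/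
theorem adjugate_eq_zero_of_mul_skew {K : Type*} [Field K] [NeZero (2 : K)] {L C : Matrix n n K}
    (hC : Cᵀ = -C) (hC0 : C ≠ 0) (h : L * C = 0) : L.adjugate = 0 ∧ L.det = 0 := by
  have hskew : ∀ i j, C j i = -C i j := fun i j => congrFun (congrFun hC i) j
  have hdiag : ∀ i, C i i = 0 := fun i => by
    have := hskew i i
    have h2 : (2 : K) * C i i = 0 := by linear_combination this
    exact (mul_eq_zero.1 h2).resolve_left two_ne_zero
  obtain ⟨i, j, hij⟩ : ∃ i j, C i j ≠ 0 := by
    by_contra! h0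
    exact hC0 (by ext i j; exact h0 i j)
  have hcol : ∀ k, L *ᵥ (fun l => C l k) = 0 := fun k => by
    ext l
    exact congrFun (congrFun h l) k
  have hji : C j i ≠ 0 := by
    rw [hskew i j]
    exact neg_ne_zero.2 hij
  constructor
  · ext k l
    rw [adjugate_apply, zero_apply]
    have key : ∀ v : n → K, v ≠ 0 → L *ᵥ v = 0 → v k = 0 →
        (L.updateRow l (Pi.single k 1)).det = 0 := by
      intro v hv0 hv hvk
      refine exists_mulVec_eq_zero_iff.1 ⟨v, hv0, ?_⟩
      ext a
      by_cases ha : a = l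
      · subst ha
        simp [mulVec, hvk]
      · have := congrFun hv a
        simpa [mulVec, updateRow_ne ha] using this
    by_cases hk : C k i = 0
    · exact key (fun a => C a i) (fun h0 => hji (congrFun h0 j)) (hcol i) hk
    · refine key (C k j • (fun a => C a i) - C k i • (fun a => C a j)) (fun h0 => ?_) ?_ ?_
      · have := congrFun h0 i
        simp [hdiag] at this
        exact this.elim hk hij
      · rw [mulVec_sub, mulVec_smul, mulVec_smul, hcol, hcol]
        simp
      · simp
        ring
  · exact exists_mulVec_eq_zero_iff.1 ⟨fun a => C a i, fun h0 => hji (congrFun h0 j), hcol i⟩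

/-- A skew-symmetric matrix commuting with a symmetric matrix `M` vanishes as soon as no nonzero
skew-symmetric matrix is annihilated by a matrix `t + M`. -/
theorem eq_zero_of_skew_of_commute {K : Type*} [Field K] [IsAlgClosed K] {M Q : Matrix n n K}
    (hM : Mᵀ = M) (h : ∀ (t : K) (C : Matrix n n K), Cᵀ = -C → (t • 1 + M) * C = 0 → C = 0)
    (hQ : Qᵀ = -Q) (hQM : Q * M = M * Q) : Q = 0 := by
  let W : Submodule K (Matrix n n K) :=
    { carrier := {C | Cᵀ = -C ∧ C * M = M * C}
      add_mem' := by
        rintro A B ⟨h1, h2⟩ ⟨h3, h4⟩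
        exact ⟨by rw [transpose_add, h1, h3, neg_add], by rw [add_mul, mul_add, h2, h4]⟩
      zero_mem' := by simp
      smul_mem' := by
        rintro c A ⟨h1, h2⟩
        exact ⟨by rw [transpose_smul, h1, smul_neg],
          by rw [Matrix.smul_mul, Matrix.mul_smul, h2]⟩ }
  by_contra hne
  let f : W →ₗ[K] W :=
    { toFun := fun C => ⟨M * C.1, by
        obtain ⟨h1, h2⟩ := C.2
        refine ⟨by rw [transpose_mul, hM, h1, neg_mul, h2], by rw [mul_assoc, h2]⟩⟩
      map_add' := fun A B => Subtype.ext (mul_add _ _ _)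
      map_smul' := fun c A => Subtype.ext (Matrix.mul_smul _ _ _) }
  have : Nontrivial W := ⟨⟨⟨Q, hQ, hQM⟩, 0, fun h => hne (congrArg Subtype.val h)⟩⟩
  obtain ⟨μ, hμ⟩ := Module.End.exists_eigenvalue f
  obtain ⟨C, hC⟩ := hμ.exists_hasEigenvector
  refine hC.2 (Subtype.ext (h (-μ) C.1 C.2.1 ?_))
  have := congrArg Subtype.val hC.apply_eq_smul
  change M * C.1 = μ • C.1 at this
  rw [add_mul, this]
  simp

end Matrix

namespace Matrix

open Polynomial

variable {n R : Type*} [Fintype n] [DecidableEq n] [CommRing R]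

theorem coeff_adjugate_X_add_C_card (M : Matrix n n R) (i j : n) :
    (((X : R[X]) • 1 + M.map C).adjugate i j).coeff (Fintype.card n) = 0 := by
  have h : ((X : R[X]) • 1 + M.map C).updateRow j (Pi.single i 1) =
      (X : R[X]) • ((1 : Matrix n n R).updateRow j 0).map C +
        (M.updateRow j (Pi.single i 1)).map C := by
    ext k l
    by_cases hk : k = j
    · subst hk
      by_cases hl : l = i
      · subst hl
        simp
      · simp [hl]
    · by_cases hl : k = l
      · subst hl
        simp [hk]
      · simp [hk, hl]
  rw [adjugate_apply, h, coeff_det_X_add_C_card]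
  exact det_eq_zero_of_row_eq_zero j fun k => by simp

theorem trace_pow_mul_eq_zero {M S : Matrix n n R}
    (h : (((X : R[X]) • 1 + M.map C).adjugate * S.map C).trace = 0) (k : ℕ) :
    (M ^ k * S).trace = 0 := by
  have key : ∀ N : Matrix n n R, (((X : R[X]) • 1 + M.map C).adjugate * N.map C).trace = 0 →
      (((X : R[X]) • 1 + M.map C).adjugate * (M * N).map C).trace = 0 ∧ N.trace = 0 := by
    intro N hN
    have h1 : ((X : R[X]) • 1 + M.map C).adjugate * (M * N).map C =
        ((X : R[X]) • 1 + M.map C).det • N.map C -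
          (X : R[X]) • (((X : R[X]) • 1 + M.map C).adjugate * N.map C) := by
      have h2 : (M * N).map C = ((X : R[X]) • 1 + M.map C) * N.map C - (X : R[X]) • N.map C := by
        rw [add_mul, Matrix.map_mul]
        simp
      rw [h2, mul_sub, ← mul_assoc, adjugate_mul, Matrix.mul_smul]
      simp
    have h3 : (((X : R[X]) • 1 + M.map C).adjugate * (M * N).map C).trace =
        ((X : R[X]) • 1 + M.map C).det * C N.trace := by
      rw [h1, trace_sub, trace_smul, trace_smul, hN, AddMonoidHom.map_trace (C : R →+* R[X])]
      simp
    have h4 : N.trace = 0 := by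
      have h5 := congrArg (fun p : R[X] => p.coeff (Fintype.card n)) h3
      have h6 : ((X : R[X]) • 1 + M.map C).det.coeff (Fintype.card n) = 1 := by
        have := coeff_det_X_add_C_card (1 : Matrix n n R) M
        simpa using this
      simp only [coeff_mul_C, h6, one_mul] at h5
      rw [← h5]
      simp only [trace, diag, mul_apply, finsetSum_coeff, map_apply,
        coeff_mul_C, coeff_adjugate_X_add_C_card, zero_mul, Finset.sum_const_zero]
    exact ⟨by rw [h3, h4]; simp, h4⟩
  have main : ∀ k, (((X : R[X]) • 1 + M.map C).adjugate * (M ^ k * S).map C).trace = 0 := by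
    intro k
    induction k with
    | zero => simpa using h
    | succ k ih =>
      rw [pow_succ', mul_assoc]
      exact (key _ ih).1
  exact (key _ (main k)).2

theorem exists_skew_commutator {K : Type*} [Field K] [NeZero (2 : K)] {m : ℕ}
    {M S : Matrix (Fin m) (Fin m) K} (hM : Mᵀ = M) (hS : Sᵀ = S) (v : Fin m → K)
    (hv : (Matrix.of fun i k : Fin m => (M ^ (k : ℕ) *ᵥ v) i).det ≠ 0)
    (h : ∀ k, (M ^ k * S).trace = 0) :
    ∃ Q : Matrix (Fin m) (Fin m) K, Qᵀ = -Q ∧ Q * M - M * Q = S := by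
  let F : Matrix (Fin m) (Fin m) K →ₗ[K] Matrix (Fin m) (Fin m) K :=
    { toFun := fun Q => (Q - Qᵀ) * M - M * (Q - Qᵀ)
      map_add' := fun A B => by
        simp only [transpose_add]
        noncomm_ring
      map_smul' := fun c A => by
        simp only [transpose_smul, ← smul_sub, Matrix.smul_mul, Matrix.mul_smul, RingHom.id_apply] }
  by_contra hne
  have hnot : S ∉ LinearMap.range F := by
    rintro ⟨Q, hQ⟩
    exact hne ⟨Q - Qᵀ, by simp, hQ⟩
  obtain ⟨f, hfS, hf⟩ := Submodule.exists_le_ker_of_notMem hnot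
  let T : Matrix (Fin m) (Fin m) K := Matrix.of fun i j => f (Matrix.single j i 1)
  have hT : ∀ N, f N = (T * N).trace := by
    intro N
    conv_lhs => rw [matrix_eq_sum_single N]
    simp only [map_sum, trace, diag, mul_apply]
    rw [Finset.sum_comm]
    refine Finset.sum_congr rfl fun i _ => Finset.sum_congr rfl fun j _ => ?_
    have : Matrix.single j i (N j i) = N j i • Matrix.single j i (1 : K) := by
      simp
    rw [this, map_smul]
    simp [T, mul_comm]
  have hU : ∀ Q, ((T + Tᵀ) * M * Q).trace = (M * (T + Tᵀ) * Q).trace := by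
    intro Q
    have h1 : f (F Q) = 0 := hf ⟨Q, rfl⟩
    rw [hT] at h1
    have h1 : (T * ((Q - Qᵀ) * M - M * (Q - Qᵀ))).trace = 0 := h1
    have h2 : (T * Qᵀ * M).trace = (M * Q * Tᵀ).trace := by
      rw [← trace_transpose, transpose_mul, transpose_mul, transpose_transpose, hM, mul_assoc]
    have h3 : (T * M * Qᵀ).trace = (Q * M * Tᵀ).trace := by
      rw [← trace_transpose, transpose_mul, transpose_mul, transpose_transpose, hM, mul_assoc]
    have h4 : (T * ((Q - Qᵀ) * M - M * (Q - Qᵀ))).trace =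
        (T * Q * M).trace - (T * Qᵀ * M).trace - (T * M * Q).trace + (T * M * Qᵀ).trace := by
      rw [← trace_sub, ← trace_sub, ← trace_add]
      congr 1
      noncomm_ring
    rw [h4, h2, h3] at h1
    have h5 : (T * Q * M).trace = (M * T * Q).trace := by rw [trace_mul_comm, mul_assoc]
    have h6 : (M * Q * Tᵀ).trace = (Tᵀ * M * Q).trace := by rw [trace_mul_comm, mul_assoc]
    have h7 : (Q * M * Tᵀ).trace = (M * Tᵀ * Q).trace := by
      rw [mul_assoc, trace_mul_comm]
    rw [add_mul, add_mul, mul_add, add_mul, trace_add, trace_add]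
    linear_combination -h1 + h5 - h6 + h7
  have hcomm : (T + Tᵀ) * M = M * (T + Tᵀ) := ext_iff_trace_mul_right.2 hU
  generalize hUdef : T + Tᵀ = U at *
  let W : Matrix (Fin m) (Fin m) K := Matrix.of fun i k : Fin m => (M ^ (k : ℕ) *ᵥ v) i
  have hW : IsUnit W.det := isUnit_iff_ne_zero.2 hv
  let c : Fin m → K := W⁻¹ *ᵥ (U *ᵥ v)
  let P : Matrix (Fin m) (Fin m) K := ∑ k : Fin m, c k • M ^ (k : ℕ)
  have hPv : P *ᵥ v = U *ᵥ v := by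
    have h1 : W *ᵥ c = U *ᵥ v := by
      simp only [c, mulVec_mulVec, mul_nonsing_inv_cancel_left W U hW]
    rw [← h1]
    ext i
    simp only [P, sum_mulVec, smul_mulVec, Finset.sum_apply, Pi.smul_apply, smul_eq_mul]
    simp only [W, mulVec, dotProduct, of_apply, mul_comm]
  have hPM : ∀ k : ℕ, P * M ^ k = M ^ k * P := by
    intro k
    simp only [P, Finset.sum_mul, Finset.mul_sum, Matrix.smul_mul, Matrix.mul_smul, ← pow_add,
      add_comm]
  have hUM : ∀ k : ℕ, U * M ^ k = M ^ k * U := fun k => (Commute.pow_right hcomm k)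
  have hUP : U = P := by
    have h1 : (U - P) * W = 0 := by
      ext i k
      have h2 : ((U - P) * W) i k = ((U - P) *ᵥ (M ^ (k : ℕ) *ᵥ v)) i := rfl
      rw [h2, mulVec_mulVec, sub_mul, hUM, hPM, sub_mulVec, ← mulVec_mulVec, ← mulVec_mulVec, hPv]
      simp
    have h3 := congrArg (· * W⁻¹) h1
    simp only [mul_assoc, mul_nonsing_inv W hW, mul_one, zero_mul] at h3
    exact sub_eq_zero.1 h3
  have h1 : (U * S).trace = 0 := by
    rw [hUP]
    simp only [P, Finset.sum_mul, trace_sum, Matrix.smul_mul, trace_smul, h, smul_zero,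
      Finset.sum_const_zero]
  have h2 : (Tᵀ * S).trace = (T * S).trace := by
    rw [← trace_transpose, transpose_mul, transpose_transpose, hS, trace_mul_comm]
  rw [← hUdef, add_mul, trace_add, h2, ← two_mul] at h1
  apply hfS
  rw [hT]
  exact (mul_eq_zero.1 h1).resolve_left two_ne_zero

end Matrix

namespace Matrix

open Polynomial

theorem exists_skew_commutator_of_isDomain {R : Type*} [CommRing R] [IsDomain R] [NeZero (2 : R)]
    {m : ℕ} {M S : Matrix (Fin m) (Fin m) R} (hM : Mᵀ = M) (hS : Sᵀ = S) (v : Fin m → R)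
    (hv : (Matrix.of fun i k : Fin m => (M ^ (k : ℕ) *ᵥ v) i).det ≠ 0)
    (h : ∀ k, (M ^ k * S).trace = 0) :
    ∃ (Q : Matrix (Fin m) (Fin m) R) (δ : R), δ ≠ 0 ∧ Qᵀ = -Q ∧ Q * M - M * Q = δ • S := by
  let K := FractionRing R
  let φ : R →+* K := algebraMap R K
  have hφ : Function.Injective φ := IsFractionRing.injective R K
  have : NeZero (2 : K) := ⟨by
    rw [← map_ofNat φ 2]
    exact fun h0 => two_ne_zero ((map_eq_zero_iff φ hφ).1 h0)⟩
  have hpow : ∀ k, (M.map φ) ^ k = (M ^ k).map φ := fun k => (map_pow φ.mapMatrix M k).symm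
  obtain ⟨Q, hQ, hQM⟩ := exists_skew_commutator (M := M.map φ) (S := S.map φ)
    (by rw [← transpose_map, hM]) (by rw [← transpose_map, hS]) (fun i => φ (v i))
    (by
      have : (Matrix.of fun i k : Fin m => ((M.map φ) ^ (k : ℕ) *ᵥ fun i => φ (v i)) i) =
          (Matrix.of fun i k : Fin m => (M ^ (k : ℕ) *ᵥ v) i).map φ := by
        ext i k
        simp only [hpow]
        simp [mulVec, dotProduct]
      rw [this]
      exact fun h0 => hv ((map_eq_zero_iff φ hφ).1 ((RingHom.map_det φ _).trans h0)))
    (by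
      intro k
      rw [hpow, ← Matrix.map_mul]
      exact (AddMonoidHom.map_trace φ (M ^ k * S)).symm.trans (by rw [h, map_zero]))
  obtain ⟨b, hb⟩ := IsLocalization.exist_integer_multiples_of_finite (nonZeroDivisors R)
    (fun ij : Fin m × Fin m => Q ij.1 ij.2)
  choose q hq using hb
  have hq' : (Matrix.of fun i j => q (i, j)).map φ = φ b • Q := by
    ext i j
    have := hq (i, j)
    simpa [Algebra.smul_def] using this
  have hinj : Function.Injective fun N : Matrix (Fin m) (Fin m) R => N.map φ :=
    Matrix.map_injective hφ
  refine ⟨Matrix.of fun i j => q (i, j), b, nonZeroDivisors.ne_zero b.2, hinj ?_, hinj ?_⟩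
  · change (Matrix.of fun i j => q (i, j))ᵀ.map φ = (-(Matrix.of fun i j => q (i, j))).map φ
    rw [transpose_map, hq', transpose_smul, hQ]
    have : (-(Matrix.of fun i j => q (i, j))).map φ = -(Matrix.of fun i j => q (i, j)).map φ := by
      ext i j
      simp
    rw [this, hq', smul_neg]
  · change ((Matrix.of fun i j => q (i, j)) * M - M * (Matrix.of fun i j => q (i, j))).map φ =
      ((b : R) • S).map φ
    have h1 : ((b : R) • S).map φ = φ b • S.map φ := by
      ext i j
      simp
    have h2 : ((Matrix.of fun i j => q (i, j)) * M - M * (Matrix.of fun i j => q (i, j))).map φ =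
        (Matrix.of fun i j => q (i, j)).map φ * M.map φ -
          M.map φ * (Matrix.of fun i j => q (i, j)).map φ := by
      rw [← Matrix.map_mul, ← Matrix.map_mul]
      ext i j
      simp only [map_apply, sub_apply, map_sub]
    rw [h1, h2, hq', ← hQM, smul_sub, Matrix.smul_mul, Matrix.mul_smul]

theorem eq_zero_of_skew_commutator {n K : Type*} [Fintype n] [DecidableEq n] [Field K]
    [IsAlgClosed K] {A B S : Matrix n n K} (hA : Aᵀ = A) (hB : Bᵀ = B)
    (hAB : ∀ (t y : K) (N : Matrix n n K), Nᵀ = -N → (t • 1 + (B + y • A)) * N = 0 → N = 0)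
    (hA' : ∀ (t : K) (N : Matrix n n K), Nᵀ = -N → (t • 1 + A) * N = 0 → N = 0)
    {Q : Matrix n n K[X]} {δ : K[X]} (hδ : δ ≠ 0) (hQ : Qᵀ = -Q)
    (h : Q * (B.map C + (X : K[X]) • A.map C) - (B.map C + (X : K[X]) • A.map C) * Q =
      δ • S.map C) : S = 0 := by
  induction hk : δ.natDegree using Nat.strong_induction_on generalizing Q δ with
  | _ k ih =>
  have hskew : ∀ i j, Q j i = -Q i j := fun i j => congrFun (congrFun hQ i) j
  by_cases hδ0 : δ.natDegree = 0
  · obtain ⟨r, rfl⟩ := natDegree_eq_zero.1 hδ0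
    have hentry : ∀ (i j : n), (∑ l, Q i l * C (B l j)) + (X * ∑ l, Q i l * C (A l j)) -
        ((∑ l, C (B i l) * Q l j) + (X * ∑ l, C (A i l) * Q l j)) = C (r * S i j) := by
      intro i j
      rw [mul_add, add_mul, Matrix.mul_smul, Matrix.smul_mul] at h
      have h1 := congrFun (congrFun h i) j
      rw [C_mul]
      exact h1
    have hstep : ∀ k, (∀ i j, (Q i j).coeff (k + 1) = 0) → ∀ i j, (Q i j).coeff k = 0 := by
      intro k hk1
      let N : Matrix n n K := Q.map fun p => p.coeff k
      have hN : N = 0 := by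
        refine eq_zero_of_skew_of_commute hA hA' ?_ ?_
        · ext i j
          simp [N, hskew i j]
        · ext i j
          have h1 := congrArg (fun p : K[X] => p.coeff (k + 1)) (hentry i j)
          simp only [coeff_sub, coeff_add, coeff_X_mul, finsetSum_coeff, coeff_mul_C, coeff_C_mul, hk1, zero_mul,
            mul_zero,            Finset.sum_const_zero, zero_add, coeff_C_succ] at h1
          simp only [N, mul_apply, map_apply]
          exact sub_eq_zero.1 h1
      intro i j
      exact congrFun (congrFun hN i) j
    have hzero : ∀ d k, (∀ i j, (Q i j).natDegree < k + d) → ∀ i j, (Q i j).coeff k = 0 := by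
      intro d
      induction d with
      | zero => exact fun k hk i j => coeff_eq_zero_of_natDegree_lt (hk i j)
      | succ d ihd =>
        intro k hk
        refine hstep k (ihd (k + 1) fun i j => ?_)
        have := hk i j
        omega
    have hQ0 : ∀ i j, Q i j = 0 := by
      intro i j
      ext k
      refine hzero ((Finset.univ.sup fun i => Finset.univ.sup fun j => (Q i j).natDegree) + 1) k
        (fun i j => ?_) i j
      have h1 := Finset.le_sup (f := fun j => (Q i j).natDegree) (Finset.mem_univ j)
      have h2 := Finset.le_sup (f := fun i => Finset.univ.sup fun j => (Q i j).natDegree)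
        (Finset.mem_univ i)
      have h3 := h1.trans h2
      exact Nat.lt_of_lt_of_le (Nat.lt_succ_of_le h3) (Nat.le_add_left _ _)
    ext i j
    have h1 := hentry i j
    simp only [hQ0, zero_mul, Finset.sum_const_zero, mul_zero, add_zero, sub_zero] at h1
    have h2 : r * S i j = 0 := C_eq_zero.1 h1.symm
    exact (mul_eq_zero.1 h2).resolve_left fun h0 => hδ (by rw [h0, C_0])
  · obtain ⟨y, hy⟩ := IsAlgClosed.exists_root δ fun h0 => hδ0 (natDegree_eq_of_degree_eq_some h0)
    let φ : K[X] →+* K := evalRingHom y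
    have hMφ : (B.map C + (X : K[X]) • A.map C).map φ = B + y • A := by
      ext i j
      simp only [φ, map_apply, add_apply, smul_apply, smul_eq_mul, coe_evalRingHom, eval_add,
        eval_mul, eval_C, eval_X]
    have hQφ : Q.map φ = 0 := by
      refine eq_zero_of_skew_of_commute (M := B + y • A) ?_ (fun t N => hAB t y N) ?_ ?_
      · rw [transpose_add, transpose_smul, hA, hB]
      · ext i j
        simp [hskew i j]
      · have h1 := congrArg (fun N : Matrix n n K[X] => N.map φ) h
        have h2 : ∀ N N' : Matrix n n K[X], (N - N').map φ = N.map φ - N'.map φ := by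
          intro N N'
          ext i j
          simp
        have h3 : (δ • S.map C).map φ = 0 := by
          ext i j
          simp [φ, hy.eq_zero]
        simp only [h2, h3, Matrix.map_mul, hMφ] at h1
        exact sub_eq_zero.1 h1
    have hdvd : ∀ i j, X - C y ∣ Q i j := fun i j =>
      dvd_iff_isRoot.2 (congrFun (congrFun hQφ i) j)
    choose q hq using hdvd
    obtain ⟨ε, rfl⟩ := dvd_iff_isRoot.2 hy
    have hQq : Q = (X - C y) • Matrix.of q := by
      ext i j : 2
      simp [hq]
    have hXy : (X - C y : K[X]) ≠ 0 := X_sub_C_ne_zero y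
    have hcancel : ∀ N N' : Matrix n n K[X], (X - C y) • N = (X - C y) • N' → N = N' := by
      intro N N' hN
      refine Matrix.ext fun i j => ?_
      exact mul_left_cancel₀ hXy (congrFun (congrFun hN i) j)
    have hε : ε ≠ 0 := right_ne_zero_of_mul hδ
    refine ih ε.natDegree ?_ hε (Q := Matrix.of q) ?_ ?_ rfl
    · rw [← hk, natDegree_mul hXy hε, natDegree_X_sub_C]
      omega
    · apply hcancel
      rw [← transpose_smul, ← hQq, hQ, hQq, smul_neg]
    · apply hcancel
      rw [smul_sub, ← Matrix.smul_mul, ← Matrix.mul_smul, ← hQq, h, smul_smul]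

end Matrix

section

open Polynomial Matrix

theorem fst_eq_zero_of_trace_adjugate {m : ℕ} {e f : PencilSpace m}
    (he : Function.Injective e.1)
    (h : ∀ t x y : ℝ, ((pencil e t x y).adjugate * pencil f 0 x y).trace = 0) : f.1 = 0 := by
  ext i
  have h1 := h (-e.1 i) 1 0
  have h2 : pencil e (-e.1 i) (1 : ℝ) 0 = diagonal fun j => e.1 j - e.1 i := by
    ext j k
    rw [pencil_apply]
    by_cases hjk : j = k
    · subst hjk
      simp
      ring
    · simp [hjk]
  have h3 : pencil f (0 : ℝ) 1 0 = diagonal f.1 := by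
    ext j k
    rw [pencil_apply]
    by_cases hjk : j = k
    · subst hjk
      simp
    · simp [hjk]
  rw [h2, h3, adjugate_diagonal, diagonal_mul_diagonal, trace_diagonal,
    Finset.sum_eq_single i] at h1
  · refine (mul_eq_zero.1 h1).resolve_left (Finset.prod_ne_zero_iff.2 fun k hk => ?_)
    exact sub_ne_zero.2 fun h0 => (Finset.mem_erase.1 hk).1 (he h0)
  · intro j _ hj
    rw [Finset.prod_eq_zero (i := i) (Finset.mem_erase.2 ⟨Ne.symm hj, Finset.mem_univ _⟩)
      (sub_self _), zero_mul]
  · simp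

theorem trace_adjugate_pencil_X_eq_zero {m : ℕ} {e f : PencilSpace m} (hf : f.1 = 0)
    (h : ∀ t x y : ℝ, ((pencil e t x y).adjugate * pencil f 0 x y).trace = 0) :
    ((pencil e (X : ℝ[X][X]) 1 (C X)).adjugate * pencil f 0 0 1).trace = 0 := by
  set P := ((pencil e (X : ℝ[X][X]) 1 (C X)).adjugate * pencil f 0 0 1).trace with hP
  have heval : ∀ t y : ℝ, y * (P.eval (C t)).eval y = 0 := by
    intro t y
    let φ : ℝ[X][X] →ₐ[ℝ] ℝ := (aeval y).comp ((aeval (C t : ℝ[X])).restrictScalars ℝ)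
    have hφ : ∀ p, φ p = (p.eval (C t)).eval y := fun p => by simp [φ]
    rw [← hφ]
    have h1 : φ P = ((pencil e t 1 y).adjugate * pencil f 0 0 1).trace := by
      have h2 := pencil_map φ e (X : ℝ[X][X]) 1 (C X)
      have h3 := pencil_map φ f 0 0 1
      have h4 : φ (X : ℝ[X][X]) = t := by simp [hφ]
      have h5 : φ (C X : ℝ[X][X]) = y := by simp [hφ]
      rw [map_one, h4, h5] at h2
      rw [map_one, map_zero] at h3
      rw [← h2, ← h3]
      have h6 : ((pencil e (X : ℝ[X][X]) 1 (C X)).map φ).adjugate =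
          (pencil e (X : ℝ[X][X]) 1 (C X)).adjugate.map φ :=
        (φ.map_adjugate _).symm
      rw [h6, ← Matrix.map_mul]
      exact (AddMonoidHom.map_trace φ _)
    have h7 : pencil f (0 : ℝ) 1 y = y • pencil f 0 0 1 := by
      ext i j
      simp [pencil_apply, hf]
    have h8 := h t 1 y
    rw [h7, Matrix.mul_smul, trace_smul] at h8
    rw [h1]
    exact h8
  have hzero : ∀ t : ℝ, P.eval (C t) = 0 := by
    intro t
    have h1 : X * P.eval (C t) = 0 := by
      refine Polynomial.funext fun y => ?_
      rw [eval_mul, eval_X, heval, eval_zero]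
    exact (mul_eq_zero.1 h1).resolve_left X_ne_zero
  refine eq_zero_of_infinite_isRoot P ((Set.infinite_range_of_injective C_injective).mono ?_)
  rintro _ ⟨t, rfl⟩
  exact hzero t

theorem snd_eq_zero_of_trace_adjugate {m : ℕ} {e f : PencilSpace m}
    (he : Function.Injective e.1)
    (hNC : ∀ (t y : ℂ) (N : Matrix (Fin m) (Fin m) ℂ), Nᵀ = -N → pencil e t 1 y * N = 0 → N = 0)
    (hNC' : ∀ (t : ℂ) (N : Matrix (Fin m) (Fin m) ℂ), Nᵀ = -N → pencil e t 0 1 * N = 0 → N = 0)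
    (h : ((pencil e (X : ℝ[X][X]) 1 (C X)).adjugate * pencil f 0 0 1).trace = 0) : f.2 = 0 := by
  have halg : ∀ r : ℝ, algebraMap ℝ ℝ[X] r = C r := fun r => rfl
  have hM : (pencil e (X : ℝ[X][X]) 1 (C X)) = (X : ℝ[X][X]) • 1 + (pencil e 0 1 X).map C := by
    refine Matrix.ext fun i j => ?_
    rw [Matrix.add_apply, map_apply, pencil_apply, pencil_apply, IsScalarTower.algebraMap_apply ℝ ℝ[X]]
    by_cases hij : i = j <;> simp [hij, IsScalarTower.algebraMap_apply ℝ ℝ[X] ℝ[X][X]] <;> ring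
  have hS : (pencil f (0 : ℝ[X][X]) 0 1) = (pencil f (0 : ℝ[X]) 0 1).map C := by
    refine Matrix.ext fun i j => ?_
    rw [map_apply, pencil_apply, pencil_apply]
    by_cases hij : i = j <;> simp [hij, IsScalarTower.algebraMap_apply ℝ ℝ[X] ℝ[X][X]]
  rw [hM, hS] at h
  have hv : (Matrix.of fun i k : Fin m =>
      (pencil e (0 : ℝ[X]) 1 X ^ (k : ℕ) *ᵥ fun _ => (1 : ℝ[X])) i).det ≠ 0 := by
    intro h0
    have h1 := congrArg (evalRingHom (0 : ℝ)) h0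
    rw [RingHom.map_det, map_zero] at h1
    have h2 : (evalRingHom (0 : ℝ)).mapMatrix (Matrix.of fun i k : Fin m =>
        (pencil e (0 : ℝ[X]) 1 X ^ (k : ℕ) *ᵥ fun _ => (1 : ℝ[X])) i) = vandermonde e.1 := by
      have h3 : ∀ k : ℕ, (pencil e (0 : ℝ[X]) 1 X ^ k).map (evalRingHom (0 : ℝ)) =
          diagonal (fun i => e.1 i ^ k) := by
        intro k
        have h4 : (pencil e (0 : ℝ[X]) 1 X).map (evalRingHom (0 : ℝ)) = diagonal e.1 := by
          ext i j
          rw [map_apply, pencil_apply]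
          by_cases hij : i = j <;> simp [hij]
        have h5 := map_pow (evalRingHom (0 : ℝ)).mapMatrix (pencil e (0 : ℝ[X]) 1 X) k
        simp only [RingHom.mapMatrix_apply] at h5
        rw [h5, h4, diagonal_pow]
        rfl
      ext i k
      have h6 : ((evalRingHom (0 : ℝ)).mapMatrix (Matrix.of fun i k : Fin m =>
          (pencil e (0 : ℝ[X]) 1 X ^ (k : ℕ) *ᵥ fun _ => (1 : ℝ[X])) i)) i k =
          ∑ j, ((pencil e (0 : ℝ[X]) 1 X ^ (k : ℕ)).map (evalRingHom (0 : ℝ))) i j := by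
        simp [mulVec, dotProduct, eval_finsetSum]
      rw [h6, h3]
      simp [diagonal_apply]
    rw [h2] at h1
    exact det_vandermonde_ne_zero_iff.2 he h1
  obtain ⟨Q, δ, hδ, hQ, hQM⟩ := exists_skew_commutator_of_isDomain (pencil_transpose e 0 1 X)
    (pencil_transpose f 0 0 1) (fun _ => (1 : ℝ[X])) hv (trace_pow_mul_eq_zero h)
  let ψ : ℝ[X] →+* ℂ[X] := mapRingHom Complex.ofRealHom
  have hψ : Function.Injective ψ := Polynomial.map_injective _ Complex.ofReal_injective
  have h0 : pencil f (0 : ℂ) 0 1 = 0 := by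
    refine eq_zero_of_skew_commutator (A := pencil e 0 0 1) (B := pencil e 0 1 0) (Q := Q.map ψ)
      (δ := ψ δ) (pencil_transpose _ _ _ _) (pencil_transpose _ _ _ _) ?_ ?_ ?_ ?_ ?_
    · intro t y N hN h1
      refine hNC t y N hN ?_
      convert h1 using 2
      ext i j
      simp only [pencil_apply, Matrix.add_apply, Matrix.smul_apply, smul_eq_mul, one_apply]
      by_cases hij : i = j
      · simp [hij]
        ring
      · simp [hij]
    · intro t N hN h1
      refine hNC' t N hN ?_
      convert h1 using 2
      ext i j
      simp only [pencil_apply, Matrix.add_apply, Matrix.smul_apply, smul_eq_mul, one_apply]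
      by_cases hij : i = j <;> simp [hij]
    · exact fun h0 => hδ ((map_eq_zero_iff ψ hψ).1 h0)
    · rw [← transpose_map, hQ]
      refine Matrix.ext fun i j => ?_
      simp
    · have h1 := congrArg (fun N : Matrix (Fin m) (Fin m) ℝ[X] => N.map ψ) hQM
      have h2 : ∀ N N' : Matrix (Fin m) (Fin m) ℝ[X], (N - N').map ψ = N.map ψ - N'.map ψ := by
        intro N N'
        refine Matrix.ext fun i j => ?_
        simp
      have h3 : (pencil e (0 : ℝ[X]) 1 X).map ψ =
          (pencil e (0 : ℂ) 1 0).map C + (X : ℂ[X]) • (pencil e (0 : ℂ) 0 1).map C := by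
        refine Matrix.ext fun i j => ?_
        simp only [pencil_apply, map_apply, Matrix.add_apply, Matrix.smul_apply, smul_eq_mul, halg, ψ]
        by_cases hij : i = j <;> simp [hij]
      have h4 : (δ • pencil f (0 : ℝ[X]) 0 1).map ψ = ψ δ • (pencil f (0 : ℂ) 0 1).map C := by
        refine Matrix.ext fun i j => ?_
        simp only [pencil_apply, map_apply, Matrix.smul_apply, smul_eq_mul, halg, ψ]
        by_cases hij : i = j <;> simp [hij]
      simp only [h2, Matrix.map_mul, h3, h4] at h1
      exact h1
  ext s
  induction s using Sym2.inductionOn with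
  | _ i j =>
    have h1 := congrFun (congrFun h0 i) j
    rw [pencil_apply] at h1
    simpa using h1

theorem eq_zero_of_trace_adjugate {m : ℕ} {e f : PencilSpace m}
    (he : Function.Injective e.1)
    (hNC : ∀ (t y : ℂ) (N : Matrix (Fin m) (Fin m) ℂ), Nᵀ = -N → pencil e t 1 y * N = 0 → N = 0)
    (hNC' : ∀ (t : ℂ) (N : Matrix (Fin m) (Fin m) ℂ), Nᵀ = -N → pencil e t 0 1 * N = 0 → N = 0)
    (h : ∀ t x y : ℝ, ((pencil e t x y).adjugate * pencil f 0 x y).trace = 0) : f = 0 := by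
  have h1 := fst_eq_zero_of_trace_adjugate he h
  exact Prod.ext h1
    (snd_eq_zero_of_trace_adjugate he hNC hNC' (trace_adjugate_pencil_X_eq_zero h1 h))

end

theorem TernaryIndex.card (m : ℕ) : Fintype.card (TernaryIndex m) = m + (m + 1).choose 2 := by
  rw [Fintype.card_sigma]
  simp only [Fintype.card_fin]
  rw [Fin.sum_univ_eq_sum_range fun i => m - i + 1]
  induction m with
  | zero => rfl
  | succ m ih =>
    rw [Finset.sum_range_succ']
    simp only [Nat.add_sub_add_right, ih, Nat.sub_zero]
    rw [Nat.choose_succ_succ (m + 1) 1, Nat.choose_one_right]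
    simp only [Nat.succ_eq_add_one, Nat.reduceAdd]
    omega

theorem finrank_pencilSpace (m : ℕ) :
    Module.finrank ℝ (PencilSpace m) = Module.finrank ℝ (TernaryIndex m → ℝ) := by
  rw [Module.finrank_prod, Module.finrank_fintype_fun_eq_card, Module.finrank_fintype_fun_eq_card,
    Module.finrank_fintype_fun_eq_card, TernaryIndex.card, Sym2.card, Fintype.card_fin]

theorem pencil_add_smul {m : ℕ} (e f : PencilSpace m) (s t x y : ℝ) :
    pencil (e + s • f) t x y = pencil e t x y + s • pencil f 0 x y := by
  ext i j
  simp only [pencil_apply, Matrix.add_apply, Matrix.smul_apply]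
  by_cases hij : i = j <;> simp [hij] <;> ring

open Matrix in
/-- At a pencil none of whose members annihilates a nonzero skew-symmetric matrix, the
determinant map is a submersion. -/
theorem detForm_mem_interior_range {m : ℕ} {e : PencilSpace m} (he : Function.Injective e.1)
    (hNC : ∀ (t y : ℂ) (N : Matrix (Fin m) (Fin m) ℂ), Nᵀ = -N → pencil e t 1 y * N = 0 → N = 0)
    (hNC' : ∀ (t : ℂ) (N : Matrix (Fin m) (Fin m) ℂ), Nᵀ = -N → pencil e t 0 1 * N = 0 → N = 0) :
    detForm e ∈ interior (Set.range (detForm (m := m))) := by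
  have hd := (contDiff_detForm (m := m)).contDiffAt.hasStrictFDerivAt (x := e) one_ne_zero
  have hinj : Function.Injective (fderiv ℝ (detForm (m := m)) e) := by
    rw [injective_iff_map_eq_zero]
    intro f hf
    refine eq_zero_of_trace_adjugate he hNC hNC' fun t x y => ?_
    have h1 : HasDerivAt (fun s : ℝ => detForm (e + s • f)) (fderiv ℝ (detForm (m := m)) e f) 0 := by
      have h2 : HasDerivAt (fun s : ℝ => e + s • f) f 0 := by
        simpa using ((hasDerivAt_id (0 : ℝ)).smul_const f).const_add e
      have h3 : HasFDerivAt (detForm (m := m)) (fderiv ℝ (detForm (m := m)) e)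
          (e + (0 : ℝ) • f) := by
        simpa using hd.hasFDerivAt
      exact h3.comp_hasDerivAt 0 h2
    let L := LinearMap.toContinuousLinearMap (TernaryForm.lowerEval m (t, x, y))
    have h4 : HasDerivAt (fun s : ℝ => L (detForm (e + s • f))) 0 0 := by
      have := L.hasFDerivAt.comp_hasDerivAt (0 : ℝ) h1
      rw [hf, map_zero] at this
      exact this
    have h5 : HasDerivAt (fun s : ℝ => L (detForm (e + s • f)))
        ((pencil e t x y).adjugate * pencil f 0 x y).trace 0 := by
      have h6 : (fun s : ℝ => L (detForm (e + s • f))) = fun s =>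
          (pencil e t x y + s • pencil f 0 x y).det - t ^ m := by
        ext s
        have : L (detForm (e + s • f)) = ternaryForm (detForm (e + s • f)) t x y - t ^ m := rfl
        rw [this, ternaryForm_detForm_real, pencil_add_smul]
      rw [h6]
      exact (hasDerivAt_det_add_smul _ _).sub_const _
    exact h5.unique h4
  have hsurj : Function.Surjective (fderiv ℝ (detForm (m := m)) e) :=
    (LinearMap.injective_iff_surjective_of_finrank_eq_finrank (finrank_pencilSpace m)).1 hinj
  have hmap := hd.map_nhds_eq_of_surj (LinearMap.range_eq_top.2 hsurj)
  rw [mem_interior_iff_mem_nhds, ← hmap]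
  exact Filter.range_mem_map

section

open Matrix Polynomial

theorem linePoly_detForm_eq_charpoly {m : ℕ} (e : PencilSpace m) (x y : ℂ) :
    linePoly (detForm e) x y = (-pencil e 0 x y).charpoly := by
  refine Polynomial.funext fun t => ?_
  rw [TernaryForm.linePoly_eval, ternaryForm_detForm, eval_charpoly]
  congr 1
  ext i j
  rw [Matrix.sub_apply, Matrix.neg_apply, pencil_apply, pencil_apply, scalar_apply, diagonal_apply]
  by_cases hij : i = j <;> simp [hij]
  ring

/-- No member of a strictly hyperbolic pencil over a real point annihilates a nonzero
skew-symmetric matrix. -/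
theorem eq_zero_of_skew_of_mem_strictlyHyperbolic {m : ℕ} {e : PencilSpace m}
    (he : detForm e ∈ strictlyHyperbolic m) {x y : ℝ} (hxy : x ≠ 0 ∨ y ≠ 0) {t : ℂ}
    {N : Matrix (Fin m) (Fin m) ℂ} (hN : Nᵀ = -N) (h : pencil e t (x : ℂ) (y : ℂ) * N = 0) :
    N = 0 := by
  by_contra hN0
  obtain ⟨h1, h2⟩ := adjugate_eq_zero_of_mul_skew hN hN0 h
  refine (he x y hxy t ((ternaryForm_detForm _ _ _ _).trans h2)).2 ?_
  obtain ⟨p, hp, hd⟩ := exists_eval_eq_det_add_smul (pencil e t (x : ℂ) (y : ℂ)) 1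
  have h3 : p = (linePoly (detForm e) x y).comp (X + C t) := by
    refine Polynomial.funext fun s => ?_
    rw [hp, eval_comp, TernaryForm.linePoly_eval, ternaryForm_detForm]
    congr 1
    ext i j
    rw [Matrix.add_apply, Matrix.smul_apply, pencil_apply, pencil_apply, one_apply]
    by_cases hij : i = j <;> simp [hij]
    ring
  rw [h1, zero_mul, trace_zero, h3, derivative_comp] at hd
  simpa using hd

theorem skew_single {m : ℕ} (i j : Fin m) :
    (single i j (1 : ℂ) - single j i 1)ᵀ = -(single i j 1 - single j i 1) := by
  simp

theorem injective_fst_of_mem_strictlyHyperbolic {m : ℕ} {e : PencilSpace m}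
    (he : detForm e ∈ strictlyHyperbolic m) : Function.Injective e.1 := by
  intro i j hij
  by_contra hne
  have h := eq_zero_of_skew_of_mem_strictlyHyperbolic he (x := 1) (y := 0) (by simp)
    (t := -(e.1 i : ℂ)) (skew_single i j) (by
      ext k l
      simp only [mul_apply, pencil_apply, Matrix.sub_apply, single_apply, Matrix.zero_apply]
      rw [Finset.sum_eq_single k]
      · by_cases hki : k = i
        · subst hki
          simp
        · by_cases hkj : k = j
          · subst hkj
            simp [hij]
          · simp [Ne.symm hki, Ne.symm hkj]
      · intro b _ hb
        simp [Ne.symm hb]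
      · simp)
  have := congrFun (congrFun h i) j
  simp [hne] at this

theorem mem_strictlyHyperbolic_of_forall_skew {m : ℕ} {e : PencilSpace m}
    (h : ∀ x y : ℝ, (x ≠ 0 ∨ y ≠ 0) → ∀ (t : ℂ) (N : Matrix (Fin m) (Fin m) ℂ), Nᵀ = -N →
      pencil e t (x : ℂ) (y : ℂ) * N = 0 → N = 0) : detForm e ∈ strictlyHyperbolic m := by
  intro x y hxy t ht
  have hB : (-pencil e 0 (x : ℂ) (y : ℂ)).IsHermitian := by
    ext i j
    rw [conjTranspose_apply, Matrix.neg_apply, Matrix.neg_apply, pencil_apply, pencil_apply,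
      Sym2.eq_swap]
    by_cases hij : i = j
    · simp [hij]
    · simp [hij, Ne.symm hij]
  have hp : linePoly (detForm e) x y = ∏ i, (X - C (hB.eigenvalues i : ℂ)) := by
    rw [linePoly_detForm_eq_charpoly, hB.charpoly_eq]
    rfl
  rw [← TernaryForm.linePoly_eval, hp, eval_prod, Finset.prod_eq_zero_iff] at ht
  obtain ⟨i, -, hi⟩ := ht
  have hti : t = hB.eigenvalues i := by simpa [sub_eq_zero] using hi
  refine ⟨by simp [hti], ?_⟩
  rw [hp, derivative_prod_finset, eval_finsetSum, Finset.sum_eq_single i]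
  · simp only [derivative_sub, derivative_X, derivative_C, sub_zero, mul_one, eval_prod, eval_sub,
      eval_X, eval_C]
    refine Finset.prod_ne_zero_iff.2 fun j hj h0 => ?_
    have hji : j ≠ i := (Finset.mem_erase.1 hj).1
    have htj : t = hB.eigenvalues j := sub_eq_zero.1 h0
    let u : Fin m → Fin m → ℂ := fun k => (hB.eigenvectorBasis k).ofLp
    have hu : ∀ k, t = hB.eigenvalues k → pencil e t (x : ℂ) (y : ℂ) *ᵥ u k = 0 := by
      intro k hk
      have h1 : pencil e t (x : ℂ) (y : ℂ) = t • 1 - (-pencil e 0 (x : ℂ) (y : ℂ)) := by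
        ext a b
        rw [Matrix.sub_apply, Matrix.neg_apply, Matrix.smul_apply, pencil_apply, pencil_apply,
          one_apply]
        by_cases hab : a = b <;> simp [hab]
        ring
      rw [h1, sub_mulVec, hB.mulVec_eigenvectorBasis k, smul_mulVec, one_mulVec, hk]
      ext a
      simp [u]
    have horth : ∀ k l, u k ⬝ᵥ star (u l) = if k = l then 1 else 0 := by
      intro k l
      have := orthonormal_iff_ite.1 hB.eigenvectorBasis.orthonormal l k
      rw [EuclideanSpace.inner_eq_star_dotProduct] at this
      simp only [eq_comm (a := k)]
      exact this
    have h1 := h x y hxy t (vecMulVec (u i) (u j) - vecMulVec (u j) (u i))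
      (by rw [transpose_sub, transpose_vecMulVec, transpose_vecMulVec, neg_sub])
      (by rw [mul_sub, mul_vecMulVec, mul_vecMulVec, hu i hti, hu j htj]; simp)
    have h2 := congrArg (fun N => N *ᵥ star (u j)) h1
    simp only [sub_mulVec, vecMulVec_mulVec, horth, if_true, Ne.symm hji, if_false, zero_mulVec] at h2
    have h3 : u i = 0 := by simpa using h2
    have h4 := horth i i
    rw [h3] at h4
    simp at h4
  · intro j _ hj
    rw [eval_mul, eval_prod, Finset.prod_eq_zero (i := i)]
    · simp
    · simp [Ne.symm hj]
    · simp [hti]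
  · simp

/-- The pencil with diagonal part `0, 1, 2, …` and the adjacency matrix of the path graph. -/
def pathPencil (m : ℕ) : PencilSpace m :=
  (fun i => (i : ℕ), Sym2.lift ⟨fun i j => if (i : ℕ) + 1 = j ∨ (j : ℕ) + 1 = i then 1 else 0,
    fun i j => by simp only [or_comm]⟩)

theorem pathPencil_mulVec_eq_zero {m : ℕ} {t x y : ℂ} (hy : y ≠ 0) {u : Fin m → ℂ}
    (h : pencil (pathPencil m) t x y *ᵥ u = 0) (h0 : ∀ i : Fin m, (i : ℕ) = 0 → u i = 0) :
    u = 0 := by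
  have key : ∀ n : ℕ, ∀ i : Fin m, (i : ℕ) = n → u i = 0 := by
    intro n
    induction n using Nat.strong_induction_on with
    | _ n ih =>
    intro i hi
    rcases n with _ | n
    · exact h0 i hi
    · have h1 := congrFun h ⟨n, by omega⟩
      simp only [mulVec, dotProduct, Pi.zero_apply] at h1
      rw [Finset.sum_eq_single i] at h1
      · refine (mul_eq_zero.1 h1).resolve_left ?_
        rw [pencil_apply]
        have h2 : (⟨n, by omega⟩ : Fin m) ≠ i := by
          intro h3
          have := congrArg Fin.val h3
          simp only at this
          omega
        simp [h2, pathPencil, hi, hy]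
      · intro j _ hj
        by_cases hjn : (j : ℕ) < n + 1
        · rw [ih j hjn j rfl, mul_zero]
        · have h2 : (j : ℕ) ≠ n + 1 := fun h3 => hj (Fin.ext (h3.trans hi.symm))
          have h3 : (⟨n, by omega⟩ : Fin m) ≠ j := by
            intro h3
            have := congrArg Fin.val h3
            simp only at this
            omega
          have h4 : ¬ (n + 1 = (j : ℕ) ∨ (j : ℕ) + 1 = n) := by omega
          rw [pencil_apply]
          simp [h3, pathPencil, h4]
      · simp
  ext i
  exact key i i rfl

theorem pathPencil_eq_zero_of_skew {m : ℕ} {t x y : ℂ} (hxy : x ≠ 0 ∨ y ≠ 0)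
    {N : Matrix (Fin m) (Fin m) ℂ} (hN : Nᵀ = -N) (h : pencil (pathPencil m) t x y * N = 0) :
    N = 0 := by
  have hskew : ∀ i j, N j i = -N i j := fun i j => congrFun (congrFun hN i) j
  have hdiag : ∀ i, N i i = 0 := fun i => self_eq_neg.1 (hskew i i)
  by_cases hy : y = 0
  · subst hy
    have hx : x ≠ 0 := hxy.resolve_right (by simp)
    have h1 : ∀ i j, N i j ≠ 0 → t + x * (i : ℕ) = 0 := by
      intro i j hij
      have h2 := congrFun (congrFun h i) j
      rw [mul_apply, Finset.sum_eq_single i] at h2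
      · rw [pencil_apply] at h2
        simpa [pathPencil, hij] using h2
      · intro k _ hk
        rw [pencil_apply]
        simp [Ne.symm hk]
      · simp
    ext i j
    rw [Matrix.zero_apply]
    by_contra hij
    have h2 := h1 i j hij
    have h3 := h1 j i (by rw [hskew i j]; exact neg_ne_zero.2 hij)
    have h4 : x * ((i : ℕ) - (j : ℕ) : ℂ) = 0 := by linear_combination h2 - h3
    have h5 := sub_eq_zero.1 ((mul_eq_zero.1 h4).resolve_left hx)
    have h6 : i = j := Fin.ext (by exact_mod_cast h5)
    exact hij (h6 ▸ hdiag i)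
  · have hcol : ∀ j, pencil (pathPencil m) t x y *ᵥ (fun i => N i j) = 0 := by
      intro j
      ext i
      exact congrFun (congrFun h i) j
    have h1 : ∀ j : Fin m, (j : ℕ) = 0 → ∀ i, N i j = 0 := by
      intro j hj i
      refine congrFun (pathPencil_mulVec_eq_zero hy (hcol j) fun k hk => ?_) i
      have : k = j := Fin.ext (hk.trans hj.symm)
      rw [this, hdiag]
    ext i j
    refine congrFun (pathPencil_mulVec_eq_zero hy (hcol j) fun k hk => ?_) i
    rw [hskew j k, h1 k hk, neg_zero]

theorem detForm_pathPencil_mem (m : ℕ) : detForm (pathPencil m) ∈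
    strictlyHyperbolic m ∩ interior (Set.range (detForm (m := m))) := by
  refine ⟨mem_strictlyHyperbolic_of_forall_skew fun x y hxy t N hN h =>
    pathPencil_eq_zero_of_skew ?_ hN h, detForm_mem_interior_range ?_
    (fun t y N hN h => pathPencil_eq_zero_of_skew ?_ hN h)
    (fun t N hN h => pathPencil_eq_zero_of_skew ?_ hN h)⟩
  · simpa using hxy
  · intro i j hij
    have h1 : ((i : ℕ) : ℝ) = (j : ℕ) := hij
    exact Fin.ext (by exact_mod_cast h1)
  · simp
  · simp

/-- A strictly hyperbolic determinantal form outside of the interior of the set of determinantal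
forms has a nonreal point over which the pencil annihilates a skew-symmetric matrix. -/
theorem exists_skew_of_notMem_interior {m : ℕ} {e : PencilSpace m}
    (he : detForm e ∈ strictlyHyperbolic m)
    (h : detForm e ∉ interior (Set.range (detForm (m := m)))) :
    ∃ (t y : ℂ) (N : Matrix (Fin m) (Fin m) ℂ), y.im ≠ 0 ∧ Nᵀ = -N ∧ N ≠ 0 ∧
      pencil e t 1 y * N = 0 := by
  by_contra! hne
  refine h (detForm_mem_interior_range (injective_fst_of_mem_strictlyHyperbolic he) ?_ ?_)
  · intro t y N hN h1
    by_cases hy : y.im = 0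
    · have hy' : y = (y.re : ℂ) := Complex.ext rfl (by simpa using hy)
      refine eq_zero_of_skew_of_mem_strictlyHyperbolic he (x := 1) (y := y.re) (t := t) (by simp)
        hN ?_
      rw [← hy']
      simpa using h1
    · by_contra hN0
      exact hne t y N hy hN hN0 h1
  · intro t N hN h1
    refine eq_zero_of_skew_of_mem_strictlyHyperbolic he (x := 0) (y := 1) (t := t) (by simp)
        hN ?_
    simpa using h1

end

section

open Matrix Polynomial

theorem three_le_of_mul_skew_eq_zero {m : ℕ} {e : PencilSpace m}
    (he : detForm e ∈ strictlyHyperbolic m) {t y : ℂ} (hy : y.im ≠ 0)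
    {N : Matrix (Fin m) (Fin m) ℂ} (hN : Nᵀ = -N) (hN0 : N ≠ 0) (h : pencil e t 1 y * N = 0) :
    3 ≤ m := by
  have hskew : ∀ i j, N j i = -N i j := fun i j => congrFun (congrFun hN i) j
  have hdiag : ∀ i, N i i = 0 := fun i => self_eq_neg.1 (hskew i i)
  by_contra! hm
  interval_cases m
  · exact hN0 (Subsingleton.elim _ _)
  · exact hN0 (Matrix.ext fun i j => by rw [Subsingleton.elim j i, hdiag]; rfl)
  · have h01 : N 0 1 ≠ 0 := by
      intro h0
      refine hN0 (Matrix.ext fun i j => ?_)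
      fin_cases i <;> fin_cases j <;> simp [hdiag, h0, hskew 0 1]
    have e1 := congrFun (congrFun h 0) 1
    have e2 := congrFun (congrFun h 1) 0
    simp only [mul_apply, Fin.sum_univ_two, hdiag, hskew 0 1, mul_zero, add_zero, zero_add,
      Matrix.zero_apply, mul_neg, neg_eq_zero, mul_eq_zero, h01, or_false] at e1 e2
    simp only [pencil_apply, if_true, one_mul, Complex.coe_algebraMap] at e1 e2
    have h3 := e1.trans e2.symm
    have him := congrArg Complex.im h3
    have hre := congrArg Complex.re h3
    simp at him hre
    have ha : e.2 s(0, 0) = e.2 s(1, 1) := him.resolve_right hy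
    rw [ha] at hre
    have := injective_fst_of_mem_strictlyHyperbolic he (by linarith : e.1 0 = e.1 1)
    simp at this

end

section

open MvPolynomial

theorem TernaryForm.exists_shear {m : ℕ} (a b : ℝ) (c : TernaryIndex m → ℝ) :
    ∃ c' : TernaryIndex m → ℝ, ∀ t x y : ℂ,
      ternaryForm c' t x y = ternaryForm c (t + (a * y + b * x)) x y := by
  set P : MvPolynomial (Fin 3) ℂ := ternaryForm c
    (X 0 + (C (a : ℂ) * X 2 + C (b : ℂ) * X 1)) (X 1) (X 2) with hP
  have hl : (C (a : ℂ) * X 2 + C (b : ℂ) * X 1 : MvPolynomial (Fin 3) ℂ).IsHomogeneous 1 := by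
    have := ((isHomogeneous_C _ (a : ℂ)).mul (isHomogeneous_X ℂ (2 : Fin 3))).add
      ((isHomogeneous_C _ (b : ℂ)).mul (isHomogeneous_X ℂ (1 : Fin 3)))
    simpa using this
  have hPh : P.IsHomogeneous m := isHomogeneous_ternaryForm c ((isHomogeneous_X _ _).add hl)
    (isHomogeneous_X _ _) (isHomogeneous_X _ _)
  have h1 : (eval ![(1 : ℂ), 0, 0] P).re = 1 := by
    rw [hP, eval_ternaryForm]
    have := ofReal c 1 0 0
    simp only [at_one_zero_zero, Complex.ofReal_one, Complex.ofReal_zero] at this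
    simp [← this]
  obtain ⟨c', hc'⟩ := exists_of_isHomogeneous hPh h1
  refine ⟨c', ?_⟩
  have key : (ternaryForm c' (X 0) (X 1) (X 2) : MvPolynomial (Fin 3) ℂ) = P := by
    refine MvPolynomial.eq_of_eval_ofReal_eq fun v => ?_
    have e1 : (![(v 0 : ℂ), v 1, v 2] : Fin 3 → ℂ) = fun i => (v i : ℂ) := by
      ext i
      fin_cases i <;> rfl
    rw [eval_ternaryForm, eval_X, eval_X, eval_X, ← ofReal, hc', e1, hP, eval_ternaryForm]
    simp only [map_add, map_mul, eval_X, eval_C, ← Complex.ofReal_mul, ← Complex.ofReal_add,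
      ← ofReal, Complex.ofReal_re]
  intro t x y
  have := congrArg (eval ![t, x, y]) key
  rw [hP, eval_ternaryForm, eval_ternaryForm] at this
  simpa using this

theorem TernaryForm.ext_one {m : ℕ} {c c' : TernaryIndex m → ℝ}
    (h : ∀ t y : ℝ, ternaryForm c t 1 y = ternaryForm c' t 1 y) : c = c' := by
  have hc : ∀ (a : TernaryIndex m → ℝ) (t y : ℝ), Continuous fun x => ternaryForm a t x y :=
    fun a t y => by unfold ternaryForm; fun_prop
  refine ext fun t x y => ?_
  revert x
  refine funext_iff.1 (Continuous.ext_on (dense_compl_singleton (0 : ℝ)) (hc c t y) (hc c' t y) ?_)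
  intro x hx
  have hx' : x ≠ 0 := hx
  have h1 : ∀ a : TernaryIndex m → ℝ,
      ternaryForm a t x y = x ^ m * ternaryForm a (t / x) 1 (y / x) := by
    intro a
    rw [← smul, mul_div_cancel₀ _ hx', mul_div_cancel₀ _ hx', mul_one]
  simp only [h1, h]

end

section

variable {n : ℕ}

theorem TernaryForm.eq_sq_mul_add {R : Type*} [CommRing R] [Algebra ℝ R]
    (c : TernaryIndex (n + 2) → ℝ) (t y : R) :
    ternaryForm c t 1 y =
      t ^ 2 * ternaryForm (fun k : TernaryIndex n =>
        c ⟨k.1.succ.succ, k.2.cast (by simp)⟩) t 1 y +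
      t * (∑ j : Fin (n + 2), algebraMap ℝ R (c ⟨1, j.cast (by simp)⟩) * y ^ (j : ℕ)) +
      ∑ j : Fin (n + 3), algebraMap ℝ R (c ⟨0, j⟩) * y ^ (j : ℕ) := by
  set F : Fin (n + 2) → R := fun i => ∑ j : Fin (n + 2 - i + 1),
    algebraMap ℝ R (c ⟨i, j⟩) * (t ^ (i : ℕ) * y ^ (j : ℕ)) with hF
  have h2 : ∀ i : Fin n, F i.succ.succ =
      t ^ 2 * ∑ j : Fin (n - i + 1), algebraMap ℝ R (c ⟨i.succ.succ, j.cast (by simp)⟩) *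
        (t ^ (i : ℕ) * y ^ (j : ℕ)) := by
    intro i
    rw [Finset.mul_sum]
    refine Fintype.sum_equiv (finCongr (by simp)) _ _ fun j => ?_
    simp only [finCongr_apply, Fin.val_cast, Fin.val_succ, pow_add, pow_one, Fin.cast_cast,
      Fin.cast_refl, id]
    ring
  have h1 : F 1 =
      t * ∑ j : Fin (n + 2), algebraMap ℝ R (c ⟨1, j.cast (by simp)⟩) * y ^ (j : ℕ) := by
    rw [Finset.mul_sum]
    refine Fintype.sum_equiv (finCongr (by simp)) _ _ fun j => ?_
    change _ = t * (algebraMap ℝ R (c ⟨1, j⟩) * y ^ (j : ℕ))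
    simp only [Fin.val_one, pow_one]
    ring
  have h0 : F 0 = ∑ j : Fin (n + 3), algebraMap ℝ R (c ⟨0, j⟩) * y ^ (j : ℕ) := by
    refine Finset.sum_congr rfl fun j _ => ?_
    simp
  have hL : ternaryForm c t 1 y = t ^ (n + 2) + (F 0 + (F 1 + ∑ i : Fin n, F i.succ.succ)) := by
    have : ∑ i, F i = F 0 + (F 1 + ∑ i : Fin n, F i.succ.succ) := by
      rw [Fin.sum_univ_succ, Fin.sum_univ_succ]
      rfl
    rw [← this]
    simp only [ternaryForm, one_pow, one_mul, Fintype.sum_sigma, hF]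
  simp only [hL, h2, ← Finset.mul_sum, h1, h0]
  simp only [ternaryForm, one_pow, one_mul, Fintype.sum_sigma]
  ring

end

section

open Matrix Polynomial

theorem Polynomial.Monic.degree_lt_of_mul {R : Type*} [CommRing R] [Nontrivial R] {p q : R[X]}
    (hp : p.Monic) {k : ℕ} (h : (p * q).degree < (k : ℕ)) :
    q.degree < (k - p.natDegree : ℕ) := by
  by_cases hq : q = 0
  · rw [hq, degree_zero]
    exact WithBot.bot_lt_coe _
  · have h0 : p * q ≠ 0 := hp.mul_right_ne_zero hq
    rw [← natDegree_lt_iff_degree_lt h0, hp.natDegree_mul' hq] at h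
    rw [← natDegree_lt_iff_degree_lt hq]
    omega

theorem Polynomial.eval_eq_sum_fin {R : Type*} [CommRing R] {p : R[X]} {k : ℕ}
    (h : p.degree < (k : ℕ)) (y : R) : p.eval y = ∑ j : Fin k, p.coeff j * y ^ (j : ℕ) := by
  rw [eval_eq_sum, ← Polynomial.sum_fin _ (by simp) h]

theorem exists_conjugate_singularity {n : ℕ} {e : PencilSpace (n + 2)} {t z : ℂ} (hz : z.im ≠ 0)
    {N : Matrix (Fin (n + 2)) (Fin (n + 2)) ℂ} (hN : Nᵀ = -N) (hN0 : N ≠ 0)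
    (h : pencil e t 1 z * N = 0) :
    ∃ (a b p q : ℝ) (u : TernaryIndex n → ℝ) (v : Fin n → ℝ) (w : Fin (n - 1) → ℝ), ∀ s y : ℝ,
      ternaryForm (detForm e) (s + (a * y + b)) 1 y = s ^ 2 * ternaryForm u s 1 y +
        s * ((y ^ 2 + p * y + q) * ∑ j, v j * y ^ (j : ℕ)) +
        (y ^ 2 + p * y + q) ^ 2 * ∑ j, w j * y ^ (j : ℕ) := by
  obtain ⟨hadj, hdet⟩ := adjugate_eq_zero_of_mul_skew hN hN0 h
  set a : ℝ := t.im / z.im with ha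
  set b : ℝ := t.re - a * z.re with hb
  have ht : t = a * z + b := by
    apply Complex.ext
    · simp [hb]
    · simp [ha, hz]
  obtain ⟨c, hc⟩ := TernaryForm.exists_shear a b (detForm e)
  set u : TernaryIndex n → ℝ := fun k => c ⟨k.1.succ.succ, k.2.cast (by simp)⟩ with hu
  set v : Fin (n + 2) → ℝ := fun j => c ⟨1, j.cast (by simp)⟩ with hv
  set w : Fin (n + 3) → ℝ := fun j => c ⟨0, j⟩ with hw
  set V : ℝ[X] := ∑ j : Fin (n + 2), C (v j) * X ^ (j : ℕ) with hV
  set W : ℝ[X] := ∑ j : Fin (n + 3), C (w j) * X ^ (j : ℕ) with hW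
  have hVe : ∀ y : ℂ, aeval y V = ∑ j, algebraMap ℝ ℂ (v j) * y ^ (j : ℕ) := fun y => by simp [hV]
  have hWe : ∀ y : ℂ, aeval y W = ∑ j, algebraMap ℝ ℂ (w j) * y ^ (j : ℕ) := fun y => by simp [hW]
  have hsplit : ∀ s y : ℂ, ternaryForm c s 1 y =
      s ^ 2 * ternaryForm u s 1 y + s * aeval y V + aeval y W := fun s y => by
    rw [hVe, hWe]
    exact TernaryForm.eq_sq_mul_add c s y
  have hWz : aeval z W = 0 := by
    have h1 := hsplit 0 z
    rw [hc, zero_add, mul_one, ← ht, ternaryForm_detForm, hdet] at h1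
    simpa using h1.symm
  have hVz : aeval z V = 0 := by
    obtain ⟨P, hP, hPd⟩ := exists_eval_eq_det_add_smul (pencil e t 1 z) 1
    have : P = X ^ 2 * linePoly u 1 z + X * C (aeval z V) + C (aeval z W) := by
      refine Polynomial.funext fun s => ?_
      simp only [eval_add, eval_mul, eval_pow, eval_X, eval_C, TernaryForm.linePoly_eval]
      rw [hP, ← hsplit, hc, ternaryForm_detForm, mul_one, ← ht]
      congr 1
      rw [pencil, pencil, add_smul]
      abel
    rw [this, hadj] at hPd
    simpa [derivative_mul] using hPd
  have hW'z : aeval z (derivative W) = 0 := by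
    obtain ⟨P, hP, hPd⟩ := exists_eval_eq_det_add_smul (pencil e t 1 z) (pencil e a 0 1)
    have : P = (W.map (algebraMap ℝ ℂ)).comp (X + C z) := by
      refine Polynomial.funext fun s => ?_
      have h1 := hsplit 0 (s + z)
      rw [eval_comp, eval_map_algebraMap, eval_add, eval_X, eval_C, hP]
      rw [hc, ternaryForm_detForm] at h1
      simp only [ne_eq, OfNat.ofNat_ne_zero, not_false_eq_true, zero_pow, zero_mul, zero_add] at h1
      rw [← h1]
      congr 1
      refine Matrix.ext fun i j => ?_
      rw [Matrix.add_apply, Matrix.smul_apply, pencil_apply, pencil_apply, pencil_apply, ht,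
        smul_eq_mul]
      split_ifs <;> ring
    rw [this, hadj] at hPd
    simpa [derivative_comp, derivative_map, eval_map_algebraMap] using hPd
  set κ : ℝ[X] := X ^ 2 - C (2 * z.re) * X + C (‖z‖ ^ 2) with hκ
  have hκd : κ.natDegree = 2 := by
    rw [hκ]
    compute_degree!
  have hκm : κ.Monic := by
    rw [hκ]
    monicity!
  obtain ⟨V', hV'⟩ : κ ∣ V := quadratic_dvd_of_aeval_eq_zero_im_ne_zero V hVz hz
  obtain ⟨Q, hQ⟩ : κ ∣ W := quadratic_dvd_of_aeval_eq_zero_im_ne_zero W hWz hz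
  have hκz : aeval z κ = 0 := by
    rw [hκ, ← Complex.normSq_eq_norm_sq]
    simp only [map_add, map_sub, map_mul, map_pow, aeval_X, aeval_C, Complex.coe_algebraMap]
    apply Complex.ext <;> simp [pow_two, Complex.normSq_apply] <;> ring
  have hκ'z : aeval z (derivative κ) ≠ 0 := by
    intro h0
    have := congrArg Complex.im h0
    rw [hκ, derivative_add, derivative_C, add_zero] at this
    simp [← two_mul, hz] at this
  have hQz : aeval z Q = 0 := by
    rw [hQ, derivative_mul, map_add, map_mul, map_mul, hκz, zero_mul, add_zero] at hW'z
    exact (mul_eq_zero.1 hW'z).resolve_left hκ'z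
  obtain ⟨W', hW'⟩ : κ ∣ Q := quadratic_dvd_of_aeval_eq_zero_im_ne_zero Q hQz hz
  have hVd : V'.degree < (n : ℕ) := by
    have := hκm.degree_lt_of_mul (hV' ▸ degree_sum_fin_lt v : (κ * V').degree < (n + 2 : ℕ))
    rwa [hκd] at this
  have hWd : W'.degree < (n - 1 : ℕ) := by
    have h1 := hκm.degree_lt_of_mul (hQ ▸ degree_sum_fin_lt w : (κ * Q).degree < (n + 3 : ℕ))
    rw [hκd, hW'] at h1
    have h2 := hκm.degree_lt_of_mul h1
    rwa [hκd] at h2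
  refine ⟨a, b, -(2 * z.re), ‖z‖ ^ 2, u, fun j => V'.coeff j, fun j => W'.coeff j, fun s y => ?_⟩
  have hκe : y ^ 2 + -(2 * z.re) * y + ‖z‖ ^ 2 = κ.eval y := by
    simp [hκ]
    ring
  rw [← eval_eq_sum_fin hVd, ← eval_eq_sum_fin hWd, hκe, ← eval_mul, ← hV', ← eval_pow, ← eval_mul,
    pow_two κ, mul_assoc, ← hW', ← hQ]
  have h1 := hsplit s y
  rw [hc] at h1
  have : ∀ (f : ℝ[X]), aeval (y : ℂ) f = ((f.eval y : ℝ) : ℂ) := fun f => by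
    rw [← Complex.coe_algebraMap, aeval_algebraMap_apply, coe_aeval_eq_eval]
  rw [this, this, mul_one] at h1
  have h2 := TernaryForm.ofReal (detForm e) (s + (a * y + b)) 1 y
  have h3 := TernaryForm.ofReal u s 1 y
  push_cast at h2 h3
  rw [← h2, ← h3] at h1
  exact_mod_cast h1

end

section

variable {n : ℕ}

/-- Parameters of the ternary forms of degree `n + 2` that are singular at two conjugate points. -/
abbrev SingularSpace (n : ℕ) : Type :=
  (ℝ × ℝ) × (ℝ × ℝ) × (TernaryIndex n → ℝ) × (Fin n → ℝ) × (Fin (n - 1) → ℝ)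

/-- The ternary form of degree `n + 2` in the square of the ideal generated by
`t - (a y + b x)` and `y ^ 2 + p x y + q x ^ 2`. -/
def singularForm {R : Type*} [CommRing R] [Algebra ℝ R] (d : SingularSpace n) (t x y : R) : R :=
  (t - (algebraMap ℝ R d.1.1 * y + algebraMap ℝ R d.1.2 * x)) ^ 2 *
      ternaryForm d.2.2.1 (t - (algebraMap ℝ R d.1.1 * y + algebraMap ℝ R d.1.2 * x)) x y +
    (t - (algebraMap ℝ R d.1.1 * y + algebraMap ℝ R d.1.2 * x)) *
      ∑ j : Fin n, (y ^ 2 + algebraMap ℝ R d.2.1.1 * (x * y) + algebraMap ℝ R d.2.1.2 * x ^ 2) *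
        (algebraMap ℝ R (d.2.2.2.1 j) * (x ^ (n - 1 - j : ℕ) * y ^ (j : ℕ))) +
    ∑ j : Fin (n - 1),
      (y ^ 2 + algebraMap ℝ R d.2.1.1 * (x * y) + algebraMap ℝ R d.2.1.2 * x ^ 2) ^ 2 *
        (algebraMap ℝ R (d.2.2.2.2 j) * (x ^ (n - 2 - j : ℕ) * y ^ (j : ℕ)))

theorem singularForm_map {R S : Type*} [CommRing R] [Algebra ℝ R] [CommRing S] [Algebra ℝ S]
    (f : R →ₐ[ℝ] S) (d : SingularSpace n) (t x y : R) :
    f (singularForm d t x y) = singularForm d (f t) (f x) (f y) := by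
  simp [singularForm, TernaryForm.map]

open MvPolynomial in
theorem isHomogeneous_singularForm (d : SingularSpace n) :
    (singularForm d (X 0) (X 1) (X 2) : MvPolynomial (Fin 3) ℂ).IsHomogeneous (n + 2) := by
  have hC : ∀ r : ℝ, (algebraMap ℝ (MvPolynomial (Fin 3) ℂ) r).IsHomogeneous 0 := fun r => by
    rw [IsScalarTower.algebraMap_apply ℝ ℂ (MvPolynomial (Fin 3) ℂ)]
    exact isHomogeneous_C _ _
  have hX : ∀ i : Fin 3, (X i : MvPolynomial (Fin 3) ℂ).IsHomogeneous 1 := fun i =>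
    isHomogeneous_X _ _
  have hl : (X 0 - (algebraMap ℝ _ d.1.1 * X 2 + algebraMap ℝ _ d.1.2 * X 1) :
      MvPolynomial (Fin 3) ℂ).IsHomogeneous 1 := by
    refine (hX 0).sub (IsHomogeneous.add ?_ ?_)
    · simpa using (hC d.1.1).mul (hX 2)
    · simpa using (hC d.1.2).mul (hX 1)
  have hk : (X 2 ^ 2 + algebraMap ℝ _ d.2.1.1 * (X 1 * X 2) + algebraMap ℝ _ d.2.1.2 * X 1 ^ 2 :
      MvPolynomial (Fin 3) ℂ).IsHomogeneous 2 := by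
    refine IsHomogeneous.add (IsHomogeneous.add ?_ ?_) ?_
    · simpa using (hX 2).pow 2
    · simpa using (hC d.2.1.1).mul ((hX 1).mul (hX 2))
    · simpa using (hC d.2.1.2).mul ((hX 1).pow 2)
  refine IsHomogeneous.add (IsHomogeneous.add ?_ ?_) ?_
  · have := (hl.pow 2).mul (TernaryForm.isHomogeneous_ternaryForm d.2.2.1 hl (hX 1) (hX 2))
    rwa [one_mul, add_comm 2 n] at this
  · rw [show n + 2 = 1 + (n + 1) by omega]
    refine hl.mul (IsHomogeneous.sum _ _ _ fun j _ => ?_)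
    have h2 := hk.mul ((hC (d.2.2.2.1 j)).mul
      (((hX 1).pow (n - 1 - j : ℕ)).mul ((hX 2).pow (j : ℕ))))
    have hj := j.2
    rwa [show 2 + (0 + (1 * (n - 1 - j : ℕ) + 1 * (j : ℕ))) = n + 1 by omega] at h2
  · refine IsHomogeneous.sum _ _ _ fun j _ => ?_
    have h2 := (hk.pow 2).mul ((hC (d.2.2.2.2 j)).mul
      (((hX 1).pow (n - 2 - j : ℕ)).mul ((hX 2).pow (j : ℕ))))
    have hj := j.2
    rwa [show 2 * 2 + (0 + (1 * (n - 2 - j : ℕ) + 1 * (j : ℕ))) = n + 2 by omega] at h2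

theorem singularForm_one_zero_zero (d : SingularSpace n) :
    singularForm d (1 : ℝ) 0 0 = 1 := by
  simp [singularForm, TernaryForm.at_one_zero_zero]

open MvPolynomial in
theorem exists_ternaryForm_eq_singularForm (d : SingularSpace n) :
    ∃ c : TernaryIndex (n + 2) → ℝ, ∀ t x y : ℝ, ternaryForm c t x y = singularForm d t x y := by
  have ev : ∀ t x y : ℝ, eval ![(t : ℂ), x, y]
      (singularForm d (X 0) (X 1) (X 2) : MvPolynomial (Fin 3) ℂ) = singularForm d t x y := by
    intro t x y
    have h1 := singularForm_map ((MvPolynomial.aeval ![(t : ℂ), x, y] :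
      MvPolynomial (Fin 3) ℂ →ₐ[ℂ] ℂ).restrictScalars ℝ) d (X 0) (X 1) (X 2)
    have h2 := singularForm_map Complex.ofRealAm d t x y
    simp only [Complex.ofRealAm_coe] at h2
    rw [h2]
    simpa [coe_aeval_eq_eval] using h1
  obtain ⟨c, hc⟩ := TernaryForm.exists_of_isHomogeneous (isHomogeneous_singularForm d) (by
    have := ev 1 0 0
    rw [Complex.ofReal_one, Complex.ofReal_zero] at this
    rw [this, singularForm_one_zero_zero, Complex.ofReal_re])
  exact ⟨c, fun t x y => by rw [hc, ev, Complex.ofReal_re]⟩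

/-- The coefficients of `singularForm`. -/
noncomputable def singularCoeff (d : SingularSpace n) : TernaryIndex (n + 2) → ℝ :=
  (exists_ternaryForm_eq_singularForm d).choose

theorem ternaryForm_singularCoeff (d : SingularSpace n) (t x y : ℝ) :
    ternaryForm (singularCoeff d) t x y = singularForm d t x y :=
  (exists_ternaryForm_eq_singularForm d).choose_spec t x y

theorem contDiff_singularCoeff : ContDiff ℝ 1 (singularCoeff (n := n)) := by
  refine TernaryForm.contDiff_of_eval fun t x y => ?_
  simp only [ternaryForm_singularCoeff]
  simp only [singularForm, ternaryForm, Algebra.algebraMap_self, RingHom.id_apply]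
  fun_prop

theorem detForm_mem_range_singularCoeff {e : PencilSpace (n + 2)} {t z : ℂ} (hz : z.im ≠ 0)
    {N : Matrix (Fin (n + 2)) (Fin (n + 2)) ℂ} (hN : N.transpose = -N) (hN0 : N ≠ 0)
    (h : pencil e t 1 z * N = 0) : detForm e ∈ Set.range (singularCoeff (n := n)) := by
  obtain ⟨a, b, p, q, u, v, w, hs⟩ := exists_conjugate_singularity hz hN hN0 h
  refine ⟨((a, b), (p, q), u, v, w), TernaryForm.ext_one fun s y => ?_⟩
  have h1 := hs (s - (a * y + b)) y
  rw [sub_add_cancel] at h1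
  rw [h1, ternaryForm_singularCoeff]
  simp [singularForm, Finset.mul_sum]

theorem dense_compl_cone_singularCoeff (hn : n ≠ 0) (a : TernaryIndex (n + 2) → ℝ) :
    Dense ((fun q : ℝ × (TernaryIndex (n + 2) → ℝ) => a + q.1 • (q.2 - a)) ''
      (Set.univ ×ˢ Set.range (singularCoeff (n := n))))ᶜ := by
  have h1 : ContDiff ℝ 1 fun q : ℝ × SingularSpace n => a + q.1 • (singularCoeff q.2 - a) :=
    contDiff_const.add (contDiff_fst.smul ((contDiff_singularCoeff.comp contDiff_snd).sub
      contDiff_const))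
  refine (h1.dense_compl_range_of_finrank_lt_finrank ?_).mono (Set.compl_subset_compl.2 ?_)
  · simp only [Module.finrank_prod, Module.finrank_self, Module.finrank_fintype_fun_eq_card,
      TernaryIndex.card, Fintype.card_fin]
    have h2 : (n + 2 + 1).choose 2 = (n + 1).choose 2 + (n + 1) + (n + 2) := by
      simp [Nat.choose_succ_succ', Nat.choose_one_right]
      omega
    omega
  · rintro _ ⟨⟨s, _⟩, ⟨-, ⟨d, rfl⟩⟩, rfl⟩
    exact ⟨(s, d), rfl⟩

theorem strictlyHyperbolic_subset_range_detForm {m : ℕ} (hm : m ≠ 0) :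
    strictlyHyperbolic m ⊆ Set.range (detForm (m := m)) := by
  suffices H : ∃ Z : Set (TernaryIndex m → ℝ),
      (∀ c ∈ strictlyHyperbolic m ∩ Set.range (detForm (m := m)), c ∉ Z →
        c ∈ interior (Set.range (detForm (m := m)))) ∧
      ∀ a, Dense ((fun q : ℝ × (TernaryIndex m → ℝ) => a + q.1 • (q.2 - a)) ''
        (Set.univ ×ˢ Z))ᶜ by
    obtain ⟨Z, hint, hZ⟩ := H
    exact (TernaryForm.isPreconnected_strictlyHyperbolic hm).subset_of_forall_mem_interior
      (TernaryForm.isOpen_strictlyHyperbolic) (isClosed_range_detForm m)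
      ⟨_, detForm_pathPencil_mem m⟩ hint hZ
  by_cases h3 : 3 ≤ m
  · obtain ⟨n, rfl⟩ := Nat.exists_eq_add_of_le' (by omega : 2 ≤ m)
    refine ⟨Set.range singularCoeff, ?_, dense_compl_cone_singularCoeff (by omega)⟩
    rintro _ ⟨hc, e, rfl⟩ hZ
    by_contra hne
    obtain ⟨t, z, N, hz, hN, hN0, h⟩ := exists_skew_of_notMem_interior hc hne
    exact hZ (detForm_mem_range_singularCoeff hz hN hN0 h)
  · refine ⟨∅, ?_, fun a => by simp⟩
    rintro _ ⟨hc, e, rfl⟩ -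
    by_contra hne
    obtain ⟨t, z, N, hz, hN, hN0, h⟩ := exists_skew_of_notMem_interior hc hne
    exact h3 (three_le_of_mul_skew_eq_zero hc hz hN hN0 h)

end

theorem weaklyHyperbolic_subset_range_detForm {m : ℕ} (hm : m ≠ 0) :
    weaklyHyperbolic m ⊆ Set.range (detForm (m := m)) := by
  intro c hc
  have h1 : Filter.Tendsto (fun ε : ℝ => TernaryForm.smoothing ε c) (nhdsWithin 0 {0}ᶜ)
      (nhds c) := by
    have : Continuous fun ε : ℝ => TernaryForm.smoothing ε c :=
      (TernaryForm.continuous_smoothing (m := m)).comp (f := fun ε : ℝ => (ε, c)) (by fun_prop)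
    have h0 := this.tendsto 0
    rw [TernaryForm.smoothing_zero] at h0
    exact h0.mono_left nhdsWithin_le_nhds
  refine (isClosed_range_detForm m).mem_of_tendsto h1 ?_
  filter_upwards [self_mem_nhdsWithin] with ε hε
  exact strictlyHyperbolic_subset_range_detForm hm
    (TernaryForm.smoothing_mem_strictlyHyperbolic hm hc hε)

theorem exists_pencil_of_forall_im_eq_zero {m : ℕ} (hm : m ≠ 0) (p : MvPolynomial (Fin 2) ℝ)
    (x0 : Fin 2 → ℝ) (hdeg : p.totalDegree = m) (hRZ : ∀ x : Fin 2 → ℝ, ∀ t : ℂ,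
      MvPolynomial.aeval (fun i => (x0 i : ℂ) + t * (x i : ℂ)) p = 0 → t.im = 0)
    (hval : MvPolynomial.eval x0 p = 1) :
    ∃ e : PencilSpace m, ∀ x : Fin 2 → ℝ,
      (pencil e 1 (x 0 - x0 0) (x 1 - x0 1)).det = MvPolynomial.eval x p := by
  obtain ⟨c, hc, hcp⟩ := exists_weaklyHyperbolic_of_isRZ p x0 hdeg hRZ hval
  obtain ⟨e, rfl⟩ := weaklyHyperbolic_subset_range_detForm hm hc
  refine ⟨e, fun x => ?_⟩
  rw [← ternaryForm_detForm_real, hcp, add_sub_cancel, add_sub_cancel]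
  have : ![x 0, x 1] = x := by
    ext i
    fin_cases i <;> rfl
  rw [this]

open MvPolynomial in
/-- (Helton–Vinnikov) Every `RZ_{x⁰}` polynomial `p ∈ ℝ[x_1, x_2]` of degree `m` with
`p(x⁰) = 1` admits a determinantal representation `p = det(A_0 + x_1 A_1 + x_2 A_2)`
with real symmetric `m × m` matrices satisfying `A_0 + x⁰_1 A_1 + x⁰_2 A_2 = I`. -/
theorem stmt7 {m : ℕ} (p : MvPolynomial (Fin 2) ℝ) (x0 : Fin 2 → ℝ)
    (hdeg : p.totalDegree = m) (hRZ : IsRZ p x0)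
    (hval : MvPolynomial.eval x0 p = 1) :
    ∃ A0 A1 A2 : Matrix (Fin m) (Fin m) ℝ,
      A0.IsSymm ∧ A1.IsSymm ∧ A2.IsSymm ∧
      A0 + x0 0 • A1 + x0 1 • A2 = 1 ∧
      Matrix.det (Matrix.of fun k l =>
        C (A0 k l) + X 0 * C (A1 k l) + X 1 * C (A2 k l)) = p := by
  rcases eq_or_ne m 0 with rfl | hm
  · refine ⟨0, 0, 0, Matrix.isSymm_zero, Matrix.isSymm_zero, Matrix.isSymm_zero,
      Subsingleton.elim _ _, ?_⟩
    rw [totalDegree_eq_zero_iff_eq_C.1 hdeg, eval_C] at hval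
    rw [Matrix.det_isEmpty, totalDegree_eq_zero_iff_eq_C.1 hdeg, hval, C_1]
  · obtain ⟨e, he⟩ := exists_pencil_of_forall_im_eq_zero hm p x0 hdeg hRZ hval
    have h1 : (Matrix.diagonal e.1).IsSymm := Matrix.isSymm_diagonal _
    have h2 := symMatrix_isSymm e.2
    refine ⟨1 - x0 0 • Matrix.diagonal e.1 - x0 1 • symMatrix e.2, Matrix.diagonal e.1,
      symMatrix e.2, (Matrix.isSymm_one.sub (h1.smul _)).sub (h2.smul _), h1, h2, by abel, ?_⟩
    refine MvPolynomial.funext fun x => ?_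
    rw [RingHom.map_det, ← he]
    congr 1
    refine Matrix.ext fun i j => ?_
    simp [pencil, Matrix.one_apply]
    ring
end

section
/- For d = 3 and every m ≥ 4, and for every d ≥ 4 and every m ≥ 2, there exists a polynomial p ∈ ℂ[x_1,…,x_d] of degree m that admits no determinantal representation det(A_0 + x_1 A_1 + ⋯ + x_d A_d) = p(x) with complex m×m matrices A_0, A_1, …, A_d. -/
open MvPolynomial

/-- Finitely many polynomial maps from an affine space to one of larger dimension do not
jointly cover the target. -/
theorem MvPolynomial.exists_forall_eval_ne {K σ τ J : Type} [Field K] [Infinite K] [Fintype σ]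
    [Fintype τ] [Fintype J] (hcard : Fintype.card τ < Fintype.card σ)
    (f : J → σ → MvPolynomial τ K) :
    ∃ a : σ → K, ∀ j v, ∃ s, eval v (f j s) ≠ a s := by
  have key (j : J) : ∃ Q : MvPolynomial σ K, Q ≠ 0 ∧ aeval (f j) Q = 0 := by
    have hdep : ¬ AlgebraicIndependent K (f j) := fun hind => by
      have hle := hind.cardinalMk_le_trdeg
      rw [MvPolynomial.trdeg_of_isDomain] at hle
      simp only [Cardinal.mk_fintype, Cardinal.lift_natCast, Nat.cast_le] at hle
      omega
    rw [algebraicIndependent_iff] at hdep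
    push Not at hdep
    obtain ⟨Q, h0, hne⟩ := hdep
    exact ⟨Q, hne, h0⟩
  choose Q hQ hQf using key
  obtain ⟨a, ha⟩ : ∃ a : σ → K, eval a (∏ j, Q j) ≠ 0 := by
    by_contra! hzero
    exact Finset.prod_ne_zero_iff.2 (fun j _ => hQ j)
      (MvPolynomial.funext fun a => by rw [hzero a, map_zero])
  refine ⟨a, fun j v => ?_⟩
  by_contra! heq
  have hj : eval a (Q j) ≠ 0 := by
    rw [map_prod] at ha
    exact Finset.prod_ne_zero_iff.1 ha j (Finset.mem_univ j)
  apply hj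
  have h := congrArg (eval v) (hQf j)
  rw [map_zero, aeval_def, ← MvPolynomial.coe_eval₂Hom, ← RingHom.comp_apply] at h
  rw [← h]
  have : (eval a : MvPolynomial σ K →+* K) = (eval v).comp (eval₂Hom (algebraMap K _) (f j)) := by
    ext s
    · simp
    · simp [heq s]
  rw [this]

/-- The monomials in `e + 2` variables of degree at most `m` that are not a power of the first
variable. -/
noncomputable def mixedMonomials (e m : ℕ) : Finset (Fin (e + 2) →₀ ℕ) :=
  ((Finset.range (m + 1)).biUnion fun k => Finset.finsuppAntidiag Finset.univ k).filter
    fun s => ∃ j ≠ 0, s j ≠ 0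

theorem mem_mixedMonomials {e m : ℕ} {s : Fin (e + 2) →₀ ℕ} :
    s ∈ mixedMonomials e m ↔ ∑ i, s i ≤ m ∧ ∃ j ≠ 0, s j ≠ 0 := by
  simp [mixedMonomials]

theorem le_card_mixedMonomials (e m : ℕ) :
    (m + e + 2).choose (e + 2) ≤ (mixedMonomials e m).card + (m + 1) := by
  classical
  set T : Finset (Fin (e + 2) →₀ ℕ) :=
    (Finset.range (m + 1)).biUnion fun k => Finset.finsuppAntidiag Finset.univ k with hT
  have hTcard : T.card = (m + e + 2).choose (e + 2) := by
    rw [hT, Finset.card_biUnion]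
    · rw [show m + e + 2 = m + (e + 1) + 1 by ring, ← Nat.sum_range_add_choose]
      refine Finset.sum_congr rfl fun k _ => ?_
      rw [Finset.card_finsuppAntidiag_nat_eq_choose, Finset.card_univ, Fintype.card_fin,
        show e + 2 + k - 1 = k + (e + 1) by omega]
      exact Nat.choose_symm_add
    · intro k _ l _ hkl
      rw [Function.onFun, Finset.disjoint_left]
      intro s hs hs'
      simp only [Finset.mem_finsuppAntidiag] at hs hs'
      exact hkl (hs.1.symm.trans hs'.1)
  have hpure : (T.filter fun s => ¬ ∃ j ≠ 0, s j ≠ 0).card ≤ m + 1 := by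
    rw [← Finset.card_range (m + 1)]
    refine (Finset.card_le_card (t := (Finset.range (m + 1)).image (Finsupp.single 0))
      fun s hs => ?_).trans Finset.card_image_le
    simp only [hT, Finset.mem_filter, Finset.mem_biUnion, Finset.mem_range,
      Finset.mem_finsuppAntidiag] at hs
    obtain ⟨⟨k, hk, hsum, -⟩, hs⟩ := hs
    push Not at hs
    have hk0 : s 0 = k := by
      rw [← hsum]
      exact (Finset.sum_eq_single_of_mem 0 (Finset.mem_univ _) fun j _ hj => hs j hj).symm
    refine Finset.mem_image.2 ⟨k, Finset.mem_range.2 hk, ?_⟩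
    ext j
    by_cases hj : j = 0
    · simp [hj, hk0]
    · simp [hs j hj, Finsupp.single_eq_of_ne hj]
  have := Finset.card_filter_add_card_filter_not (s := T) fun s => ∃ j ≠ 0, s j ≠ 0
  rw [hTcard] at this
  have hmix : (mixedMonomials e m).card = (T.filter fun s => ∃ j ≠ 0, s j ≠ 0).card := by
    simp [mixedMonomials, hT]
  omega


theorem four_mul_add_six_le_choose_two {n : ℕ} (hn : 3 ≤ n) : 4 * n + 6 ≤ (n + 4).choose 2 := by
  induction n, hn using Nat.le_induction with
  | base => decide
  | succ n hn ih =>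
    have : (n + 1 + 4).choose 2 = (n + 4).choose 1 + (n + 4).choose 2 :=
      Nat.choose_succ_succ' (n + 4) 1
    rw [Nat.choose_one_right] at this
    omega

theorem two_mul_add_three_le_choose_two {n : ℕ} (hn : 1 ≤ n) : 2 * n + 3 ≤ (n + 3).choose 2 := by
  induction n, hn using Nat.le_induction with
  | base => decide
  | succ n hn ih =>
    have : (n + 1 + 3).choose 2 = (n + 3).choose 1 + (n + 3).choose 2 :=
      Nat.choose_succ_succ' (n + 3) 1
    rw [Nat.choose_one_right] at this
    omega

theorem two_mul_sq_add_two_lt_choose_three {n : ℕ} (hn : 3 ≤ n) :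
    2 * (n + 1) ^ 2 + 2 < (n + 4).choose 3 := by
  induction n, hn using Nat.le_induction with
  | base => decide
  | succ n hn ih =>
    have : (n + 1 + 4).choose 3 = (n + 4).choose 2 + (n + 4).choose 3 :=
      Nat.choose_succ_succ' (n + 4) 2
    have := four_mul_add_six_le_choose_two hn
    nlinarith

theorem sq_le_choose_four {n : ℕ} (hn : 1 ≤ n) : (n + 1) ^ 2 ≤ (n + 4).choose 4 := by
  induction n, hn using Nat.le_induction with
  | base => decide
  | succ n hn ih =>
    have h4 : (n + 1 + 4).choose 4 = (n + 4).choose 3 + (n + 4).choose 4 :=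
      Nat.choose_succ_succ' (n + 4) 3
    have h3 : (n + 4).choose 3 = (n + 3).choose 2 + (n + 3).choose 3 :=
      Nat.choose_succ_succ' (n + 3) 2
    have := two_mul_add_three_le_choose_two hn
    nlinarith

theorem mul_sq_add_two_lt_choose {e n : ℕ} (h : (e = 1 ∧ 3 ≤ n) ∨ (2 ≤ e ∧ 1 ≤ n)) :
    (e + 1) * (n + 1) ^ 2 + 2 < (n + e + 3).choose (e + 2) := by
  have step (e : ℕ) (he : 1 ≤ e) (hn : 1 ≤ n)
      (ih : (e + 1) * (n + 1) ^ 2 + 2 < (n + e + 3).choose (e + 2)) :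
      (e + 1 + 1) * (n + 1) ^ 2 + 2 < (n + (e + 1) + 3).choose (e + 1 + 2) := by
    have hle : (n + 1) ^ 2 ≤ (n + (e + 3)).choose (e + 3) :=
      calc (n + 1) ^ 2 ≤ (n + 4).choose 4 := sq_le_choose_four hn
        _ = (n + 4).choose n := Nat.choose_symm_add.symm
        _ ≤ (n + (e + 3)).choose n := Nat.choose_le_choose _ (by omega)
        _ = _ := Nat.choose_symm_add
    have := Nat.choose_succ_succ' (n + e + 3) (e + 2)
    have h' : (n + (e + 1) + 3).choose (e + 1 + 2) =
        (n + e + 3).choose (e + 2) + (n + (e + 3)).choose (e + 3) := by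
      rw [show n + (e + 1) + 3 = n + e + 3 + 1 by ring]
      exact this
    nlinarith
  rcases h with ⟨rfl, hn⟩ | ⟨he, hn⟩
  · exact two_mul_sq_add_two_lt_choose_three hn
  · induction e, he using Nat.le_induction with
    | base =>
      by_cases h3 : 3 ≤ n
      · exact step 1 le_rfl hn (two_mul_sq_add_two_lt_choose_three h3)
      · interval_cases n <;> decide
    | succ e he ih => exact step e (by omega) hn ih

/-- The determinant of the affine linear matrix pencil `A₀ + ∑ i, X i • A i`. -/
noncomputable def pencilDet {R ι κ : Type} [CommRing R] [Fintype ι] [Fintype κ] [DecidableEq κ]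
    (A₀ : Matrix κ κ R) (A : ι → Matrix κ κ R) : MvPolynomial ι R :=
  Matrix.det (Matrix.of fun k l => C (A₀ k l) + ∑ i, X i * C (A i k l))

theorem eval_pencilDet {R ι κ : Type} [CommRing R] [Fintype ι] [Fintype κ] [DecidableEq κ]
    (A₀ : Matrix κ κ R) (A : ι → Matrix κ κ R) (y : ι → R) :
    eval y (pencilDet A₀ A) = (A₀ + ∑ i, y i • A i).det := by
  rw [pencilDet, RingHom.map_det]
  congr 1
  ext k l
  simp [Matrix.sum_apply]

theorem map_pencilDet {R S ι κ : Type} [CommRing R] [CommRing S] [Fintype ι] [Fintype κ]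
    [DecidableEq κ] (φ : R →+* S) (A₀ : Matrix κ κ R) (A : ι → Matrix κ κ R) :
    map φ (pencilDet A₀ A) = pencilDet (A₀.map φ) fun i => (A i).map φ := by
  rw [pencilDet, pencilDet, RingHom.map_det]
  congr 1
  ext k l
  simp

/-- The parameters of a pencil in normal form: the first summand for the matrix of the second
variable, whose first column is normalized, the second for the matrices of the later variables. -/
abbrev NormalParam (e n : ℕ) : Type :=
  Option (Fin (n + 1) × Fin n) ⊕ Fin e × Fin (n + 1) × Fin (n + 1)

theorem card_normalParam (e n : ℕ) :
    Fintype.card (NormalParam e n) + (n + 1) = (e + 1) * (n + 1) ^ 2 + 1 := by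
  simp only [Fintype.card_sum, Fintype.card_option, Fintype.card_prod, Fintype.card_fin]
  ring

/-- The coefficient matrices of a pencil in normal form: the first one is `diag(1, …, n + 1)`, and
the off-diagonal part of the first column of the second one is prescribed by `w`. -/
def normalForm {R : Type} [CommRing R] {e n : ℕ} (w : Fin n → R) (u : NormalParam e n → R) :
    Fin (e + 2) → Matrix (Fin (n + 1)) (Fin (n + 1)) R :=
  Fin.cons (Matrix.diagonal fun k : Fin (n + 1) => (k : R) + 1) <| Fin.cons
    (Matrix.of fun k => Fin.cons ((Fin.cons (u (.inl none)) w : Fin (n + 1) → R) k)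
      fun l => u (.inl (some (k, l))))
    fun i => Matrix.of fun k l => u (.inr (i, k, l))

theorem normalForm_map {R S : Type} [CommRing R] [CommRing S] (φ : R →+* S) {e n : ℕ}
    (w : Fin n → R) (u : NormalParam e n → R) (i : Fin (e + 2)) :
    (normalForm w u i).map φ = normalForm (φ ∘ w) (φ ∘ u) i := by
  induction i using Fin.cases with
  | zero =>
    ext k l
    simp [normalForm, Matrix.diagonal_apply, apply_ite φ]
  | succ i =>
    induction i using Fin.cases with
    | zero =>
      ext k l
      induction l using Fin.cases <;> induction k using Fin.cases <;> simp [normalForm]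
    | succ i =>
      ext k l
      simp [normalForm]

theorem exists_eq_normalForm {R : Type} [CommRing R] {e n : ℕ} (w : Fin n → R)
    (B : Fin (e + 2) → Matrix (Fin (n + 1)) (Fin (n + 1)) R)
    (h0 : B 0 = Matrix.diagonal fun k : Fin (n + 1) => (k : R) + 1)
    (h1 : ∀ k : Fin n, B 1 k.succ 0 = w k) :
    ∃ u, B = normalForm w u := by
  refine ⟨Sum.elim (fun o => o.elim (B 1 0 0) fun q => B 1 q.1 q.2.succ)
    fun q => B q.1.succ.succ q.2.1 q.2.2, ?_⟩
  funext i
  induction i using Fin.cases with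
  | zero => simp [normalForm, h0]
  | succ i =>
    induction i using Fin.cases with
    | zero =>
      ext k l
      induction l using Fin.cases <;> induction k using Fin.cases <;> simp [normalForm, h1]
    | succ i =>
      ext k l
      simp [normalForm]

theorem Matrix.exists_mul_eq_mul_diagonal {K κ : Type} [Field K] [Fintype κ] [DecidableEq κ]
    (M : Matrix κ κ K) (μ : κ → K) (hμ : Function.Injective μ)
    (hM : ∀ k, (M - μ k • (1 : Matrix κ κ K)).det = 0) :
    ∃ P : Matrix κ κ K, IsUnit P.det ∧ M * P = P * Matrix.diagonal μ := by
  choose v hv0 hv using fun k => Matrix.exists_mulVec_eq_zero_iff.2 (hM k)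
  have hMv (k : κ) : M.mulVec (v k) = μ k • v k := by
    have := hv k
    rwa [Matrix.sub_mulVec, Matrix.smul_mulVec, Matrix.one_mulVec, sub_eq_zero] at this
  have hli : LinearIndependent K v :=
    Module.End.eigenvectors_linearIndependent' (Matrix.toLin' M) μ hμ v fun k =>
      ⟨Module.End.mem_eigenspace_iff.2 (by simpa using hMv k), hv0 k⟩
  refine ⟨(Matrix.of v).transpose, ?_, ?_⟩
  · rw [Matrix.det_transpose, ← Matrix.isUnit_iff_isUnit_det]
    exact Matrix.linearIndependent_rows_iff_isUnit.1 hli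
  · ext i k
    rw [Matrix.mul_diagonal]
    have := congrFun (hMv k) i
    simpa [Matrix.mul_apply, Matrix.mulVec, dotProduct, mul_comm] using this

/-- A pencil with value `∏ (1 + (k + 1) t)` on the first axis can be brought to normal form. -/
theorem exists_normalForm_pencilDet_eq {e n : ℕ}
    (A₀ : Matrix (Fin (n + 1)) (Fin (n + 1)) ℂ)
    (A : Fin (e + 2) → Matrix (Fin (n + 1)) (Fin (n + 1)) ℂ)
    (hA : ∀ t : ℂ, eval (Pi.single 0 t) (pencilDet A₀ A) =
      ∏ k : Fin (n + 1), (1 + ((k : ℂ) + 1) * t)) :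
    ∃ (w : Fin n → Bool) (u : NormalParam e n → ℂ),
      pencilDet A₀ A = pencilDet 1 (normalForm (fun k => if w k then 1 else 0) u) := by
  have haxis (t : ℂ) : (A₀ + t • A 0).det = ∏ k : Fin (n + 1), (1 + ((k : ℂ) + 1) * t) := by
    rw [← hA t, eval_pencilDet, Finset.sum_eq_single_of_mem 0 (Finset.mem_univ _), Pi.single_eq_same]
    intro i _ hi
    rw [Pi.single_eq_of_ne hi, zero_smul]
  have hdet : A₀.det = 1 := by simpa using haxis 0
  have hunit : IsUnit A₀.det := by simp [hdet]
  have hdet' : A₀⁻¹.det = 1 := by simp [Matrix.det_nonsing_inv, hdet]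
  obtain ⟨P, hP, hMP⟩ := Matrix.exists_mul_eq_mul_diagonal (A₀⁻¹ * A 0)
    (fun k : Fin (n + 1) => (k : ℂ) + 1)
    (fun k l hkl => Fin.ext (Nat.cast_injective (add_right_cancel hkl))) (fun k => by
      have hk : (k : ℂ) + 1 ≠ 0 := Nat.cast_add_one_ne_zero _
      have hroot : (A₀ + (-((k : ℂ) + 1)⁻¹) • A 0).det = 0 := by
        rw [haxis]
        refine Finset.prod_eq_zero (Finset.mem_univ k) ?_
        field_simp
        ring
      have : A₀⁻¹ * A 0 - ((k : ℂ) + 1) • (1 : Matrix (Fin (n + 1)) (Fin (n + 1)) ℂ) =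
          (-((k : ℂ) + 1)) • (A₀⁻¹ * (A₀ + (-((k : ℂ) + 1)⁻¹) • A 0)) := by
        rw [Matrix.mul_add, Matrix.nonsing_inv_mul _ hunit, Matrix.mul_smul, smul_add, smul_smul]
        rw [neg_mul_neg, mul_inv_cancel₀ hk, one_smul, neg_smul]
        abel
      rw [this, Matrix.det_smul, Matrix.det_mul, hroot, mul_zero, mul_zero])
  set N : Matrix (Fin (n + 1)) (Fin (n + 1)) ℂ := P⁻¹ * (A₀⁻¹ * A 1) * P with hN
  set c : Fin (n + 1) → ℂ :=
    Fin.cons 1 fun k => if N k.succ 0 = 0 then 1 else N k.succ 0 with hc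
  have hc0 (k : Fin (n + 1)) : c k ≠ 0 := by
    induction k using Fin.cases with
    | zero => simp [hc]
    | succ k =>
      simp only [hc, Fin.cons_succ]
      split_ifs with h <;> simp [h]
  set Q := P * Matrix.diagonal c with hQ
  have hQunit : IsUnit Q.det := by
    rw [hQ, Matrix.det_mul, Matrix.det_diagonal]
    exact hP.mul (Finset.prod_ne_zero_iff.2 fun k _ => hc0 k).isUnit
  have hinv : (Matrix.diagonal c)⁻¹ = Matrix.diagonal fun k => (c k)⁻¹ := by
    refine Matrix.inv_eq_left_inv ?_
    rw [Matrix.diagonal_mul_diagonal, ← Matrix.diagonal_one]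
    congr 1
    funext k
    exact inv_mul_cancel₀ (hc0 k)
  set B : Fin (e + 2) → Matrix (Fin (n + 1)) (Fin (n + 1)) ℂ :=
    fun i => Q⁻¹ * (A₀⁻¹ * A i) * Q with hB
  obtain ⟨u, hu⟩ := exists_eq_normalForm
    (fun k => if decide (N k.succ 0 ≠ 0) = true then (1 : ℂ) else 0) B (by
      rw [hB]
      dsimp only
      rw [Matrix.mul_assoc, hQ, ← Matrix.mul_assoc _ P, hMP, Matrix.mul_assoc P,
        Matrix.diagonal_mul_diagonal]
      simp_rw [mul_comm _ (c _)]
      rw [← Matrix.diagonal_mul_diagonal, ← Matrix.mul_assoc P, ← hQ, ← Matrix.mul_assoc,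
        Matrix.nonsing_inv_mul _ hQunit, Matrix.one_mul]) (fun k => by
      have : B 1 = (Matrix.diagonal fun k => (c k)⁻¹) * N * Matrix.diagonal c := by
        simp only [hB, hQ, hN, Matrix.mul_inv_rev, hinv, Matrix.mul_assoc]
      rw [this, Matrix.mul_diagonal, Matrix.diagonal_mul]
      by_cases h : N k.succ 0 = 0 <;> simp [hc, h])
  refine ⟨fun k => decide (N k.succ 0 ≠ 0), u, ?_⟩
  rw [← hu]
  refine MvPolynomial.funext fun y => ?_
  rw [eval_pencilDet, eval_pencilDet]
  have : 1 + ∑ i, y i • B i = Q⁻¹ * (A₀⁻¹ * (A₀ + ∑ i, y i • A i)) * Q := by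
    rw [Matrix.mul_add, Matrix.nonsing_inv_mul _ hunit, Matrix.mul_add, Matrix.add_mul,
      Matrix.mul_one, Matrix.nonsing_inv_mul _ hQunit]
    simp only [hB, Matrix.mul_sum, Matrix.sum_mul, Matrix.mul_smul, Matrix.smul_mul]
  have hQQ : Q⁻¹.det * Q.det = 1 := by
    rw [← Matrix.det_mul, Matrix.nonsing_inv_mul _ hQunit, Matrix.det_one]
  rw [this, Matrix.det_mul, Matrix.det_mul, Matrix.det_mul, hdet', one_mul, mul_right_comm, hQQ,
    one_mul]

open MvPolynomial in
/-- For `d = 3, m ≥ 4` and for `d ≥ 4, m ≥ 2` there exists a polynomial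
`p ∈ ℂ[x_1,…,x_d]` of degree `m` admitting no determinantal representation
`det(A_0 + x_1 A_1 + ⋯ + x_d A_d) = p(x)` with complex `m × m` matrices. -/
theorem stmt8 {d m : ℕ} (h : (d = 3 ∧ 4 ≤ m) ∨ (4 ≤ d ∧ 2 ≤ m)) :
    ∃ p : MvPolynomial (Fin d) ℂ, p.totalDegree = m ∧
      ¬ ∃ (A0 : Matrix (Fin m) (Fin m) ℂ) (A : Fin d → Matrix (Fin m) (Fin m) ℂ),
        Matrix.det (Matrix.of fun k l =>
          C (A0 k l) + ∑ i, X i * C (A i k l)) = p := by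
  obtain ⟨e, rfl⟩ : ∃ e, d = e + 2 := Nat.exists_eq_add_of_le' (by omega)
  obtain ⟨n, rfl⟩ : ∃ n, m = n + 1 := Nat.exists_eq_add_of_le' (by omega)
  have hcard : Fintype.card (NormalParam e n) <
      Fintype.card ↥(mixedMonomials e (n + 1)) := by
    have h1 := card_normalParam e n
    have h2 := le_card_mixedMonomials e (n + 1)
    have h3 := mul_sq_add_two_lt_choose (e := e) (n := n) (by omega)
    rw [show n + 1 + e + 2 = n + e + 3 by ring] at h2
    rw [Fintype.card_coe]
    omega
  obtain ⟨a, ha⟩ := exists_forall_eval_ne (K := ℂ) hcard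
    fun (w : Fin n → Bool) (s : ↥(mixedMonomials e (n + 1))) => coeff s.1
      (pencilDet 1 (normalForm (fun k => if w k then 1 else 0) X))
  set q : MvPolynomial (Fin (e + 2)) ℂ :=
    ∏ k : Fin (n + 1), (1 + C ((k : ℂ) + 1) * X 0) with hq
  set p := q + ∑ s : ↥(mixedMonomials e (n + 1)), monomial s.1 (a s - coeff s.1 q) with hp
  have hpcoeff (s : ↥(mixedMonomials e (n + 1))) : coeff s.1 p = a s := by
    rw [hp, coeff_add, coeff_sum, Finset.sum_eq_single_of_mem s (Finset.mem_univ _)]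
    · rw [coeff_monomial, if_pos rfl]
      ring
    · intro t _ hts
      rw [coeff_monomial, if_neg fun h => hts (Subtype.ext h)]
  have hmono {R : Type} [CommRing R] [Algebra ℂ R] (t : R) :
      aeval (Pi.single 0 t) p = ∏ k : Fin (n + 1), (1 + algebraMap ℂ R ((k : ℂ) + 1) * t) := by
    rw [hp, map_add, map_sum, Finset.sum_eq_zero, hq, map_prod, add_zero]
    · simp
    · intro s _
      obtain ⟨j, hj, hsj⟩ := (mem_mixedMonomials.1 s.2).2
      rw [aeval_monomial, Finsupp.prod,
        Finset.prod_eq_zero (i := j) (Finsupp.mem_support_iff.2 hsj), mul_zero]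
      rw [Pi.single_eq_of_ne hj, zero_pow hsj]
  refine ⟨p, le_antisymm ?_ ?_, ?_⟩
  · refine (totalDegree_add _ _).trans (max_le ?_ (totalDegree_finsetSum_le fun s _ => ?_))
    · refine (totalDegree_finsetProd _ _).trans ((Finset.sum_le_card_nsmul _ _ 1 fun k _ => ?_).trans
        (by simp))
      refine (totalDegree_add _ _).trans (max_le (by simp) ((totalDegree_mul _ _).trans ?_))
      rw [totalDegree_C, totalDegree_X]
    · refine (totalDegree_monomial_le _ _).trans ?_
      rw [Finsupp.sum_fintype _ _ fun _ => rfl]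
      exact (mem_mixedMonomials.1 s.2).1
  · have hdeg := aeval_natDegree_le p le_rfl (Pi.single 0 Polynomial.X) (n := 1) fun i => by
      by_cases hi : i = 0
      · subst hi; simp
      · simp [Pi.single_eq_of_ne hi]
    rw [hmono, mul_one] at hdeg
    refine le_trans (le_of_eq ?_) hdeg
    have hfac (k : Fin (n + 1)) :
        (1 + algebraMap ℂ (Polynomial ℂ) ((k : ℂ) + 1) * Polynomial.X).natDegree = 1 := by
      rw [add_comm]
      exact Polynomial.natDegree_linear (Nat.cast_add_one_ne_zero _)
    rw [Polynomial.natDegree_prod _ _ fun k _ h0 => by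
      have := hfac k
      rw [h0, Polynomial.natDegree_zero] at this
      exact zero_ne_one this]
    simp only [hfac]
    simp
  · rintro ⟨A₀, A, hA⟩
    change pencilDet A₀ A = p at hA
    obtain ⟨w, u, hwu⟩ := exists_normalForm_pencilDet_eq A₀ A fun t => by
      rw [hA]
      simpa [aeval_eq_eval] using hmono t
    obtain ⟨s, hs⟩ := ha w u
    apply hs
    rw [← hpcoeff, ← hA, hwu, ← coeff_map, map_pencilDet]
    simp only [normalForm_map]
    congr 2
    · ext k l
      simp [Matrix.one_apply, apply_ite]
    · funext i
      congr 1
      · funext k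
        simp [apply_ite]
      · funext k
        simp
end

section
/- (Brändén) Let p be the polynomial of degree 4 in the 8 real variables x_a, x_b, x_c, x_d, x_{a'}, x_{b'}, x_{c'}, x_{d'} defined by p = Σ_{S ∈ B(V₈)} Π_{j ∈ S} (x_j + 1), where B(V₈) is the collection of all 4-element subsets of {a,b,c,d,a',b',c',d'} except the five subsets {a,a',b,b'}, {b,b',c,c'}, {c,c',d,d'}, {d,d',a,a'}, {a,a',c,c'}. Then: (i) p is an RZ polynomial with respect to the point 0; (ii) for every positive integer r there exist no integer n and no real symmetric n×n matrices A_0, A_1, …, A_8 with A_0 positive definite such that det(A_0 + Σ_{j=1}^{8} x_j A_j) = p(x)^r as polynomials in the eight variables. -/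
/-- The set of bases of the Vámos matroid `V₈` on the ground set
`{a,b,c,d,a',b',c',d'}`, encoded as `Fin 8` via
`a=0, b=1, c=2, d=3, a'=4, b'=5, c'=6, d'=7`: all 4-element subsets except
`{a,a',b,b'}, {b,b',c,c'}, {c,c',d,d'}, {d,d',a,a'}, {a,a',c,c'}`. -/
def vamosBases : Finset (Finset (Fin 8)) :=
  Finset.powersetCard 4 Finset.univ \
    {({0, 4, 1, 5} : Finset (Fin 8)), {1, 5, 2, 6}, {2, 6, 3, 7}, {3, 7, 0, 4},
      {0, 4, 2, 6}}

/-- The Vámos polynomial with the variables in each of the four pairs identified. -/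
def vamosDiag {R : Type*} [CommRing R] (a b c d : R) : R :=
  b ^ 2 * d ^ 2 + 4 * (a + b + c + d) * (a * b * c + a * b * d + a * c * d + b * c * d)

/-- A polynomial interlacing `vamosDiag`. -/
def vamosInterlacer {R : Type*} [CommRing R] (a b c d : R) : R :=
  4 * a * b * d + 4 * b * c * d + 2 * b * d * (b + d) + 2 * a * c * (b + d) + a * b * (a + b)
    + a * d * (a + d) + b * c * (b + c) + c * d * (c + d)

open ComplexConjugate in
/-- A sum-of-squares certificate for the stability of `vamosDiag`. -/
lemma vamosDiag_certificate (a b c d : ℂ) :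
    vamosDiag a b c d * conj (vamosInterlacer a b c d)
        - conj (vamosDiag a b c d) * vamosInterlacer a b c d =
      ((2 * (a.im * (4 * ‖c * (b * (a + b + c) + d * (a + c + d))
              + a * b * d + 3 * b * c * d + b * d * (b + d)‖ ^ 2
            + ‖2 * (a * b * d + b * c * d) + 3 / 2 * (b * d * (b + d))‖ ^ 2
            + 1 / 4 * ‖b * d * (b + d)‖ ^ 2
            + 1 / 2 * ‖b * d * (b - d)‖ ^ 2)
          + c.im * (4 * ‖a * (b * (a + b + c) + d * (a + c + d))
              + c * b * d + 3 * b * a * d + b * d * (b + d)‖ ^ 2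
            + ‖2 * (a * b * d + b * c * d) + 3 / 2 * (b * d * (b + d))‖ ^ 2
            + 1 / 4 * ‖b * d * (b + d)‖ ^ 2
            + 1 / 2 * ‖b * d * (b - d)‖ ^ 2)
          + b.im * (‖2 * a * d * (a + c + d) + 2 * a * b * d + 1 / 2 * b * d ^ 2‖ ^ 2
            + ‖2 * c * d * (a + c + d) + 2 * c * b * d + 1 / 2 * b * d ^ 2‖ ^ 2
            + ‖a * b * d + b * c * d + b * d ^ 2‖ ^ 2
            + 1 / 2 * ‖b * d ^ 2‖ ^ 2)
          + d.im * (‖2 * a * b * (a + c + b) + 2 * a * b * d + 1 / 2 * d * b ^ 2‖ ^ 2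
            + ‖2 * c * b * (a + c + b) + 2 * c * b * d + 1 / 2 * d * b ^ 2‖ ^ 2
            + ‖a * b * d + b * c * d + d * b ^ 2‖ ^ 2
            + 1 / 2 * ‖d * b ^ 2‖ ^ 2)) : ℝ) : ℂ) * Complex.I := by
  have him (z : ℂ) : (z.im : ℂ) * (2 * Complex.I) = z - conj z := by
    rw [Complex.sub_conj]; push_cast; ring
  have key (x y z w X Y Z W : ℂ) : (2 * (x * X + y * Y + z * Z + w * W)) * Complex.I
      = x * (2 * Complex.I) * X + y * (2 * Complex.I) * Y + z * (2 * Complex.I) * Z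
        + w * (2 * Complex.I) * W := by ring
  push_cast
  rw [key]
  simp only [him, ← Complex.mul_conj']
  simp only [vamosDiag, vamosInterlacer, map_add, map_mul, map_sub, map_pow, map_div₀, map_one,
    Complex.conj_ofNat]
  ring

lemma vamosDiag_ne_zero {a b c d : ℂ} (ha : 0 < a.im) (hb : 0 < b.im) (hc : 0 < c.im)
    (hd : 0 < d.im) : vamosDiag a b c d ≠ 0 := by
  intro h
  have key := vamosDiag_certificate a b c d
  rw [h, map_zero, zero_mul, zero_mul, sub_zero, eq_comm, mul_eq_zero,
    or_iff_left Complex.I_ne_zero, Complex.ofReal_eq_zero] at key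
  have hb0 : b ≠ 0 := by rintro rfl; simp at hb
  have hd0 : d ≠ 0 := by rintro rfl; simp at hd
  have hbd : b * d ^ 2 ≠ 0 := mul_ne_zero hb0 (pow_ne_zero 2 hd0)
  exact absurd key (ne_of_gt (by positivity))

/-- The Grace–Walsh–Szegő coincidence theorem for the upper half-plane and two variables. -/
lemma exists_im_pos_coincidence {α β γ x y : ℂ} (hx : 0 < x.im) (hy : 0 < y.im)
    (h : α + β * (x + y) + γ * (x * y) = 0) :
    ∃ ζ : ℂ, 0 < ζ.im ∧ α + β * (ζ + ζ) + γ * (ζ * ζ) = 0 := by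
  rcases eq_or_ne γ 0 with rfl | hγ
  · refine ⟨(x + y) / 2, ?_, by linear_combination h⟩
    have : ((x + y) / 2).im = (x.im + y.im) / 2 := by
      rw [show (x + y) / 2 = (x + y) * ((1 / 2 : ℝ) : ℂ) by push_cast; ring, Complex.im_mul_ofReal]
      simp; ring
    rw [this]; positivity
  · obtain ⟨w, hw⟩ := IsAlgClosed.exists_pow_nat_eq (β ^ 2 - γ * α) two_pos
    by_contra! hne
    have root (s : ℂ) (hs : s ^ 2 = β ^ 2 - γ * α) : ((-β + s) / γ).im ≤ 0 := by
      by_contra! hlt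
      refine hne _ hlt ?_
      field_simp
      linear_combination hs
    have h₁ := root w hw
    have h₂ := root (-w) (by rw [neg_sq, hw])
    set P := x - (-β + w) / γ with hP
    set R := x - (-β + -w) / γ with hR
    have hPim : x.im ≤ P.im := by rw [hP, Complex.sub_im]; linarith
    have hRim : x.im ≤ R.im := by rw [hR, Complex.sub_im]; linarith
    have hPR : (y - x) * (P + R) + 2 * (P * R) = 0 := by
      have : γ * ((y - x) * (P + R) + 2 * (P * R)) = 0 := by
        rw [hP, hR]
        field_simp
        linear_combination (2 * γ) * h - 2 * hw
      exact (mul_eq_zero.1 this).resolve_left hγ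
    have hre := congrArg Complex.re hPR
    have him := congrArg Complex.im hPR
    simp only [Complex.add_re, Complex.add_im, Complex.mul_re, Complex.mul_im, Complex.sub_re,
      Complex.sub_im, Complex.re_ofNat, Complex.im_ofNat, Complex.zero_re, Complex.zero_im] at hre him
    obtain ⟨p, p'⟩ := P
    obtain ⟨r, r'⟩ := R
    simp only at hre him hPim hRim
    have h1 : (y.im - x.im) * ((p + r) ^ 2 + (p' + r') ^ 2)
        = -2 * ((p ^ 2 + p' ^ 2) * r' + (r ^ 2 + r' ^ 2) * p') := by
      linear_combination (p + r) * him - (p' + r') * hre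
    have h2 : x.im * ((p + r) ^ 2 + (p' + r') ^ 2)
        ≤ 2 * ((p ^ 2 + p' ^ 2) * r' + (r ^ 2 + r' ^ 2) * p') := by
      nlinarith [mul_le_mul_of_nonneg_left hRim (by positivity : 0 ≤ p ^ 2 + p' ^ 2),
        mul_le_mul_of_nonneg_left hPim (by positivity : 0 ≤ r ^ 2 + r' ^ 2),
        mul_nonneg hx.le (sq_nonneg (p - r)), mul_nonneg hx.le (sq_nonneg (p' - r'))]
    have h3 : 0 < y.im * ((p + r) ^ 2 + (p' + r') ^ 2) :=
      mul_pos hy (add_pos_of_nonneg_of_pos (sq_nonneg _) (pow_pos (by linarith) 2))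
    linarith

lemma sum_vamosBases_eq {R : Type*} [CommRing R] (z : Fin 8 → R) :
    ∑ S ∈ vamosBases, ∏ j ∈ S, z j =
      (z 1 * z 5) * (z 3 * z 7)
      + (z 0 * z 4) * ((z 1 + z 5) * (z 2 + z 6) + (z 1 + z 5) * (z 3 + z 7)
        + (z 2 + z 6) * (z 3 + z 7))
      + (z 1 * z 5) * ((z 0 + z 4) * (z 2 + z 6) + (z 0 + z 4) * (z 3 + z 7)
        + (z 2 + z 6) * (z 3 + z 7))
      + (z 2 * z 6) * ((z 0 + z 4) * (z 1 + z 5) + (z 0 + z 4) * (z 3 + z 7)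
        + (z 1 + z 5) * (z 3 + z 7))
      + (z 3 * z 7) * ((z 0 + z 4) * (z 1 + z 5) + (z 0 + z 4) * (z 2 + z 6)
        + (z 1 + z 5) * (z 2 + z 6))
      + (z 0 + z 4) * (z 1 + z 5) * (z 2 + z 6) * (z 3 + z 7) := by
  have hsub : ({({0, 4, 1, 5} : Finset (Fin 8)), {1, 5, 2, 6}, {2, 6, 3, 7}, {3, 7, 0, 4},
      {0, 4, 2, 6}} : Finset (Finset (Fin 8))) ⊆ Finset.powersetCard 4 Finset.univ := by decide
  have hsum := Finset.sum_sdiff (f := fun S => ∏ j ∈ S, z j) hsub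
  have hesymm : ∑ S ∈ Finset.powersetCard 4 (Finset.univ : Finset (Fin 8)), ∏ j ∈ S, z j
      = (([z 0, z 1, z 2, z 3, z 4, z 5, z 6, z 7] : List R) : Multiset R).esymm 4 := by
    rw [← Finset.esymm_map_val]
    rfl
  have hfive : ∑ S ∈ {({0, 4, 1, 5} : Finset (Fin 8)), {1, 5, 2, 6}, {2, 6, 3, 7}, {3, 7, 0, 4},
      {0, 4, 2, 6}}, ∏ j ∈ S, z j = z 0 * z 4 * (z 1 * z 5) + z 1 * z 5 * (z 2 * z 6)
        + z 2 * z 6 * (z 3 * z 7) + z 3 * z 7 * (z 0 * z 4) + z 0 * z 4 * (z 2 * z 6) := by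
    have prod_four (i j k l : Fin 8) (h₁ : i ∉ ({j, k, l} : Finset (Fin 8)))
        (h₂ : j ∉ ({k, l} : Finset (Fin 8))) (h₃ : k ∉ ({l} : Finset (Fin 8))) :
        ∏ m ∈ {i, j, k, l}, z m = z i * z j * (z k * z l) := by
      rw [Finset.prod_insert h₁, Finset.prod_insert h₂, Finset.prod_insert h₃,
        Finset.prod_singleton, mul_assoc]
    repeat rw [Finset.sum_insert (by decide)]
    rw [Finset.sum_singleton]
    repeat rw [prod_four _ _ _ _ (by decide) (by decide) (by decide)]
    ring
  rw [hesymm, hfive] at hsum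
  simp only [Multiset.esymm, Multiset.powersetCard_coe, List.sublistsLen_succ_cons,
    List.sublistsLen_zero, List.sublistsLen_succ_nil, List.map_cons, List.map_nil,
    List.nil_append, List.cons_append, Multiset.map_coe, Multiset.prod_coe, Multiset.sum_coe,
    List.prod_cons, List.prod_nil, List.sum_cons, List.sum_nil] at hsum
  rw [vamosBases]
  linear_combination hsum

lemma sum_vamosBases_ne_zero {z : Fin 8 → ℂ} (hz : ∀ i, 0 < (z i).im) :
    ∑ S ∈ vamosBases, ∏ j ∈ S, z j ≠ 0 := by
  rw [sum_vamosBases_eq]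
  intro h
  have step {x y : ℂ} (hx : 0 < x.im) (hy : 0 < y.im) (f : ℂ → ℂ → ℂ)
      (hf : ∀ s u, f s u = f 0 0 + (f 1 0 - f 0 0) * s + (f 0 1 - f 0 0) * u)
      (h : f (x + y) (x * y) = 0) : ∃ ζ : ℂ, 0 < ζ.im ∧ f (ζ + ζ) (ζ * ζ) = 0 := by
    rw [hf] at h
    obtain ⟨ζ, hζ, h0⟩ := exists_im_pos_coincidence hx hy h
    exact ⟨ζ, hζ, (hf _ _).trans h0⟩
  generalize hf : (fun sa ua sb ub sc uc sd ud : ℂ => ub * ud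
      + ua * (sb * sc + sb * sd + sc * sd) + ub * (sa * sc + sa * sd + sc * sd)
      + uc * (sa * sb + sa * sd + sb * sd) + ud * (sa * sb + sa * sc + sb * sc)
      + sa * sb * sc * sd) = f
  have h' : f (z 0 + z 4) (z 0 * z 4) (z 1 + z 5) (z 1 * z 5) (z 2 + z 6) (z 2 * z 6)
    (z 3 + z 7) (z 3 * z 7) = 0 := by rw [← h, ← hf]
  obtain ⟨a, ha, h₁⟩ := step (hz 0) (hz 4) (fun s u => f s u (z 1 + z 5) (z 1 * z 5)
    (z 2 + z 6) (z 2 * z 6) (z 3 + z 7) (z 3 * z 7)) (fun s u => by rw [← hf]; ring) h'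
  obtain ⟨b, hb, h₂⟩ := step (hz 1) (hz 5) (fun s u => f (a + a) (a * a) s u
    (z 2 + z 6) (z 2 * z 6) (z 3 + z 7) (z 3 * z 7)) (fun s u => by rw [← hf]; ring) h₁
  obtain ⟨c, hc, h₃⟩ := step (hz 2) (hz 6) (fun s u => f (a + a) (a * a) (b + b) (b * b) s u
    (z 3 + z 7) (z 3 * z 7)) (fun s u => by rw [← hf]; ring) h₂
  obtain ⟨d, hd, h₄⟩ := step (hz 3) (hz 7)
    (f (a + a) (a * a) (b + b) (b * b) (c + c) (c * c)) (fun s u => by rw [← hf]; ring) h₃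
  refine vamosDiag_ne_zero ha hb hc hd ?_
  rw [← h₄, ← hf, vamosDiag]
  ring

open MvPolynomial in
lemma isRZ_vamos : IsRZ (∑ S ∈ vamosBases, ∏ j ∈ S, (X j + 1) : MvPolynomial (Fin 8) ℝ) 0 := by
  intro x t ht
  simp only [Pi.zero_apply, Complex.ofReal_zero, zero_add, map_sum, map_prod, map_add, aeval_X,
    map_one] at ht
  by_contra him
  have ht0 : t ≠ 0 := by rintro rfl; simp at him
  have hcard {S : Finset (Fin 8)} (hS : S ∈ vamosBases) : S.card = 4 :=
    (Finset.mem_powersetCard.1 (Finset.mem_sdiff.1 hS).1).2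
  have hscale (ε : ℂ) (hε : ε ^ 4 = 1) :
      ∑ S ∈ vamosBases, ∏ j ∈ S, ε * ((x j : ℂ) + t⁻¹) = 0 := by
    have : t ^ 4 * ∑ S ∈ vamosBases, ∏ j ∈ S, ε * ((x j : ℂ) + t⁻¹) = 0 := by
      rw [← ht, Finset.mul_sum]
      refine Finset.sum_congr rfl fun S hS => ?_
      rw [Finset.prod_mul_distrib, Finset.prod_const, hcard hS, hε, one_mul, ← hcard hS,
        ← Finset.prod_const, ← Finset.prod_mul_distrib]
      exact Finset.prod_congr rfl fun j _ => by field_simp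
    exact (mul_eq_zero.1 this).resolve_left (pow_ne_zero 4 ht0)
  have hn : 0 < Complex.normSq t := Complex.normSq_pos.2 ht0
  rcases lt_or_gt_of_ne him with hneg | hpos
  · refine sum_vamosBases_ne_zero (fun i => ?_) (hscale 1 (one_pow 4))
    simpa [Complex.inv_im] using div_pos (neg_pos.2 hneg) hn
  · refine sum_vamosBases_ne_zero (fun i => ?_) (hscale (-1) (by norm_num))
    simpa [Complex.inv_im, neg_div] using div_pos hpos hn

lemma Matrix.IsHermitian.det_one_add_smul_eq_prod {n : Type*} [Fintype n] [DecidableEq n]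
    {M : Matrix n n ℝ} (hM : M.IsHermitian) (t : ℝ) :
    (1 + t • M).det = ∏ i, (1 + t * hM.eigenvalues i) := by
  have h : 1 + t • M = Unitary.conjStarAlgAut ℝ _ hM.eigenvectorUnitary
      (1 + t • diagonal hM.eigenvalues) := by
    rw [map_add, map_one, map_smul]
    congr 2
    exact hM.spectral_theorem
  rw [h, Unitary.conjStarAlgAut_apply, det_mul_comm, ← mul_assoc, Unitary.coe_star_mul_self,
    one_mul, ← diagonal_one, ← diagonal_smul, diagonal_add, det_diagonal]
  simp

open Polynomial in
lemma Matrix.IsHermitian.rank_eq_natDegree_of_det {n : Type*} [Fintype n] [DecidableEq n]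
    {M : Matrix n n ℝ} (hM : M.IsHermitian) {c : ℝ} (hc : c ≠ 0) {P : ℝ[X]}
    (h : ∀ t : ℝ, (1 + t • M).det = c * P.eval t) : M.rank = P.natDegree := by
  have hP : C c * P = ∏ i, (1 + X * C (hM.eigenvalues i)) := by
    refine Polynomial.funext fun t => ?_
    rw [eval_mul, eval_C, ← h, hM.det_one_add_smul_eq_prod, eval_prod]
    simp only [eval_add, eval_one, eval_mul, eval_X, eval_C]
  have hdeg (a : ℝ) : (1 + X * C a : ℝ[X]).natDegree = if a ≠ 0 then 1 else 0 := by
    split_ifs with ha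
    · compute_degree!
    · simp [not_not.1 ha]
  have hne (a : ℝ) : (1 + X * C a : ℝ[X]) ≠ 0 := fun h0 => by
    simpa using congrArg (eval 0) h0
  rw [← natDegree_C_mul hc, hP, natDegree_prod _ _ fun i _ => hne _, hM.rank_eq_card_non_zero_eigs,
    Fintype.card_subtype, Finset.card_filter]
  exact Finset.sum_congr rfl fun i _ => (hdeg _).symm

lemma Matrix.IsHermitian.posSemidef_of_det_ne_zero {n : Type*} [Fintype n] [DecidableEq n]
    {M : Matrix n n ℝ} (hM : M.IsHermitian) (h : ∀ t : ℝ, 0 < t → (1 + t • M).det ≠ 0) :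
    M.PosSemidef := by
  refine hM.posSemidef_iff_eigenvalues_nonneg.2 fun i => ?_
  by_contra! hi
  refine h (-(hM.eigenvalues i)⁻¹) (neg_pos.2 (inv_lt_zero.2 hi)) ?_
  rw [hM.det_one_add_smul_eq_prod]
  refine Finset.prod_eq_zero (Finset.mem_univ i) ?_
  rw [neg_mul, inv_mul_cancel₀ (ne_of_lt hi), add_neg_cancel]

open scoped MatrixOrder Matrix in
lemma Matrix.PosDef.exists_isUnit_eq_transpose_mul_self {n : Type*} [Fintype n] [DecidableEq n]
    {M : Matrix n n ℝ} (hM : M.PosDef) : ∃ B : Matrix n n ℝ, IsUnit B ∧ M = Bᵀ * B := by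
  obtain ⟨B, hB, h⟩ := CStarAlgebra.isStrictlyPositive_iff_eq_star_mul_self.1 hM.isStrictlyPositive
  exact ⟨B, hB, h⟩

open scoped Matrix in
/-- A definite determinantal representation can be normalized to a monic one. -/
lemma exists_isSymm_det_one_add {n ι : Type*} [Fintype n] [DecidableEq n] [Fintype ι]
    {A₀ : Matrix n n ℝ} (h₀ : A₀.PosDef) {A : ι → Matrix n n ℝ} (hA : ∀ i, (A i).IsSymm) :
    ∃ N : ι → Matrix n n ℝ, (∀ i, (N i).IsSymm) ∧ ∃ c : ℝ, c ≠ 0 ∧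
      ∀ y : ι → ℝ, (1 + ∑ i, y i • N i).det = c * (A₀ + ∑ i, y i • A i).det := by
  obtain ⟨B, hB, rfl⟩ := h₀.exists_isUnit_eq_transpose_mul_self
  obtain ⟨u, rfl⟩ := hB
  set D : Matrix n n ℝ := ↑u⁻¹ with hD
  have hDet : D.det ≠ 0 := (Matrix.isUnit_iff_isUnit_det D).1 u⁻¹.isUnit |>.ne_zero
  have h1 : (u : Matrix n n ℝ) * D = 1 := u.mul_inv
  refine ⟨fun i => Dᵀ * A i * D, fun i => ?_, D.det ^ 2, pow_ne_zero 2 hDet, fun y => ?_⟩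
  · simp only [Matrix.IsSymm, Matrix.transpose_mul, Matrix.transpose_transpose,
      (hA i).eq, mul_assoc]
  · have : 1 + ∑ i, y i • (Dᵀ * A i * D)
        = Dᵀ * ((u : Matrix n n ℝ)ᵀ * u + ∑ i, y i • A i) * D := by
      rw [mul_add, add_mul, Finset.mul_sum, Finset.sum_mul]
      congr 1
      · rw [← mul_assoc, ← Matrix.transpose_mul, h1, mul_assoc, h1, Matrix.transpose_one, mul_one]
      · simp
    rw [this, Matrix.det_mul, Matrix.det_mul, Matrix.det_transpose]
    ring

/-- The rank function of a matroid with the given bases. -/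
def basesRank {α : Type*} [DecidableEq α] (𝓑 : Finset (Finset α)) (S : Finset α) : ℕ :=
  𝓑.sup fun B => (B ∩ S).card

open Polynomial in
lemma natDegree_sum_one_add_X_pow {ι : Type*} (s : Finset ι) (e : ι → ℕ) :
    (∑ i ∈ s, (1 + X : ℝ[X]) ^ e i).natDegree = s.sup e := by
  rcases s.eq_empty_or_nonempty with rfl | hs
  · simp
  · refine natDegree_eq_of_le_of_coeff_ne_zero ?_ ?_
    · refine natDegree_sum_le_of_forall_le _ _ fun i hi => ?_
      refine (natDegree_pow_le_of_le (m := 1) _ (by compute_degree)).trans ?_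
      rw [mul_one]
      exact Finset.le_sup hi
    · obtain ⟨i, hi, h⟩ := Finset.exists_mem_eq_sup s hs e
      rw [finsetSum_coeff]
      refine (Finset.sum_pos' (fun j _ => ?_) ⟨i, hi, ?_⟩).ne'
      · rw [coeff_one_add_X_pow]; positivity
      · rw [h, coeff_one_add_X_pow, Nat.choose_self]; simp

/-- For matrices whose determinantal polynomial is a power of a shifted basis generating
polynomial, the ranks are governed by the rank function of the matroid. -/
lemma posSemidef_and_rank_sum {n α : Type*} [Fintype n] [DecidableEq n] [Fintype α]
    [DecidableEq α] {𝓑 : Finset (Finset α)} (h𝓑 : 𝓑.Nonempty) {r : ℕ} {N : α → Matrix n n ℝ}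
    (hN : ∀ i, (N i).IsSymm) {c : ℝ} (hc : c ≠ 0)
    (h : ∀ y : α → ℝ, (1 + ∑ i, y i • N i).det = c * (∑ S ∈ 𝓑, ∏ j ∈ S, (y j + 1)) ^ r)
    (S : Finset α) :
    (∑ i ∈ S, N i).PosSemidef ∧ (∑ i ∈ S, N i).rank = r * basesRank 𝓑 S := by
  have hH : (∑ i ∈ S, N i).IsHermitian := by
    rw [Matrix.IsHermitian, Matrix.conjTranspose_sum]
    exact Finset.sum_congr rfl fun i _ => hN i
  have hdet (t : ℝ) : (1 + t • ∑ i ∈ S, N i).det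
      = c * ((∑ B ∈ 𝓑, (1 + Polynomial.X) ^ (B ∩ S).card) ^ r : Polynomial ℝ).eval t := by
    have := h fun i => if i ∈ S then t else 0
    simp only [ite_smul, zero_smul, Finset.sum_ite_mem, Finset.univ_inter] at this
    rw [Finset.smul_sum, this, Polynomial.eval_pow, Polynomial.eval_finsetSum]
    congr 2
    refine Finset.sum_congr rfl fun B _ => ?_
    simp [ite_add, add_comm]
  refine ⟨hH.posSemidef_of_det_ne_zero fun t ht => ?_, ?_⟩
  · rw [hdet, Polynomial.eval_pow, Polynomial.eval_finsetSum]
    refine mul_ne_zero hc (pow_ne_zero r (Finset.sum_pos (fun B _ => ?_) h𝓑).ne')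
    simp only [Polynomial.eval_pow, Polynomial.eval_add, Polynomial.eval_one, Polynomial.eval_X]
    positivity
  · rw [hH.rank_eq_natDegree_of_det hc hdet, Polynomial.natDegree_pow,
      natDegree_sum_one_add_X_pow, basesRank]

lemma Matrix.PosSemidef.ker_add {n : Type*} [Fintype n] {A B : Matrix n n ℝ} (hA : A.PosSemidef)
    (hB : B.PosSemidef) : (A + B).mulVecLin.ker = A.mulVecLin.ker ⊓ B.mulVecLin.ker := by
  ext x
  simp only [Submodule.mem_inf, LinearMap.mem_ker, mulVecLin_apply]
  rw [← hA.dotProduct_mulVec_zero_iff, ← hB.dotProduct_mulVec_zero_iff,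
    ← (hA.add hB).dotProduct_mulVec_zero_iff, add_mulVec, dotProduct_add]
  exact add_eq_zero_iff_of_nonneg (hA.dotProduct_mulVec_nonneg x) (hB.dotProduct_mulVec_nonneg x)

/-- A dual form of Ingleton's inequality, in the extremal case that rules out the Vámos matroid. -/
lemma ingleton_of_finrank {V : Type*} [AddCommGroup V] [Module ℝ V] [FiniteDimensional ℝ V]
    {P Q R T : Submodule ℝ V} {r n : ℕ}
    (hP : Module.finrank ℝ P + 2 * r = n) (hQ : Module.finrank ℝ Q + 2 * r = n)
    (hR : Module.finrank ℝ R + 2 * r = n) (hT : Module.finrank ℝ T + 2 * r = n)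
    (hPQ : Module.finrank ℝ (P ⊓ Q : Submodule ℝ V) + 3 * r = n)
    (hPR : Module.finrank ℝ (P ⊓ R : Submodule ℝ V) + 3 * r = n)
    (hQR : Module.finrank ℝ (Q ⊓ R : Submodule ℝ V) + 3 * r = n)
    (hPT : Module.finrank ℝ (P ⊓ T : Submodule ℝ V) + 3 * r = n)
    (hQT : Module.finrank ℝ (Q ⊓ T : Submodule ℝ V) + 3 * r = n)
    (hPQR : Module.finrank ℝ (P ⊓ Q ⊓ R : Submodule ℝ V) + 4 * r = n)
    (hPQT : Module.finrank ℝ (P ⊓ Q ⊓ T : Submodule ℝ V) + 4 * r = n)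
    (hRT : Module.finrank ℝ (R ⊓ T : Submodule ℝ V) + 4 * r = n) : r = 0 := by
  have le_sup {W : Submodule ℝ V} (hW : Module.finrank ℝ W + 2 * r = n)
      (hPW : Module.finrank ℝ (P ⊓ W : Submodule ℝ V) + 3 * r = n)
      (hQW : Module.finrank ℝ (Q ⊓ W : Submodule ℝ V) + 3 * r = n)
      (hPQW : Module.finrank ℝ (P ⊓ Q ⊓ W : Submodule ℝ V) + 4 * r = n) : W ≤ P ⊔ Q := by
    have hdim := Submodule.finrank_sup_add_finrank_inf_eq (P ⊓ W) (Q ⊓ W)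
    rw [← inf_inf_distrib_right] at hdim
    rw [← Submodule.eq_of_le_of_finrank_eq (sup_le inf_le_right inf_le_right :
      P ⊓ W ⊔ Q ⊓ W ≤ W) (by lia)]
    exact sup_le_sup inf_le_left inf_le_left
  have hle := Submodule.finrank_mono (sup_le (le_sup hR hPR hQR hPQR) (le_sup hT hPT hQT hPQT))
  have h₁ := Submodule.finrank_sup_add_finrank_inf_eq P Q
  have h₂ := Submodule.finrank_sup_add_finrank_inf_eq R T
  lia

lemma vamos_power_not_determinantal {n r : ℕ} (hr : 0 < r) {N : Fin 8 → Matrix (Fin n) (Fin n) ℝ}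
    (hN : ∀ i, (N i).IsSymm) {c : ℝ} (hc : c ≠ 0)
    (h : ∀ y : Fin 8 → ℝ,
      (1 + ∑ i, y i • N i).det = c * (∑ S ∈ vamosBases, ∏ j ∈ S, (y j + 1)) ^ r) : False := by
  have key := posSemidef_and_rank_sum ⟨{0, 1, 2, 3}, by decide⟩ hN hc h
  let K (S : Finset (Fin 8)) : Submodule ℝ (Fin n → ℝ) := (∑ i ∈ S, N i).mulVecLin.ker
  have hdim (S : Finset (Fin 8)) : Module.finrank ℝ (K S) + basesRank vamosBases S * r = n := by
    have := (∑ i ∈ S, N i).mulVecLin.finrank_range_add_finrank_ker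
    rw [← Matrix.rank, (key S).2, Module.finrank_fin_fun] at this
    rw [add_comm, mul_comm, this]
  have hK (S T : Finset (Fin 8)) (hST : Disjoint S T) : K S ⊓ K T = K (S ∪ T) := by
    rw [← (key S).1.ker_add (key T).1, ← Finset.sum_union hST]
  have h₁ (S : Finset (Fin 8)) {k : ℕ} (hk : basesRank vamosBases S = k) :
      Module.finrank ℝ (K S) + k * r = n := hk ▸ hdim S
  have h₂ (S T : Finset (Fin 8)) (hST : Disjoint S T) {k : ℕ}
      (hk : basesRank vamosBases (S ∪ T) = k) :
      Module.finrank ℝ (K S ⊓ K T : Submodule ℝ (Fin n → ℝ)) + k * r = n := by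
    rw [hK S T hST, h₁ _ hk]
  have h₃ (S T U : Finset (Fin 8)) (hST : Disjoint S T) (hU : Disjoint (S ∪ T) U) {k : ℕ}
      (hk : basesRank vamosBases (S ∪ T ∪ U) = k) :
      Module.finrank ℝ (K S ⊓ K T ⊓ K U : Submodule ℝ (Fin n → ℝ)) + k * r = n := by
    rw [hK S T hST, h₂ _ _ hU hk]
  exact hr.ne' (ingleton_of_finrank
    (h₁ {0, 4} (by decide +kernel)) (h₁ {2, 6} (by decide +kernel))
    (h₁ {1, 5} (by decide +kernel)) (h₁ {3, 7} (by decide +kernel))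
    (h₂ _ _ (by decide) (by decide +kernel)) (h₂ _ _ (by decide) (by decide +kernel))
    (h₂ _ _ (by decide) (by decide +kernel)) (h₂ _ _ (by decide) (by decide +kernel))
    (h₂ _ _ (by decide) (by decide +kernel))
    (h₃ _ _ _ (by decide) (by decide) (by decide +kernel))
    (h₃ _ _ _ (by decide) (by decide) (by decide +kernel))
    (h₂ _ _ (by decide) (by decide +kernel)))

open MvPolynomial in
/-- (Brändén) The Vámos polynomial `p = Σ_{S ∈ B(V₈)} Π_{j ∈ S} (x_j + 1)` is an RZ
polynomial with respect to `0`, and no power `p^r` (`r ≥ 1`) admits a determinantal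
representation `det(A_0 + Σ x_j A_j) = p^r` with real symmetric matrices `A_j` of any
size and `A_0` positive definite. -/
theorem stmt11 (p : MvPolynomial (Fin 8) ℝ)
    (hp : p = ∑ S ∈ vamosBases, ∏ j ∈ S, (X j + 1)) :
    IsRZ p 0 ∧
    ∀ r : ℕ, 0 < r →
      ¬ ∃ (n : ℕ) (A0 : Matrix (Fin n) (Fin n) ℝ)
          (A : Fin 8 → Matrix (Fin n) (Fin n) ℝ),
        A0.PosDef ∧ A0.IsSymm ∧ (∀ i, (A i).IsSymm) ∧
        Matrix.det (Matrix.of fun k l =>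
          C (A0 k l) + ∑ i, X i * C (A i k l)) = p ^ r := by
  subst hp
  refine ⟨isRZ_vamos, ?_⟩
  rintro r hr ⟨n, A0, A, hpos, -, hsymm, hdet⟩
  obtain ⟨N, hN, c, hc, h⟩ := exists_isSymm_det_one_add hpos hsymm
  refine vamos_power_not_determinantal hr hN hc fun y => ?_
  have heval := congrArg (eval y) hdet
  rw [RingHom.map_det, map_pow, map_sum] at heval
  simp only [map_prod, map_add, eval_X, map_one] at heval
  rw [h, ← heval]
  congr 2
  ext k l
  simp [Matrix.sum_apply]
end
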